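/- Fix b with 0 < b ≤ 1 and set C_b := ( 1 + 2 ∫_{0}^{1} α(1−α)/cosh(bα) dα ) / ( 2 ∫_{0}^{1} (1−α)/cosh(bα) dα ). Assume that for all sufficiently large T, every nontrivial zero ρ = β + iγ of the Riemann zeta function with T < γ ≤ 2T satisfies |β − 1/2| < b/(2 log T). Then, as T → ∞, Σ_{ρ : T<γ≤2T} m_ρ + Σ_{ρ : T<γ≤2T, β ≠ 1/2} m_ρ ≤ (C_b + o(1)) · (T/(2π)) log T, where m_ρ denotes the multiplicity of the zero ρ and the sums run over nontrivial zeros ρ = β + iγ of ζ counted with multiplicity. -/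

import Mathlib

open Filter Topology MeasureTheory Set

/-- The multiplicity of `ρ` as a zero of the Riemann zeta function:
the least `n` such that the `n`-th iterated derivative of `ζ` is nonzero at `ρ`. -/
noncomputable def zetaMult (ρ : ℂ) : ℕ :=
  sInf {n : ℕ | iteratedDeriv n riemannZeta ρ ≠ 0}

/-- `ρ` is a nontrivial zero of the Riemann zeta function. -/
def IsNontrivialZero (ρ : ℂ) : Prop :=
  riemannZeta ρ = 0 ∧ 0 < ρ.re ∧ ρ.re < 1

/-- The set of nontrivial zeros `ρ = β + iγ` with `T < γ ≤ 2T`. -/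
def zeroBand (T : ℝ) : Set ℂ :=
  {ρ | IsNontrivialZero ρ ∧ T < ρ.im ∧ ρ.im ≤ 2 * T}

/-- Number of nontrivial zeros with `T < γ ≤ 2T`, counted with multiplicity. -/
noncomputable def Ntot (T : ℝ) : ℝ :=
  ∑ᶠ ρ ∈ zeroBand T, (zetaMult ρ : ℝ)

/-- Number of simple nontrivial zeros with `T < γ ≤ 2T`. -/
noncomputable def Nsimple (T : ℝ) : ℝ :=
  ∑ᶠ ρ ∈ {ρ ∈ zeroBand T | zetaMult ρ = 1}, (1 : ℝ)

/-- Number of nontrivial zeros with `T < γ ≤ 2T` on the critical line, with multiplicity. -/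
noncomputable def Nline (T : ℝ) : ℝ :=
  ∑ᶠ ρ ∈ {ρ ∈ zeroBand T | ρ.re = 1/2}, (zetaMult ρ : ℝ)

/-- Number of simple critical-line nontrivial zeros with `T < γ ≤ 2T`. -/
noncomputable def NlineSimple (T : ℝ) : ℝ :=
  ∑ᶠ ρ ∈ {ρ ∈ zeroBand T | ρ.re = 1/2 ∧ zetaMult ρ = 1}, (1 : ℝ)

lemma integral_exp_neg_mul_cos' (e : ℝ) (he : 0 < e) (k : ℝ) :
    ∫ v in Ioi (0:ℝ), Real.exp (-e * v) * Real.cos (k * v) = e / (e ^ 2 + k ^ 2) := by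
  have h := integral_exp_mul_complex_Ioi (a := (⟨-e, k⟩ : ℂ)) (by simpa using he) 0
  have hi := integrableOn_exp_mul_complex_Ioi (a := (⟨-e, k⟩ : ℂ)) (by simpa using he) 0
  have h2 : ∫ v in Ioi (0:ℝ), (Complex.exp ((⟨-e, k⟩ : ℂ) * v)).re = e / (e ^ 2 + k ^ 2) := by
    have := integral_re (𝕜 := ℂ) hi
    simp only [RCLike.re_eq_complex_re] at this
    rw [this, h]
    simp only [Complex.ofReal_zero, mul_zero, Complex.exp_zero]
    rw [Complex.div_re]
    simp [Complex.normSq_apply]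
    ring_nf
  rw [← h2]
  refine integral_congr_ae (Eventually.of_forall fun v => ?_)
  simp [Complex.exp_re]

lemma integrableOn_exp_neg (e : ℝ) (he : 0 < e) :
    IntegrableOn (fun v : ℝ => Real.exp (-e * v)) (Ioi 0) :=
  integrableOn_exp_mul_Ioi (by linarith) 0

/-- cosine positivity -/
def CosPos (θ : ℝ) (f : ℝ → ℝ) : Prop := ∀ y : ℝ, 0 ≤ ∫ x in (0:ℝ)..θ, f x * Real.cos (y * x)

lemma cosPos_swap (θ : ℝ) (hθ : 0 < θ) (f : ℝ → ℝ) (hf : Continuous f) (e : ℝ) (he : 0 < e) (a : ℝ) :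
    ∫ x in (0:ℝ)..θ, f x * (e / (e ^ 2 + (a * x) ^ 2)) =
    ∫ v in Ioi (0:ℝ), Real.exp (-e * v) * ∫ x in (0:ℝ)..θ, f x * Real.cos (a * x * v) := by
  simp_rw [← integral_exp_neg_mul_cos' e he, ← intervalIntegral.integral_const_mul,
    intervalIntegral.integral_of_le hθ.le, ← MeasureTheory.integral_const_mul]
  rw [integral_integral_swap]
  · refine integral_congr_ae (Eventually.of_forall fun v => ?_)
    refine integral_congr_ae (Eventually.of_forall fun x => ?_)
    simp only []
    ring
  · have h1 : IntegrableOn f (Ioc 0 θ) := (hf.integrableOn_Icc (a := 0) (b := θ)).mono_set Ioc_subset_Icc_self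
    have h2 := integrableOn_exp_neg e he
    have h3 := h1.integrable.mul_prod h2.integrable
    have := h3.mul_bdd (c := 1) (g := fun p : ℝ × ℝ => Real.cos (a * p.1 * p.2))
      (Continuous.aestronglyMeasurable (by fun_prop))
      (Eventually.of_forall fun p => by simpa using Real.abs_cos_le_one _)
    refine this.congr (Eventually.of_forall fun p => ?_)
    simp only [Function.uncurry]
    ring

lemma cosPos_step (θ : ℝ) (hθ : 0 < θ) (f : ℝ → ℝ) (hf : Continuous f) (h : CosPos θ f) (a : ℝ) :
    CosPos θ (fun x => f x * (1 / (1 + (a * x) ^ 2))) := by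
  intro y
  have h1 := cosPos_swap θ hθ (fun x => f x * Real.cos (y * x)) (by fun_prop) 1 one_pos a
  have h2 : ∫ x in (0:ℝ)..θ, (f x * (1 / (1 + (a * x) ^ 2))) * Real.cos (y * x)
     = ∫ x in (0:ℝ)..θ, (f x * Real.cos (y * x)) * (1 / (1 ^ 2 + (a * x) ^ 2)) := by
    congr 1; ext x; ring
  rw [h2, h1]
  refine integral_nonneg fun v => mul_nonneg (Real.exp_pos _).le ?_
  have h3 : ∫ x in (0:ℝ)..θ, f x * Real.cos (y * x) * Real.cos (a * x * v)
     = (∫ x in (0:ℝ)..θ, f x * Real.cos ((y + a * v) * x)) / 2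
      + (∫ x in (0:ℝ)..θ, f x * Real.cos ((y - a * v) * x)) / 2 := by
    rw [← add_div, ← intervalIntegral.integral_add, ← intervalIntegral.integral_div]
    · congr 1; ext x
      rw [show (y + a * v) * x = y * x + a * x * v by ring,
        show (y - a * v) * x = y * x - a * x * v by ring, Real.cos_add, Real.cos_sub]
      ring
    · exact Continuous.intervalIntegrable (by fun_prop) _ _
    · exact Continuous.intervalIntegrable (by fun_prop) _ _
  rw [h3]
  have := h (y + a * v)
  have := h (y - a * v)
  positivity

lemma cosPos_step2 (θ : ℝ) (hθ : 0 < θ) (f : ℝ → ℝ) (hf : Continuous f) (h : CosPos θ f) (b c l : ℝ)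
    (hb : 0 < b) (hc : 0 ≤ c) (hcb : c ≤ b) :
    CosPos θ (fun x => f x * ((1 + (c * x) ^ 2 * l ^ 2) / (1 + (b * x) ^ 2 * l ^ 2))) := by
  intro y
  have h1 := cosPos_step θ hθ f hf h (b * l) y
  have h2 := h y
  have e : ∫ x in (0:ℝ)..θ, (f x * ((1 + (c * x) ^ 2 * l ^ 2) / (1 + (b * x) ^ 2 * l ^ 2))) * Real.cos (y * x)
     = (c / b) ^ 2 * (∫ x in (0:ℝ)..θ, f x * Real.cos (y * x))
      + (1 - (c / b) ^ 2) * (∫ x in (0:ℝ)..θ, (f x * (1 / (1 + (b * l * x) ^ 2))) * Real.cos (y * x)) := by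
    have hpos : ∀ x : ℝ, 1 + (b * l * x) ^ 2 ≠ 0 := fun x => by positivity
    rw [← intervalIntegral.integral_const_mul, ← intervalIntegral.integral_const_mul,
      ← intervalIntegral.integral_add]
    · congr 1; ext x
      have h3 := hpos x
      have h4 : 1 + (b * x) ^ 2 * l ^ 2 ≠ 0 := by positivity
      field_simp
      ring
    · exact Continuous.intervalIntegrable (by fun_prop) _ _
    · refine Continuous.intervalIntegrable ?_ _ _
      have : Continuous fun x : ℝ => 1 / (1 + (b * l * x) ^ 2) :=
        continuous_const.div (by fun_prop) hpos
      fun_prop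
  rw [e]
  have h5 : (c / b) ^ 2 ≤ 1 := by
    have : c / b ≤ 1 := by rw [div_le_one hb]; exact hcb
    have h0 : 0 ≤ c / b := by positivity
    nlinarith
  have : 0 ≤ 1 - (c / b) ^ 2 := by linarith
  positivity

noncomputable def coshProd (n : ℕ) (y : ℝ) : ℝ :=
  ∏ k ∈ Finset.range n, (1 + y ^ 2 * (2 / (Real.pi * (2 * k + 1))) ^ 2)

noncomputable def sinhProd (n : ℕ) (y : ℝ) : ℝ :=
  y * ∏ k ∈ Finset.range n, (1 + y ^ 2 / (Real.pi * (k + 1)) ^ 2)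

lemma sinhProd_tendsto (y : ℝ) : Tendsto (fun n => sinhProd n y) atTop (𝓝 (Real.sinh y)) := by
  have h := Complex.tendsto_euler_sin_prod (Complex.I * y / Real.pi)
  have hpi : (Real.pi : ℂ) ≠ 0 := by exact_mod_cast Real.pi_ne_zero
  have h1 : (Real.pi : ℂ) * (Complex.I * y / Real.pi) = y * Complex.I := by field_simp
  rw [h1, Complex.sin_mul_I] at h
  have h2 := (h.mul_const (-Complex.I))
  have h3 := (Complex.continuous_re.tendsto _).comp h2
  convert h3 using 1
  · ext n
    simp only [Function.comp, sinhProd]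
    have : ∀ j : ℕ, (1 - (Complex.I * y / Real.pi) ^ 2 / ((j:ℂ) + 1) ^ 2) =
      ((1 + y ^ 2 / (Real.pi * (j + 1)) ^ 2 : ℝ) : ℂ) := by
      intro j
      push_cast
      have : ((j:ℂ) + 1) ≠ 0 := by exact_mod_cast Nat.succ_ne_zero j
      rw [div_pow, mul_pow, Complex.I_sq]
      field_simp
      ring
    simp_rw [this]
    rw [← Complex.ofReal_prod, show (y:ℂ) * Complex.I * ((∏ j ∈ Finset.range n, (1 + y ^ 2 / (Real.pi * (j + 1)) ^ 2) : ℝ) : ℂ) * -Complex.I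
      = ((y * ∏ j ∈ Finset.range n, (1 + y ^ 2 / (Real.pi * (j + 1)) ^ 2) : ℝ) : ℂ) * (-(Complex.I * Complex.I)) by
        push_cast; ring]
    rw [Complex.I_mul_I, neg_neg, mul_one, Complex.ofReal_re]
  · congr 1
    rw [← Complex.ofReal_sinh, mul_assoc, mul_neg, Complex.I_mul_I, neg_neg, mul_one, Complex.ofReal_re]

lemma sinhProd_two (n : ℕ) (y : ℝ) : sinhProd (2 * n) (2 * y) = 2 * sinhProd n y * coshProd n y := by
  induction n with
  | zero => simp [sinhProd, coshProd]
  | succ n ih =>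
    simp only [sinhProd, coshProd] at ih ⊢
    rw [show 2 * (n + 1) = 2 * n + 1 + 1 by ring, Finset.prod_range_succ, Finset.prod_range_succ,
      Finset.prod_range_succ, Finset.prod_range_succ]
    have e1 : (1 + (2 * y) ^ 2 / (Real.pi * ((2 * n : ℕ) + 1)) ^ 2) =
      (1 + y ^ 2 * (2 / (Real.pi * (2 * n + 1))) ^ 2) := by
      push_cast
      rw [div_pow]; ring
    have e2 : (1 + (2 * y) ^ 2 / (Real.pi * ((2 * n + 1 : ℕ) + 1)) ^ 2) = (1 + y ^ 2 / (Real.pi * (n + 1)) ^ 2) := by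
      push_cast
      have : Real.pi ≠ 0 := Real.pi_ne_zero
      have : (n:ℝ) + 1 ≠ 0 := by positivity
      have : (2 * n:ℝ) + 1 + 1 ≠ 0 := by positivity
      field_simp
      ring
    rw [e1, e2]
    linear_combination (1 + y ^ 2 * (2 / (Real.pi * (2 * n + 1))) ^ 2) * (1 + y ^ 2 / (Real.pi * (n + 1)) ^ 2) * ih

lemma coshProd_tendsto (y : ℝ) : Tendsto (fun n => coshProd n y) atTop (𝓝 (Real.cosh y)) := by
  rcases eq_or_ne y 0 with rfl | hy
  · simp [coshProd]
  have h1 : Tendsto (fun n : ℕ => sinhProd (2 * n) (2 * y)) atTop (𝓝 (Real.sinh (2 * y))) :=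
    (sinhProd_tendsto (2 * y)).comp (tendsto_id.const_mul_atTop' two_pos)
  have h2 := (sinhProd_tendsto y).const_mul 2
  have hs : Real.sinh y ≠ 0 := by simpa using hy
  have h3 := h1.div h2 (mul_ne_zero two_ne_zero hs)
  have : Real.sinh (2 * y) / (2 * Real.sinh y) = Real.cosh y := by
    rw [Real.sinh_two_mul]; field_simp
  rw [this] at h3
  refine h3.congr fun n => ?_
  simp only [Pi.div_apply]
  rw [sinhProd_two]
  have : sinhProd n y ≠ 0 := by
    refine mul_ne_zero hy (Finset.prod_ne_zero_iff.mpr fun k _ => by positivity)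
  field_simp

lemma coshProd_pos (n : ℕ) (y : ℝ) : 0 < coshProd n y := Finset.prod_pos fun k _ => by positivity

lemma coshProd_continuous (n : ℕ) : Continuous (coshProd n) := by unfold coshProd; fun_prop

lemma cosPos_tri (θ : ℝ) (hθ : 0 < θ) : CosPos θ (fun x => 1 - x / θ) := by
  intro y
  rcases eq_or_ne y 0 with rfl | hy
  · refine intervalIntegral.integral_nonneg hθ.le fun x hx => ?_
    have : x / θ ≤ 1 := by rw [div_le_one hθ]; exact hx.2
    simpa using this
  have : ∫ x in (0:ℝ)..θ, (1 - x / θ) * Real.cos (y * x) = (1 - Real.cos (y * θ)) / (θ * y ^ 2) := by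
    have := intervalIntegral.integral_eq_sub_of_hasDerivAt
      (f := fun x => (1 - x / θ) * (Real.sin (y * x) / y) - Real.cos (y * x) / (θ * y ^ 2))
      (f' := fun x => (1 - x / θ) * Real.cos (y * x)) (a := 0) (b := θ) (fun x _ => by
        have h1 : HasDerivAt (fun x : ℝ => y * x) y x := by simpa using (hasDerivAt_id x).const_mul y
        have h2 := ((hasDerivAt_id x).div_const θ).const_sub 1
        have h3 := (h2.mul (h1.sin.div_const y)).sub (h1.cos.div_const (θ * y ^ 2))
        refine HasDerivAt.congr_deriv (f := fun x => (1 - x / θ) * (Real.sin (y * x) / y) - Real.cos (y * x) / (θ * y ^ 2)) h3 ?_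
        simp only [id]
        field_simp
        ring) (Continuous.intervalIntegrable (by fun_prop) _ _)
    rw [this]
    simp only [div_self hθ.ne']
    simp
    ring
  rw [this]
  have := Real.cos_le_one (y * θ)
  have : 0 ≤ 1 - Real.cos (y * θ) := by linarith
  positivity

lemma cosPos_prod (θ : ℝ) (hθ : 0 < θ) (b c : ℝ) (hb : 0 < b) (hc : 0 ≤ c) (hcb : c ≤ b) (n : ℕ) :
    CosPos θ (fun x => (1 - x / θ) * (coshProd n (c * x) / coshProd n (b * x))) := by
  induction n with
  | zero => simpa [coshProd] using cosPos_tri θ hθ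
  | succ n ih =>
    have hcont : Continuous fun x : ℝ => (1 - x / θ) * (coshProd n (c * x) / coshProd n (b * x)) := by
      have h1 : Continuous fun x : ℝ => coshProd n (c * x) / coshProd n (b * x) :=
        ((coshProd_continuous n).comp (by fun_prop)).div ((coshProd_continuous n).comp (by fun_prop))
          (fun x => (coshProd_pos n _).ne')
      fun_prop
    have := cosPos_step2 θ hθ _ hcont ih b c (2 / (Real.pi * (2 * n + 1))) hb hc hcb
    convert this using 2 with x
    simp only [coshProd, Finset.prod_range_succ]
    rw [mul_div_mul_comm]; ring

lemma cosPos_kernel (θ : ℝ) (hθ : 0 < θ) (b c : ℝ) (hb : 0 < b) (hc : |c| ≤ b) (y : ℝ) :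
    0 ≤ ∫ x in (0:ℝ)..θ, (1 - x / θ) * (Real.cosh (c * x) / Real.cosh (b * x)) * Real.cos (y * x) := by
  wlog hc0 : 0 ≤ c generalizing c
  · have := this (-c) (by simpa using hc) (by linarith)
    simpa using this
  rw [abs_of_nonneg hc0] at hc
  have hle : ∀ n x, coshProd n (c * x) / coshProd n (b * x) ≤ 1 := by
    intro n x
    rw [div_le_one (coshProd_pos n _)]
    refine Finset.prod_le_prod (fun k _ => by positivity) fun k _ => ?_
    have : (c * x) ^ 2 ≤ (b * x) ^ 2 := by
      rw [mul_pow, mul_pow]; gcongr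
    gcongr
  have hcont : ∀ n, Continuous fun x : ℝ => coshProd n (c * x) / coshProd n (b * x) := fun n =>
        ((coshProd_continuous n).comp (by fun_prop)).div ((coshProd_continuous n).comp (by fun_prop))
          (fun x => (coshProd_pos n _).ne')
  have h := intervalIntegral.tendsto_integral_filter_of_dominated_convergence (a := 0) (b := θ) (μ := volume)
    (l := atTop) (F := fun (n : ℕ) x => (1 - x / θ) * (coshProd n (c * x) / coshProd n (b * x)) * Real.cos (y * x))
    (f := fun x => (1 - x / θ) * (Real.cosh (c * x) / Real.cosh (b * x)) * Real.cos (y * x)) (fun _ => 1)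
    (Eventually.of_forall fun n => Continuous.aestronglyMeasurable (by have := hcont n; fun_prop))
    (Eventually.of_forall fun n => Eventually.of_forall fun x hx => by
      rw [uIoc_of_le hθ.le] at hx
      have h1 : x / θ ≤ 1 := by rw [div_le_one hθ]; exact hx.2
      have h2 : 0 ≤ x / θ := div_nonneg hx.1.le hθ.le
      have h3 := hle n x
      have h4 : 0 ≤ coshProd n (c * x) / coshProd n (b * x) := div_nonneg (coshProd_pos n _).le (coshProd_pos n _).le
      rw [norm_mul, norm_mul, Real.norm_eq_abs, Real.norm_eq_abs, Real.norm_eq_abs]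
      have a1 : |1 - x / θ| ≤ 1 := by rw [abs_le]; constructor <;> linarith
      have a2 : |coshProd n (c * x) / coshProd n (b * x)| ≤ 1 := by rw [abs_of_nonneg h4]; exact h3
      have a3 := Real.abs_cos_le_one (y * x)
      exact mul_le_one₀ (mul_le_one₀ a1 (abs_nonneg _) a2) (abs_nonneg _) a3)
    (by simp)
    (Eventually.of_forall fun x _ => (((coshProd_tendsto _).div (coshProd_tendsto _) (Real.cosh_pos _).ne').const_mul _).mul_const _)
  exact ge_of_tendsto' h fun n => cosPos_prod θ hθ b c hb hc0 hc n y

lemma integral_tri_cos (y : ℝ) (hy : y ≠ 0) :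
    ∫ x in (0:ℝ)..1, (1 - x) * Real.cos (y * x) = (1 - Real.cos y) / y ^ 2 := by
  have := intervalIntegral.integral_eq_sub_of_hasDerivAt
      (f := fun x => (1 - x) * (Real.sin (y * x) / y) - Real.cos (y * x) / (y ^ 2))
      (f' := fun x => (1 - x) * Real.cos (y * x)) (a := 0) (b := 1) (fun x _ => by
        have h1 : HasDerivAt (fun x : ℝ => y * x) y x := by simpa using (hasDerivAt_id x).const_mul y
        have h2 := (hasDerivAt_id x).const_sub 1
        have h3 := (h2.mul (h1.sin.div_const y)).sub (h1.cos.div_const (y ^ 2))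
        refine HasDerivAt.congr_deriv (f := fun x => (1 - x) * (Real.sin (y * x) / y) - Real.cos (y * x) / (y ^ 2)) h3 ?_
        simp only [id]
        field_simp
        ring) (Continuous.intervalIntegrable (by fun_prop) _ _)
  rw [this]
  simp
  ring

/-- the basic exponential integral -/
noncomputable def sI (T₁ T₂ v : ℝ) : ℂ := ∫ t in T₁..T₂, Complex.exp (v * t * Complex.I)

lemma norm_exp_vt (v t : ℝ) : ‖Complex.exp (v * t * Complex.I)‖ = 1 := by
  rw [← Complex.ofReal_mul]; exact Complex.norm_exp_ofReal_mul_I _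

lemma sI_norm_le (T₁ T₂ v : ℝ) (h : T₁ ≤ T₂) : ‖sI T₁ T₂ v‖ ≤ T₂ - T₁ := by
  have := intervalIntegral.norm_integral_le_of_norm_le_const (a := T₁) (b := T₂) (C := 1)
    (f := fun t : ℝ => Complex.exp (v * t * Complex.I)) (fun t _ => (norm_exp_vt v t).le)
  rwa [one_mul, abs_of_nonneg (by linarith)] at this

lemma sI_eq (T₁ T₂ v : ℝ) (hv : v ≠ 0) : sI T₁ T₂ v =
    (Complex.exp (v * T₂ * Complex.I) - Complex.exp (v * T₁ * Complex.I)) / (v * Complex.I) := by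
  have hc : (v * Complex.I : ℂ) ≠ 0 := mul_ne_zero (by exact_mod_cast hv) Complex.I_ne_zero
  have := integral_exp_mul_complex (a := T₁) (b := T₂) hc
  rw [show (v * Complex.I : ℂ) * T₂ = v * T₂ * Complex.I by ring,
    show (v * Complex.I : ℂ) * T₁ = v * T₁ * Complex.I by ring] at this
  rw [← this, sI]
  congr 1; ext t; congr 1; ring

lemma sI_norm_le' (T₁ T₂ v : ℝ) (hv : v ≠ 0) : ‖sI T₁ T₂ v‖ ≤ 2 / |v| := by
  rw [sI_eq _ _ _ hv, norm_div]
  have : ‖(v * Complex.I : ℂ)‖ = |v| := by simp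
  rw [this]
  gcongr
  refine (norm_sub_le _ _).trans ?_
  rw [norm_exp_vt, norm_exp_vt]; norm_num

lemma sI_continuous (T₁ T₂ : ℝ) : Continuous (sI T₁ T₂) := by
  unfold sI
  apply intervalIntegral.continuous_parametric_intervalIntegral_of_continuous'
  fun_prop

lemma sI_sq (T₁ T₂ v : ℝ) (h : T₁ < T₂) : ‖sI T₁ T₂ v‖ ^ 2 =
    2 * (T₂ - T₁) ^ 2 * ∫ x in (0:ℝ)..1, (1 - x) * Real.cos ((T₂ - T₁) * x * v) := by
  have hH : 0 < T₂ - T₁ := by linarith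
  rcases eq_or_ne v 0 with rfl | hv
  · have : sI T₁ T₂ 0 = ((T₂ - T₁ : ℝ) : ℂ) := by simp [sI]
    rw [this, Complex.norm_real, Real.norm_eq_abs, sq_abs]
    have h1 : ∫ x in (0:ℝ)..1, (1 - x) = 1 / 2 := by
      rw [intervalIntegral.integral_sub (by simp) (by simp)]; norm_num
    simp [h1]
    ring
  · have e : ∀ x : ℝ, (T₂ - T₁) * x * v = ((T₂ - T₁) * v) * x := fun x => by ring
    simp_rw [e]
    rw [integral_tri_cos _ (mul_ne_zero hH.ne' hv), sI_eq _ _ _ hv, norm_div, div_pow]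
    have : ‖(v * Complex.I : ℂ)‖ ^ 2 = v ^ 2 := by simp
    rw [this]
    have h2 : ‖Complex.exp (v * T₂ * Complex.I) - Complex.exp (v * T₁ * Complex.I)‖ ^ 2
        = 2 - 2 * Real.cos ((T₂ - T₁) * v) := by
      rw [← Complex.normSq_eq_norm_sq, Complex.normSq_apply, ← Complex.ofReal_mul, ← Complex.ofReal_mul,
        Complex.sub_re, Complex.sub_im]
      simp only [Complex.exp_ofReal_mul_I_re, Complex.exp_ofReal_mul_I_im]
      rw [show (T₂ - T₁) * v = v * T₂ - v * T₁ by ring, Real.cos_sub]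
      have := Real.sin_sq_add_cos_sq (v * T₂)
      have := Real.sin_sq_add_cos_sq (v * T₁)
      nlinarith
    rw [h2]
    field_simp

lemma integral_cauchy_le (e H : ℝ) (he : 0 < e) (hH : 0 < H) :
    ∫ x in (0:ℝ)..1, (1 - x) * (e / (e ^ 2 + (H * x) ^ 2)) ≤ Real.pi / (2 * H) := by
  have h1 : ∫ x in (0:ℝ)..1, e / (e ^ 2 + (H * x) ^ 2) = Real.arctan (H / e) / H := by
    have := intervalIntegral.integral_eq_sub_of_hasDerivAt
      (f := fun x => Real.arctan (H / e * x) / H)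
      (f' := fun x => e / (e ^ 2 + (H * x) ^ 2)) (a := 0) (b := 1) (fun x _ => by
        have h1 : HasDerivAt (fun x : ℝ => H / e * x) (H / e) x := by simpa using (hasDerivAt_id x).const_mul (H / e)
        have h3 := (h1.arctan).div_const H
        refine HasDerivAt.congr_deriv (f := fun x => Real.arctan (H / e * x) / H) h3 ?_
        have : e ^ 2 + (H * x) ^ 2 ≠ 0 := by positivity
        have : 1 + (H / e * x) ^ 2 ≠ 0 := by positivity
        field_simp) (Continuous.intervalIntegrable
          (Continuous.div (by fun_prop) (by fun_prop) (fun x => by positivity)) _ _)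
    rw [this]; simp
  calc _ ≤ ∫ x in (0:ℝ)..1, e / (e ^ 2 + (H * x) ^ 2) := by
        have hc : Continuous fun x : ℝ => e / (e ^ 2 + (H * x) ^ 2) :=
          Continuous.div (by fun_prop) (by fun_prop) (fun x => by positivity)
        refine intervalIntegral.integral_mono_on zero_le_one (Continuous.intervalIntegrable (by fun_prop) _ _)
          (hc.intervalIntegrable _ _) fun x hx => ?_
        have : 0 ≤ e / (e ^ 2 + (H * x) ^ 2) := by positivity
        have := hx.1
        nlinarith
    _ = Real.arctan (H / e) / H := h1
    _ ≤ (Real.pi / 2) / H := by gcongr; exact (Real.arctan_lt_pi_div_two _).le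
    _ = _ := by field_simp

lemma sI_integral_le (T₁ T₂ B : ℝ) (h : T₁ < T₂) (hB : 0 ≤ B) :
    ∫ v in (0:ℝ)..B, ‖sI T₁ T₂ v‖ ^ 2 ≤ Real.pi * (T₂ - T₁) := by
  have hH : 0 < T₂ - T₁ := by linarith
  set H := T₂ - T₁ with hHd
  set G : ℝ → ℝ := fun v => ∫ x in (0:ℝ)..1, (1 - x) * Real.cos (H * x * v) with hG
  have hsq : ∀ v, ‖sI T₁ T₂ v‖ ^ 2 = 2 * H ^ 2 * G v := fun v => sI_sq T₁ T₂ v h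
  have hG0 : ∀ v, 0 ≤ G v := fun v => by
    have := hsq v
    have h2 := sq_nonneg ‖sI T₁ T₂ v‖
    rw [this] at h2
    exact nonneg_of_mul_nonneg_right h2 (by positivity)
  have hGc : Continuous G := by
    have : G = fun v => ‖sI T₁ T₂ v‖ ^ 2 / (2 * H ^ 2) := by
      ext v; rw [hsq]; field_simp
    rw [this]
    have := sI_continuous T₁ T₂
    fun_prop
  have hG1 : ∀ v, G v ≤ 1 := fun v => by
    have := hsq v
    have h2 := sI_norm_le T₁ T₂ v h.le
    have h3 : ‖sI T₁ T₂ v‖ ^ 2 ≤ H ^ 2 := by gcongr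
    have : 0 < H ^ 2 := by positivity
    nlinarith
  have key : ∀ e : ℝ, 0 < e → Real.exp (-e * B) * ∫ v in (0:ℝ)..B, G v ≤ Real.pi / (2 * H) := by
    intro e he
    refine le_trans ?_ (integral_cauchy_le e H he hH)
    rw [cosPos_swap 1 one_pos (fun x => 1 - x) (by fun_prop) e he H,
      ← intervalIntegral.integral_const_mul, intervalIntegral.integral_of_le hB]
    have hint : IntegrableOn (fun v => Real.exp (-e * v) * G v) (Ioi 0) := by
      refine (integrableOn_exp_neg e he).mul_bdd (c := 1) hGc.aestronglyMeasurable
        (Eventually.of_forall fun v => ?_)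
      rw [Real.norm_eq_abs, abs_of_nonneg (hG0 v)]; exact hG1 v
    calc ∫ v in Ioc 0 B, Real.exp (-e * B) * G v ≤ ∫ v in Ioc 0 B, Real.exp (-e * v) * G v := by
          refine setIntegral_mono_on ?_ (hint.mono_set Ioc_subset_Ioi_self) measurableSet_Ioc fun v hv => ?_
          · exact ((Continuous.integrableOn_Icc (by fun_prop))).mono_set Ioc_subset_Icc_self
          · gcongr ?_ * _
            · exact hG0 v
            · apply Real.exp_le_exp.mpr; nlinarith [hv.2]
      _ ≤ _ := setIntegral_mono_set hint (Eventually.of_forall fun v => mul_nonneg (Real.exp_pos _).le (hG0 v))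
          (Eventually.of_forall Ioc_subset_Ioi_self)
  have hlim : Tendsto (fun e : ℝ => Real.exp (-e * B) * ∫ v in (0:ℝ)..B, G v) (𝓝[>] 0)
      (𝓝 (Real.exp (-0 * B) * ∫ v in (0:ℝ)..B, G v)) :=
    (Continuous.tendsto (by fun_prop) 0).mono_left nhdsWithin_le_nhds
  have := le_of_tendsto hlim (by filter_upwards [self_mem_nhdsWithin] with e he using key e he)
  simp only [neg_zero, zero_mul, Real.exp_zero, one_mul] at this
  simp_rw [hsq]
  rw [intervalIntegral.integral_const_mul]
  calc _ ≤ 2 * H ^ 2 * (Real.pi / (2 * H)) := by gcongr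
    _ = _ := by field_simp

lemma sI_neg_norm (T₁ T₂ v : ℝ) : ‖sI T₁ T₂ (-v)‖ = ‖sI T₁ T₂ v‖ := by
  have : sI T₁ T₂ (-v) = (starRingEnd ℂ) (sI T₁ T₂ v) := by
    unfold sI
    rw [← intervalIntegral.intervalIntegral_conj]
    congr 1; ext t
    rw [← Complex.exp_conj]; congr 1; simp
  rw [this, Complex.norm_conj]

lemma sI_integral_le_two (T₁ T₂ A B : ℝ) (h : T₁ < T₂) (hA : 0 ≤ A) (hB : 0 ≤ B) :
    ∫ v in (-A)..B, ‖sI T₁ T₂ v‖ ^ 2 ≤ 2 * Real.pi * (T₂ - T₁) := by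
  have hc : Continuous fun v => ‖sI T₁ T₂ v‖ ^ 2 := (sI_continuous T₁ T₂).norm.pow 2
  rw [← intervalIntegral.integral_add_adjacent_intervals (b := 0) (hc.intervalIntegrable _ _) (hc.intervalIntegrable _ _)]
  have h1 : ∫ v in (-A)..0, ‖sI T₁ T₂ v‖ ^ 2 = ∫ v in (0:ℝ)..A, ‖sI T₁ T₂ v‖ ^ 2 := by
    have := intervalIntegral.integral_comp_neg (a := 0) (b := A) (fun v => ‖sI T₁ T₂ v‖ ^ 2)
    simp only [neg_zero] at this
    rw [← this]; simp_rw [sI_neg_norm]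
  rw [h1]
  have := sI_integral_le T₁ T₂ A h hA
  have := sI_integral_le T₁ T₂ B h hB
  linarith

lemma deriv_tendsto_of_bdd {U : Set ℂ} (hU : IsOpen U) (F : ℕ → ℂ → ℂ) (f : ℂ → ℂ) (M : ℝ)
    (hF : ∀ n, DifferentiableOn ℂ (F n) U) (hf : DifferentiableOn ℂ f U)
    (hM : ∀ n, ∀ z ∈ U, ‖F n z‖ ≤ M) (hl : ∀ z ∈ U, Tendsto (fun n => F n z) atTop (𝓝 (f z)))
    (z : ℂ) (hz : z ∈ U) : Tendsto (fun n => deriv (F n) z) atTop (𝓝 (deriv f z)) := by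
  obtain ⟨r, hr, hrU⟩ := Metric.nhds_basis_closedBall.mem_iff.mp (hU.mem_nhds hz)
  have e : ∀ g : ℂ → ℂ, DifferentiableOn ℂ g U → Complex.cderiv r g z = deriv g z := fun g hg =>
    Complex.cderiv_eq_deriv hU hg hr hrU
  simp_rw [← e f hf, ← fun n => e (F n) (hF n), Complex.cderiv]
  refine Tendsto.const_smul ?_ _
  unfold circleIntegral
  have hmem : ∀ t : ℝ, circleMap z r t ∈ U := fun t => hrU (circleMap_mem_closedBall z hr.le t)
  refine intervalIntegral.tendsto_integral_filter_of_dominated_convergence (fun _ => r * ((r ^ 2)⁻¹ * M)) ?_ ?_ ?_ ?_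
  · refine Eventually.of_forall fun n => Continuous.aestronglyMeasurable ?_
    have h1 : Continuous fun t : ℝ => F n (circleMap z r t) :=
      (hF n).continuousOn.comp_continuous (continuous_circleMap z r) hmem
    have h2 : Continuous fun t : ℝ => ((circleMap z r t - z) ^ 2)⁻¹ := by
      refine Continuous.inv₀ (by fun_prop) fun t => ?_
      simp [circleMap_eq_center_iff, hr.ne']
    have h3 : Continuous (deriv (circleMap z r)) := by
      have : deriv (circleMap z r) = fun t => circleMap 0 r t * Complex.I := by ext t; simp
      rw [this]; fun_prop
    exact h3.smul (h2.smul h1)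
  · refine Eventually.of_forall fun n => Eventually.of_forall fun t _ => ?_
    rw [norm_smul, norm_smul]
    have h1 : ‖deriv (circleMap z r) t‖ = r := by simp [abs_of_pos hr]
    have h2 : ‖((circleMap z r t - z) ^ 2)⁻¹‖ = (r ^ 2)⁻¹ := by simp [circleMap]
    rw [h1, h2]
    gcongr
    exact hM n _ (hmem t)
  · simp
  · refine Eventually.of_forall fun t _ => ?_
    exact ((hl _ (hmem t)).const_smul _).const_smul _

lemma GammaSeq_bound (s : ℂ) (a b : ℝ) (ha : 0 < a) (h1 : a ≤ s.re) (h2 : s.re ≤ b) (n : ℕ) (hn : n ≠ 0) :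
    ‖Complex.GammaSeq s n‖ ≤ Real.Gamma a + Real.Gamma b := by
  rw [Complex.GammaSeq_eq_approx_Gamma_integral (by linarith) hn, Real.Gamma_eq_integral ha,
    Real.Gamma_eq_integral (by linarith), ← integral_add (Real.GammaIntegral_convergent ha) (Real.GammaIntegral_convergent (by linarith))]
  have hint := (Real.GammaIntegral_convergent ha).add (Real.GammaIntegral_convergent (s := b) (by linarith))
  rw [intervalIntegral.integral_of_le (Nat.cast_nonneg n)]
  have hpos : ∀ x ∈ Ioi (0:ℝ), 0 ≤ Real.exp (-x) * x ^ (a - 1) + Real.exp (-x) * x ^ (b - 1) := fun x hx => by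
    have : 0 < x := hx
    positivity
  refine (norm_integral_le_of_norm_le (hint.mono_set Ioc_subset_Ioi_self) ?_).trans
    (setIntegral_mono_set hint ?_ (Eventually.of_forall Ioc_subset_Ioi_self))
  · filter_upwards [ae_restrict_mem measurableSet_Ioc] with x hx
    have hx0 : 0 < x := hx.1
    rw [norm_mul, Complex.norm_cpow_eq_rpow_re_of_pos hx0, Complex.norm_real, Real.norm_eq_abs]
    have h3 : 0 ≤ 1 - x / n := by
      rw [sub_nonneg, div_le_one (by positivity)]; exact hx.2
    rw [abs_of_nonneg (pow_nonneg h3 n)]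
    have h4 := Real.one_sub_div_pow_le_exp_neg hx.2
    have h5 : x ^ ((s - 1).re) ≤ x ^ (a - 1) + x ^ (b - 1) := by
      rcases le_total x 1 with h | h
      · have := Real.rpow_le_rpow_of_exponent_ge hx0 h (show a - 1 ≤ (s - 1).re by simpa using h1)
        have : 0 < x ^ (b - 1) := by positivity
        linarith
      · have := Real.rpow_le_rpow_of_exponent_le h (show (s - 1).re ≤ b - 1 by simpa using h2)
        have : 0 < x ^ (a - 1) := by positivity
        linarith
    show _ ≤ Real.exp (-x) * x ^ (a - 1) + Real.exp (-x) * x ^ (b - 1)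
    rw [← mul_add]
    gcongr
  · filter_upwards [ae_restrict_mem measurableSet_Ioi] with x hx using hpos x hx

lemma add_nat_ne (s : ℂ) (hs : 0 < s.re) (j : ℕ) : s + j ≠ 0 := by
  intro h
  have := congrArg Complex.re h
  simp at this
  have : (0:ℝ) ≤ j := Nat.cast_nonneg j
  linarith

lemma GammaSeq_diff (n : ℕ) (hn : n ≠ 0) (s : ℂ) (hs : 0 < s.re) :
    DifferentiableAt ℂ (fun s => Complex.GammaSeq s n) s := by
  unfold Complex.GammaSeq
  have hn' : (n:ℂ) ≠ 0 := by exact_mod_cast hn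
  have : DifferentiableAt ℂ (fun s : ℂ => (n:ℂ) ^ s) s := DifferentiableAt.const_cpow (by fun_prop) (Or.inl hn')
  refine DifferentiableAt.div (by fun_prop) (by fun_prop) ?_
  exact Finset.prod_ne_zero_iff.mpr fun j _ => add_nat_ne s hs j

lemma GammaSeq_logDeriv (n : ℕ) (hn : n ≠ 0) (s : ℂ) (hs : 0 < s.re) :
    logDeriv (fun s => Complex.GammaSeq s n) s = Complex.log n - ∑ j ∈ Finset.range (n + 1), 1 / (s + j) := by
  unfold Complex.GammaSeq
  have hn' : (n:ℂ) ≠ 0 := by exact_mod_cast hn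
  have hfac : ((n.factorial : ℕ) : ℂ) ≠ 0 := by exact_mod_cast n.factorial_ne_zero
  have hd : DifferentiableAt ℂ (fun s : ℂ => (n:ℂ) ^ s) s := DifferentiableAt.const_cpow (by fun_prop) (Or.inl hn')
  have h0 : (n:ℂ) ^ s ≠ 0 := by simp [hn']
  rw [logDeriv_div (f := fun s : ℂ => (n:ℂ) ^ s * (n.factorial : ℂ)) (g := fun s : ℂ => ∏ j ∈ Finset.range (n + 1), (s + (j:ℂ))) s (mul_ne_zero h0 hfac) (Finset.prod_ne_zero_iff.mpr fun j _ => add_nat_ne s hs j)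
    (by fun_prop) (by fun_prop), logDeriv_mul_const _ _ hfac]
  congr 1
  · rw [logDeriv_apply]
    have h5 : deriv (fun s : ℂ => (n:ℂ) ^ s) s = (n:ℂ) ^ s * Complex.log n * 1 :=
      (HasDerivAt.const_cpow (hasDerivAt_id s) (Or.inl hn')).deriv
    have h6 : deriv (HPow.hPow (n:ℂ)) s = (n:ℂ) ^ s * Complex.log n * 1 := h5
    rw [h6]
    field_simp
  · rw [logDeriv_prod (f := fun (j : ℕ) (s : ℂ) => s + j) (fun j _ => add_nat_ne s hs j) (fun j _ => by fun_prop)]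
    refine Finset.sum_congr rfl fun j _ => ?_
    rw [logDeriv_apply]
    simp

lemma digamma_tendsto (s : ℂ) (hs : 0 < s.re) :
    Tendsto (fun n : ℕ => Complex.log n - ∑ j ∈ Finset.range (n + 1), 1 / (s + j)) atTop (𝓝 (Complex.digamma s)) := by
  have hU : IsOpen {z : ℂ | s.re / 2 < z.re ∧ z.re < 2 * s.re} :=
    (isOpen_lt continuous_const Complex.continuous_re).inter (isOpen_lt Complex.continuous_re continuous_const)
  have hne : ∀ z : ℂ, 0 < z.re → ∀ m : ℕ, z ≠ -m := fun z hz m h => by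
    have := congrArg Complex.re h
    simp at this
    have : (0:ℝ) ≤ m := Nat.cast_nonneg m
    linarith
  have h := deriv_tendsto_of_bdd hU (fun n z => Complex.GammaSeq z (n + 1)) Complex.Gamma
    (Real.Gamma (s.re / 2) + Real.Gamma (2 * s.re))
    (fun n z hz => (GammaSeq_diff (n + 1) (by omega) z (by linarith [hz.1])).differentiableWithinAt)
    (fun z hz => (Complex.differentiableAt_Gamma z (hne z (by linarith [hz.1]))).differentiableWithinAt)
    (fun n z hz => GammaSeq_bound z _ _ (by linarith) hz.1.le hz.2.le (n + 1) (by omega))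
    (fun z hz => (tendsto_add_atTop_iff_nat 1).mpr (Complex.GammaSeq_tendsto_Gamma z)) s
    ⟨by linarith, by linarith⟩
  have h2 := h.div ((tendsto_add_atTop_iff_nat 1).mpr (Complex.GammaSeq_tendsto_Gamma s))
    (Complex.Gamma_ne_zero (hne s hs))
  rw [← tendsto_add_atTop_iff_nat 1]
  refine h2.congr fun n => ?_
  rw [← GammaSeq_logDeriv (n + 1) (by omega) s hs, logDeriv_apply]
  rfl

lemma log_step (z : ℂ) (hz : 0 < z.re) : ‖1 / z - (Complex.log (z + 1) - Complex.log z)‖ ≤ 1 / ‖z‖ ^ 2 := by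
  have hz0 : z ≠ 0 := fun h => by simp [h] at hz
  have hp : ∀ x : ℝ, 0 ≤ x → 0 < (z + x).re := fun x hx => by simp; linarith
  have h0 : ∀ x : ℝ, 0 ≤ x → (z + x) ≠ 0 := fun x hx h => by have := hp x hx; simp [h] at this
  have := norm_image_sub_le_of_norm_deriv_le_segment_01' (f := fun x : ℝ => (x:ℂ) / z - Complex.log (z + x))
    (f' := fun x : ℝ => 1 / z - 1 / (z + x)) (C := 1 / ‖z‖ ^ 2) (fun x hx => by
      have h1 : HasDerivAt (fun x : ℝ => (x : ℂ)) 1 x := Complex.ofRealCLM.hasDerivAt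
      have h2 : HasDerivAt (fun x : ℝ => z + (x : ℂ)) 1 x := h1.const_add z
      have h3 := h2.clog_real (Complex.mem_slitPlane_iff.mpr (Or.inl (hp x hx.1)))
      exact ((h1.div_const z).sub h3).hasDerivWithinAt) (fun x hx => by
      have := h0 x hx.1
      have e : 1 / z - 1 / (z + x) = x / (z * (z + x)) := by field_simp; ring
      rw [e, norm_div, norm_mul, Complex.norm_real, Real.norm_eq_abs, abs_of_nonneg hx.1, sq]
      have hle : ‖z‖ ≤ ‖z + x‖ := by
        rw [Complex.norm_def, Complex.norm_def]
        apply Real.sqrt_le_sqrt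
        simp only [Complex.normSq_apply, Complex.add_re, Complex.add_im, Complex.ofReal_re, Complex.ofReal_im]
        nlinarith [hx.1, hz.le, mul_nonneg hx.1 hz.le, mul_nonneg hx.1 hx.1]
      have : 0 < ‖z‖ := norm_pos_iff.mpr hz0
      gcongr
      exact hx.2.le)
  simp only [Complex.ofReal_one, Complex.ofReal_zero, add_zero, zero_div] at this
  refine le_trans (le_of_eq ?_) this
  congr 1
  ring

lemma sum_inv_sq_le (s : ℂ) (hs : 0 < s.re) (ht : 2 ≤ s.im) (n : ℕ) :
    ∑ j ∈ Finset.range n, 1 / ‖s + j‖ ^ 2 ≤ 2 * (1 / (s.im - 1) - 1 / (s.im - 1 + n)) := by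
  induction n with
  | zero => simp
  | succ n ih =>
    rw [Finset.sum_range_succ]
    have hn : (0:ℝ) ≤ n := Nat.cast_nonneg n
    have h1 : (s.im + n) ^ 2 ≤ 2 * ‖s + n‖ ^ 2 := by
      rw [← Complex.normSq_eq_norm_sq, Complex.normSq_apply]
      simp
      nlinarith [sq_nonneg (s.im - n), mul_nonneg hs.le hn, sq_nonneg s.re]
    have h2 : 1 / ‖s + n‖ ^ 2 ≤ 2 / (s.im + n) ^ 2 := by
      have : 0 < (s.im + n) ^ 2 := by positivity
      rw [div_le_div_iff₀ (by linarith) this]; linarith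
    have h3 : 2 / (s.im + n) ^ 2 ≤ 2 * (1 / (s.im - 1 + n) - 1 / (s.im - 1 + (n + 1))) := by
      have a1 : 0 < s.im - 1 + n := by linarith
      have : s.im - 1 + (n + 1) = s.im + n := by ring
      rw [this]
      have a2 : 0 < s.im + n := by linarith
      rw [div_sub_div _ _ a1.ne' a2.ne', mul_div_assoc', div_le_div_iff₀ (by positivity) (by positivity)]
      nlinarith
    push_cast
    linarith

lemma digamma_bound (s : ℂ) (hs : 0 < s.re) (ht : 2 ≤ s.im) :
    ‖Complex.digamma s - Complex.log s‖ ≤ 4 / s.im := by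
  have hstep : ∀ n : ℕ, ‖∑ j ∈ Finset.range n, 1 / (s + j) - (Complex.log (s + n) - Complex.log s)‖
      ≤ ∑ j ∈ Finset.range n, 1 / ‖s + j‖ ^ 2 := by
    intro n
    induction n with
    | zero => simp
    | succ n ih =>
      rw [Finset.sum_range_succ, Finset.sum_range_succ]
      have h1 := log_step (s + n) (by simp; positivity)
      have : ∑ j ∈ Finset.range n, 1 / (s + ↑j) + 1 / (s + ↑n) - (Complex.log (s + ((n + 1 : ℕ) : ℂ)) - Complex.log s)
        = (∑ j ∈ Finset.range n, 1 / (s + j) - (Complex.log (s + n) - Complex.log s)) +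
         (1 / (s + n) - (Complex.log (s + n + 1) - Complex.log (s + n))) := by
        push_cast
        rw [← add_assoc]; ring
      rw [this]
      exact (norm_add_le _ _).trans (add_le_add ih h1)
  have hb : ∀ n : ℕ, ‖(Complex.log n - ∑ j ∈ Finset.range (n + 1), 1 / (s + j)) -
      (Complex.log n - Complex.log (s + (n + 1 : ℕ))) - Complex.log s‖ ≤ 4 / s.im := by
    intro n
    have h1 := (hstep (n + 1)).trans (sum_inv_sq_le s hs ht (n + 1))
    have h2 : 2 * (1 / (s.im - 1) - 1 / (s.im - 1 + (n + 1 : ℕ))) ≤ 4 / s.im := by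
      have : 0 ≤ 1 / (s.im - 1 + (n + 1 : ℕ)) := by
        have : (0:ℝ) ≤ (n + 1 : ℕ) := Nat.cast_nonneg _
        apply div_nonneg zero_le_one; linarith
      have h3 : 1 / (s.im - 1) ≤ 2 / s.im := by
        rw [div_le_div_iff₀ (by linarith) (by linarith)]; linarith
      have : 2 * (2 / s.im) = 4 / s.im := by ring
      linarith
    rw [← norm_neg]
    refine le_trans (le_of_eq ?_) (h1.trans h2)
    congr 1
    ring
  have hlog : Tendsto (fun n : ℕ => Complex.log n - Complex.log (s + (n + 1 : ℕ))) atTop (𝓝 0) := by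
    have h1 : Tendsto (fun n : ℕ => Complex.log (1 + (s + 1) / n)) atTop (𝓝 (Complex.log 1)) := by
      refine (continuousAt_clog (by simp)).tendsto.comp ?_
      have := (tendsto_const_div_atTop_nhds_zero_nat (s + 1)).const_add 1
      simpa using this
    have h2 := h1.neg
    simp only [Complex.log_one, neg_zero] at h2
    refine h2.congr' ?_
    filter_upwards [eventually_ge_atTop 1] with n hn
    have hn0 : (0:ℝ) < n := by exact_mod_cast hn
    have : s + (n + 1 : ℕ) = (n : ℝ) * (1 + (s + 1) / n) := by
      push_cast
      have : (n:ℂ) ≠ 0 := by exact_mod_cast hn0.ne'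
      field_simp; ring
    rw [this, Complex.log_ofReal_mul hn0, Complex.ofReal_log hn0.le]
    · push_cast; ring
    · intro h
      have h3 := congrArg Complex.re h
      have : (s + 1) / (n:ℂ) = ((1 / n : ℝ) : ℂ) * (s + 1) := by push_cast; ring
      rw [this] at h3
      simp at h3
      have : 0 < (n:ℝ)⁻¹ * (s.re + 1) := by positivity
      linarith
  have := (((digamma_tendsto s hs).sub hlog).sub_const (Complex.log s)).norm
  rw [sub_zero] at this
  exact le_of_tendsto' this hb

lemma factor_one {U : Set ℂ} (hU : IsOpen U) (a : ℂ) (ha : a ∈ U) (m : ℕ) : ∀ (f : ℂ → ℂ),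
    DifferentiableOn ℂ f U → analyticOrderAt f a = m →
    ∃ g : ℂ → ℂ, DifferentiableOn ℂ g U ∧ (∀ z, f z = (z - a) ^ m * g z) ∧ g a ≠ 0 := by
  induction m with
  | zero =>
    intro f hf h
    have hfa : AnalyticAt ℂ f a := hf.analyticAt (hU.mem_nhds ha)
    refine ⟨f, hf, by simp, ?_⟩
    exact hfa.analyticOrderAt_eq_zero.mp (by simpa using h)
  | succ m ih =>
    intro f hf h
    have hfa : AnalyticAt ℂ f a := hf.analyticAt (hU.mem_nhds ha)
    have h0 : f a = 0 := by
      by_contra hne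
      rw [hfa.analyticOrderAt_eq_zero.mpr hne] at h
      exact absurd h.symm (by simp)
    have hd : DifferentiableOn ℂ (dslope f a) U := (Complex.differentiableOn_dslope (hU.mem_nhds ha)).mpr hf
    have hda : AnalyticAt ℂ (dslope f a) a := hd.analyticAt (hU.mem_nhds ha)
    have hmul : ∀ z, f z = (z - a) * dslope f a z := fun z => by
      have := sub_smul_dslope f a z
      rw [h0, sub_zero, smul_eq_mul] at this
      exact this.symm
    have hord : analyticOrderAt (dslope f a) a = m := by
      have h1 : f = (fun z => z - a) * dslope f a := funext hmul
      have hlin : AnalyticAt ℂ (fun z : ℂ => z - a) a := by fun_prop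
      have h2 : analyticOrderAt (fun z : ℂ => z - a) a = 1 := by
        have := (hlin.analyticOrderAt_eq_natCast (n := 1)).mpr ⟨fun _ => 1, analyticAt_const, one_ne_zero, by simp⟩
        exact_mod_cast this
      rw [h1, analyticOrderAt_mul hlin hda, h2] at h
      rw [Nat.cast_succ, add_comm] at h
      exact (ENat.add_left_injective_of_ne_top (ENat.one_ne_top)) h
    obtain ⟨g, hg, hfg, hga⟩ := ih _ hd hord
    exact ⟨g, hg, fun z => by rw [hmul z, hfg z, pow_succ]; ring, hga⟩

lemma factor_finset {U : Set ℂ} (hU : IsOpen U) (f : ℂ → ℂ) (hf : DifferentiableOn ℂ f U) (m : ℂ → ℕ)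
    (S : Finset ℂ) (hS : ∀ ρ ∈ S, ρ ∈ U ∧ analyticOrderAt f ρ = m ρ) :
    ∃ g : ℂ → ℂ, DifferentiableOn ℂ g U ∧ (∀ z, f z = (∏ ρ ∈ S, (z - ρ) ^ m ρ) * g z) ∧ ∀ ρ ∈ S, g ρ ≠ 0 := by
  induction S using Finset.induction_on with
  | empty => exact ⟨f, hf, by simp, by simp⟩
  | insert a S haS ih =>
    obtain ⟨g, hg, hfg, hgS⟩ := ih (fun ρ hρ => hS ρ (Finset.mem_insert_of_mem hρ))
    obtain ⟨haU, hao⟩ := hS a (Finset.mem_insert_self _ _)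
    have hga : AnalyticAt ℂ g a := hg.analyticAt (hU.mem_nhds haU)
    have hpa : AnalyticAt ℂ (fun z : ℂ => ∏ ρ ∈ S, (z - ρ) ^ m ρ) a := by fun_prop
    have hp0 : (∏ ρ ∈ S, (a - ρ) ^ m ρ) ≠ 0 := Finset.prod_ne_zero_iff.mpr fun ρ hρ =>
      pow_ne_zero _ (sub_ne_zero.mpr fun h => haS (h ▸ hρ))
    have hord : analyticOrderAt g a = m a := by
      have h1 : f = (fun z : ℂ => ∏ ρ ∈ S, (z - ρ) ^ m ρ) * g := funext hfg
      rw [h1, analyticOrderAt_mul hpa hga, hpa.analyticOrderAt_eq_zero.mpr hp0, zero_add] at hao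
      exact hao
    obtain ⟨k, hk, hgk, hka⟩ := factor_one hU a haU (m a) g hg hord
    refine ⟨k, hk, fun z => ?_, fun ρ hρ => ?_⟩
    · rw [hfg, hgk, Finset.prod_insert haS]; ring
    · rcases Finset.mem_insert.mp hρ with rfl | hρ
      · exact hka
      · intro h
        exact hgS ρ hρ (by rw [hgk, h, mul_zero])

lemma logDeriv_factor {U : Set ℂ} (hU : IsOpen U) (f g : ℂ → ℂ) (hg : DifferentiableOn ℂ g U) (m : ℂ → ℕ)
    (S : Finset ℂ) (hfg : ∀ z, f z = (∏ ρ ∈ S, (z - ρ) ^ m ρ) * g z) (z : ℂ) (hz : z ∈ U) (hfz : f z ≠ 0) :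
    logDeriv f z = ∑ ρ ∈ S, (m ρ : ℂ) / (z - ρ) + logDeriv g z := by
  have h1 : f = fun z => (∏ ρ ∈ S, (z - ρ) ^ m ρ) * g z := funext hfg
  have h2 := hfz
  rw [hfg] at h2
  have hp := left_ne_zero_of_mul h2
  have hp' := Finset.prod_ne_zero_iff.mp hp
  rw [h1, logDeriv_mul (f := fun z => ∏ ρ ∈ S, (z - ρ) ^ m ρ) z hp (right_ne_zero_of_mul h2) (by fun_prop)
    (hg.differentiableAt (hU.mem_nhds hz))]
  congr 1
  rw [logDeriv_prod (f := fun (ρ : ℂ) (z : ℂ) => (z - ρ) ^ m ρ) hp' (fun j _ => by fun_prop)]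
  refine Finset.sum_congr rfl fun ρ _ => ?_
  rw [logDeriv_fun_pow (by fun_prop)]
  simp [logDeriv_apply]
  ring

/-- multiplicity used internally -/
noncomputable abbrev ordN (f : ℂ → ℂ) (z : ℂ) : ℕ := analyticOrderNatAt f z

lemma landau (f : ℂ → ℂ) (M : ℝ) (hM : 1 ≤ M) (hf : DifferentiableOn ℂ f (Metric.ball 0 2)) (f0 : f 0 = 1)
    (hb : ∀ z : ℂ, ‖z‖ ≤ 19/10 → ‖f z‖ ≤ Real.exp M) :
    ∃ S : Finset ℂ, (∀ z, z ∈ S ↔ ‖z‖ ≤ 18/10 ∧ f z = 0) ∧ (∑ ρ ∈ S, (ordN f ρ : ℝ)) ≤ 19 * M ∧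
      (∀ z : ℂ, ‖z‖ ≤ 16/10 → f z ≠ 0 →
        ‖logDeriv f z‖ ≤ ∑ ρ ∈ S, (ordN f ρ : ℝ) * (1 / ‖z - ρ‖) + 20000 * M) := by
  have hfA : AnalyticOnNhd ℂ f (Metric.ball 0 2) := hf.analyticOnNhd Metric.isOpen_ball
  have hconn : IsPreconnected (Metric.ball (0:ℂ) 2) := (convex_ball _ _).isPreconnected
  have hfin : ({z : ℂ | ‖z‖ ≤ 18/10 ∧ f z = 0}).Finite := by
    by_contra hinf
    obtain ⟨x, hx, hacc⟩ := Set.Infinite.exists_accPt_of_subset_isCompact hinf (isCompact_closedBall (0:ℂ) (18/10))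
      (fun z hz => by simpa using hz.1)
    have hx2 : x ∈ Metric.ball (0:ℂ) 2 := by simp at hx ⊢; linarith
    have hfr : ∃ᶠ z in 𝓝[≠] x, f z = 0 := by
      rw [accPt_iff_frequently_nhdsNE] at hacc
      exact hacc.mono fun z hz => hz.2
    have := hfA.eqOn_zero_of_preconnected_of_frequently_eq_zero hconn hx2 hfr (Metric.mem_ball_self two_pos)
    rw [f0] at this; simp at this
  have hordtop : ∀ z ∈ Metric.ball (0:ℂ) 2, analyticOrderAt f z ≠ ⊤ := by
    intro z hz h
    have := hfA.eqOn_zero_of_preconnected_of_eventuallyEq_zero hconn hz (analyticOrderAt_eq_top.mp h) (Metric.mem_ball_self two_pos)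
    rw [f0] at this; simp at this
  set S := hfin.toFinset with hSdef
  have hS : ∀ z, z ∈ S ↔ ‖z‖ ≤ 18/10 ∧ f z = 0 := fun z => by simp [hSdef]
  have hSU : ∀ ρ ∈ S, ρ ∈ Metric.ball (0:ℂ) 2 ∧ analyticOrderAt f ρ = (ordN f ρ : ℕ) := fun ρ hρ => by
    have h1 : ρ ∈ Metric.ball (0:ℂ) 2 := by
      have := ((hS ρ).mp hρ).1
      simp; linarith
    exact ⟨h1, (Nat.cast_analyticOrderNatAt (hordtop ρ h1)).symm⟩
  have hcount : (∑ ρ ∈ S, (ordN f ρ : ℝ)) ≤ 19 * M := by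
    have hA : AnalyticOnNhd ℂ f (Metric.closedBall 0 |(18/10:ℝ)|) := fun z hz => hfA z (by
      rw [abs_of_pos (by norm_num)] at hz; simp at hz ⊢; linarith)
    have hA' : AnalyticOnNhd ℂ f (Metric.closedBall 0 |(19/10:ℝ)|) := fun z hz => hfA z (by
      rw [abs_of_pos (by norm_num)] at hz; simp at hz ⊢; linarith)
    have hj := AnalyticOnNhd.sum_divisor_le (c := 0) (r := 18/10) (R := 19/10) (M := Real.exp M) (f := f)
      (by norm_num) (by rw [abs_of_pos, abs_of_pos] <;> norm_num) (Real.one_le_exp (by linarith)) hA' (by rw [f0]; simp)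
      (fun z hz => hb z (by rw [abs_of_pos (by norm_num)] at hz; simp at hz; linarith))
    rw [f0, norm_one, div_one, Real.log_exp] at hj
    have hlog : 1 / 19 ≤ Real.log (19/10 / (18/10)) := by
      have := Real.one_sub_inv_le_log_of_pos (x := 19/10/(18/10)) (by norm_num)
      refine le_trans (by norm_num) this
    have hj2 : M / Real.log (19/10 / (18/10)) ≤ 19 * M := by
      rw [div_le_iff₀ (by linarith)]; nlinarith
    refine le_trans ?_ (hj.trans hj2)
    have hdiv : ∀ z ∈ S, MeromorphicOn.divisor f (Metric.closedBall 0 |(18/10:ℝ)|) z = (ordN f z : ℤ) := by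
      intro z hz
      have hz1 : z ∈ Metric.closedBall (0:ℂ) |(18/10:ℝ)| := by
        rw [abs_of_pos (by norm_num)]; simpa using ((hS z).mp hz).1
      rw [MeromorphicOn.AnalyticOnNhd.divisor_apply hA hz1, (hSU z hz).2]
      rfl
    have hfs := (MeromorphicOn.divisor f (Metric.closedBall 0 |(18/10:ℝ)|)).finiteSupport (isCompact_closedBall _ _)
    rw [finsum_eq_sum_of_support_subset (s := hfs.toFinset ∪ S) _ (by intro z hz; simp; left; exact hz)]
    have hnn : ∀ z, 0 ≤ MeromorphicOn.divisor f (Metric.closedBall 0 |(18/10:ℝ)|) z := fun z => MeromorphicOn.AnalyticOnNhd.divisor_nonneg hA z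
    calc (∑ ρ ∈ S, (ordN f ρ : ℝ)) = ((∑ ρ ∈ S, MeromorphicOn.divisor f (Metric.closedBall 0 |(18/10:ℝ)|) ρ : ℤ) : ℝ) := by
          push_cast
          exact Finset.sum_congr rfl fun z hz => by rw [hdiv z hz]; simp
      _ ≤ _ := by
          exact_mod_cast Finset.sum_le_sum_of_subset_of_nonneg Finset.subset_union_right fun z _ _ => hnn z
  refine ⟨S, hS, hcount, ?_⟩
  obtain ⟨g, hg, hfg, hgS⟩ := factor_finset Metric.isOpen_ball f hf (ordN f) S hSU
  have hg0 : ∀ z : ℂ, ‖z‖ ≤ 18/10 → g z ≠ 0 := fun z hz h => by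
    have h1 : f z = 0 := by rw [hfg, h, mul_zero]
    exact hgS z ((hS z).mpr ⟨hz, h1⟩) h
  have hgb : ∀ z : ℂ, ‖z‖ ≤ 19/10 → ‖g z‖ ≤ Real.exp M * 10 ^ (∑ ρ ∈ S, ordN f ρ) := by
    have hsph : ∀ z : ℂ, ‖z‖ = 19/10 → ‖g z‖ ≤ Real.exp M * 10 ^ (∑ ρ ∈ S, ordN f ρ) := by
      intro z hz
      have h1 : (1/10 : ℝ) ^ (∑ ρ ∈ S, ordN f ρ) ≤ ‖∏ ρ ∈ S, (z - ρ) ^ ordN f ρ‖ := by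
        rw [norm_prod, ← Finset.prod_pow_eq_pow_sum]
        refine Finset.prod_le_prod (fun _ _ => by positivity) fun ρ hρ => ?_
        rw [norm_pow]
        gcongr
        have := norm_sub_norm_le z ρ
        have := ((hS ρ).mp hρ).1
        linarith
      have h2 := hb z hz.le
      rw [hfg, norm_mul] at h2
      have h3 : (1/10 : ℝ) ^ (∑ ρ ∈ S, ordN f ρ) * ‖g z‖ ≤ Real.exp M :=
        (mul_le_mul_of_nonneg_right h1 (norm_nonneg _)).trans h2
      rw [one_div, inv_pow, inv_mul_le_iff₀ (by positivity)] at h3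
      linarith
    intro z hz
    have hcl : closure (Metric.ball (0:ℂ) (19/10)) = Metric.closedBall 0 (19/10) := closure_ball _ (by norm_num)
    refine Complex.norm_le_of_forall_mem_frontier_norm_le (U := Metric.ball (0:ℂ) (19/10)) Metric.isBounded_ball
      (f := g) ?_ (fun w hw => ?_) (by rw [hcl]; simpa using hz)
    · refine DifferentiableOn.diffContOnCl ?_
      rw [hcl]
      refine hg.mono fun w hw => ?_
      simp at hw ⊢; linarith
    · rw [frontier_ball _ (by norm_num)] at hw
      exact hsph w (by simpa using hw)
  have hg00 : 1 ≤ ‖g 0‖ * (18/10) ^ (∑ ρ ∈ S, ordN f ρ) := by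
    have h1 : ‖∏ ρ ∈ S, ((0:ℂ) - ρ) ^ ordN f ρ‖ ≤ (18/10) ^ (∑ ρ ∈ S, ordN f ρ) := by
      rw [norm_prod, ← Finset.prod_pow_eq_pow_sum]
      refine Finset.prod_le_prod (fun _ _ => by positivity) fun ρ hρ => ?_
      rw [norm_pow, zero_sub, norm_neg]
      gcongr
      exact ((hS ρ).mp hρ).1
    have h2 := hfg 0
    rw [f0] at h2
    calc (1:ℝ) = ‖(∏ ρ ∈ S, ((0:ℂ) - ρ) ^ ordN f ρ) * g 0‖ := by rw [← h2]; simp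
      _ ≤ _ := by rw [norm_mul, mul_comm]; gcongr
  have hratio : ∀ z : ℂ, ‖z‖ ≤ 19/10 → ‖g z / g 0‖ ≤ Real.exp (58 * M) := by
    intro z hz
    have hg0p : 0 < ‖g 0‖ := norm_pos_iff.mpr (hg0 0 (by simp; norm_num))
    rw [norm_div, div_le_iff₀ hg0p]
    have e1 : (18:ℝ) ^ (∑ ρ ∈ S, ordN f ρ) ≤ Real.exp (57 * M) := by
      have h18 : (18:ℝ) ≤ Real.exp 3 := by
        have h27 := Real.exp_one_gt_d9
        have : Real.exp 3 = Real.exp 1 ^ 3 := by rw [← Real.exp_nat_mul]; norm_num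
        rw [this]
        calc (18:ℝ) ≤ 2.7 ^ 3 := by norm_num
          _ ≤ _ := by gcongr; linarith
      calc (18:ℝ) ^ (∑ ρ ∈ S, ordN f ρ) ≤ (Real.exp 3) ^ (∑ ρ ∈ S, ordN f ρ) := by gcongr
        _ = Real.exp (((∑ ρ ∈ S, ordN f ρ : ℕ) : ℝ) * 3) := by rw [← Real.exp_nat_mul]
        _ ≤ _ := by
          apply Real.exp_le_exp.mpr
          push_cast
          linarith
    calc ‖g z‖ ≤ Real.exp M * 10 ^ (∑ ρ ∈ S, ordN f ρ) * 1 := by rw [mul_one]; exact hgb z hz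
      _ ≤ Real.exp M * 10 ^ (∑ ρ ∈ S, ordN f ρ) * (‖g 0‖ * (18/10) ^ (∑ ρ ∈ S, ordN f ρ)) := by gcongr
      _ = Real.exp M * (18:ℝ) ^ (∑ ρ ∈ S, ordN f ρ) * ‖g 0‖ := by
          have : (18:ℝ) ^ (∑ ρ ∈ S, ordN f ρ) = 10 ^ (∑ ρ ∈ S, ordN f ρ) * (18/10) ^ (∑ ρ ∈ S, ordN f ρ) := by
            rw [← mul_pow]; norm_num
          rw [this]; ring
      _ ≤ Real.exp M * Real.exp (57 * M) * ‖g 0‖ := by gcongr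
      _ = _ := by rw [← Real.exp_add]; ring_nf
  obtain ⟨h, hh0, hh⟩ : ∃ h : ℂ → ℂ, h 0 = 0 ∧ ∀ z ∈ Metric.ball (0:ℂ) (18/10), HasDerivAt h (logDeriv g z) z ∧ Complex.exp (h z) = g z / g 0 := by
    have hgd : ∀ z ∈ Metric.ball (0:ℂ) (18/10), DifferentiableAt ℂ g z := fun z hz =>
      hg.differentiableAt (Metric.isOpen_ball.mem_nhds (by simp at hz ⊢; linarith))
    have hgne : ∀ z ∈ Metric.ball (0:ℂ) (18/10), g z ≠ 0 := fun z hz => hg0 z (by simp at hz; linarith)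
    have hld : DifferentiableOn ℂ (logDeriv g) (Metric.ball 0 (18/10)) := by
      have h1 : DifferentiableOn ℂ g (Metric.ball 0 (18/10)) := fun z hz => (hgd z hz).differentiableWithinAt
      exact (h1.deriv Metric.isOpen_ball).div h1 hgne
    obtain ⟨h, hh0, hh⟩ := (hld.isExactOn_ball).with_val_at 0 0
    refine ⟨h, hh0, fun z hz => ⟨hh z hz, ?_⟩⟩
    have hconst : ∀ z ∈ Metric.ball (0:ℂ) (18/10), HasDerivAt (fun w => g w * Complex.exp (-h w)) 0 z := by
      intro z hz
      have h2 := (hgd z hz).hasDerivAt.mul ((hh z hz).neg.cexp)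
      refine HasDerivAt.congr_deriv (f := fun w => g w * Complex.exp (-h w)) h2 ?_
      have := hgne z hz
      rw [logDeriv_apply]
      simp only [Pi.neg_apply]
      field_simp
      ring
    have heq := (convex_ball (0:ℂ) (18/10)).is_const_of_fderivWithin_eq_zero (𝕜 := ℂ) (f := fun w => g w * Complex.exp (-h w))
      (fun z hz => (hconst z hz).differentiableAt.differentiableWithinAt)
      (fun z hz => by
        rw [fderivWithin_of_isOpen Metric.isOpen_ball hz]
        ext; simp [(hconst z hz).deriv]) hz (Metric.mem_ball_self (by norm_num))
    simp only [hh0, neg_zero, Complex.exp_zero, mul_one] at heq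
    rw [← heq, Complex.exp_neg]
    have := hgne z hz
    field_simp
  have hbc : ∀ z : ℂ, ‖z‖ ≤ 17/10 → ‖h z‖ ≤ 1972 * M := by
    intro z hz
    have h1 := Complex.borelCaratheodory_zero (f := h) (M := 58 * M) (R := 18/10) (z := z) (by linarith)
      (fun w hw => (hh w hw).1.differentiableAt.differentiableWithinAt) (fun w hw => by
        have h2 := hratio w (by simp at hw; linarith)
        rw [← (hh w hw).2, Complex.norm_exp] at h2
        exact Real.exp_le_exp.mp h2) (by norm_num) (by simp; linarith) hh0
    refine h1.trans ?_
    rw [div_le_iff₀ (by linarith)]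
    nlinarith [norm_nonneg z]
  intro z hz hfz
  rw [logDeriv_factor Metric.isOpen_ball f g hg (ordN f) S hfg z (by simp; linarith) hfz]
  have h1 : ‖logDeriv g z‖ ≤ 20000 * M := by
    have h1 := Complex.norm_deriv_le_of_forall_mem_sphere_norm_le (f := h) (c := z) (R := 1/10) (C := 1972 * M) (by norm_num)
      (DifferentiableOn.diffContOnCl (by
        rw [closure_ball _ (by norm_num)]
        intro w hw
        refine (hh w ?_).1.differentiableAt.differentiableWithinAt
        simp [dist_eq_norm] at hw ⊢
        have := norm_sub_norm_le w z
        linarith)) (fun w hw => hbc w (by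
          simp at hw
          have := norm_sub_norm_le w z
          linarith))
    rw [(hh z (by simp; linarith)).1.deriv] at h1
    refine h1.trans ?_
    linarith
  refine (norm_add_le _ _).trans (add_le_add ((norm_sum_le _ _).trans (Finset.sum_le_sum fun ρ _ => ?_)) h1)
  rw [norm_div, Complex.norm_natCast, mul_one_div]

lemma natp_slit (N : ℕ) (x : ℝ) (hx : 0 ≤ x) : ((N:ℂ) + 1 + x) ∈ Complex.slitPlane := by
  refine Complex.mem_slitPlane_iff.mpr (Or.inl ?_)
  simp; positivity

lemma cpow_hasDeriv (N : ℕ) (x : ℝ) (hx : 0 ≤ x) (w : ℂ) :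
    HasDerivAt (fun y : ℝ => ((N:ℂ) + 1 + y) ^ w) (w * ((N:ℂ) + 1 + x) ^ (w - 1)) x := by
  have h2 : HasDerivAt (fun z : ℂ => ((N:ℂ) + 1 + z) ^ w) (w * ((N:ℂ) + 1 + x) ^ (w - 1)) (x:ℂ) := by
    have := HasDerivAt.cpow_const (c := w) ((hasDerivAt_id (x:ℂ)).const_add ((N:ℂ) + 1)) (natp_slit N x hx)
    simpa using this
  exact h2.comp_ofReal

lemma natp_norm (N : ℕ) (x : ℝ) (hx : 0 ≤ x) (w : ℂ) :
    ‖((N:ℂ) + 1 + x) ^ w‖ = ((N:ℝ) + 1 + x) ^ w.re := by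
  have : ((N:ℂ) + 1 + x) = (((N:ℝ) + 1 + x : ℝ) : ℂ) := by push_cast; ring
  rw [this, Complex.norm_cpow_eq_rpow_re_of_pos (by positivity)]

/-- summand of the continuation series -/
noncomputable def bz (n : ℕ) (s : ℂ) : ℂ :=
  (s - 1) * ((n:ℂ) + 1) ^ (-s) + (((n:ℂ) + 1 + 1) ^ (1 - s) - ((n:ℂ) + 1) ^ (1 - s))

lemma bz_norm (n : ℕ) (s : ℂ) (hs : 0 < s.re) : ‖bz n s‖ ≤ ‖s - 1‖ * ‖s‖ * ((n:ℝ) + 1) ^ (-s.re - 1) := by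
  have h1 : ∀ x ∈ Icc (0:ℝ) 1, ‖((n:ℂ) + 1 + x) ^ (-s) - ((n:ℂ) + 1) ^ (-s)‖ ≤ ‖s‖ * ((n:ℝ) + 1) ^ (-s.re - 1) := by
    intro x hx
    have := Convex.norm_image_sub_le_of_norm_hasDerivWithin_le (s := Icc (0:ℝ) 1) (x := 0) (y := x)
      (f := fun y : ℝ => ((n:ℂ) + 1 + y) ^ (-s)) (f' := fun y : ℝ => -s * ((n:ℂ) + 1 + y) ^ (-s - 1))
      (C := ‖s‖ * ((n:ℝ) + 1) ^ (-s.re - 1)) (fun y hy => (cpow_hasDeriv n y hy.1 (-s)).hasDerivWithinAt)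
      (fun y hy => by
        rw [norm_mul, natp_norm n y hy.1, norm_neg]
        gcongr
        simp only [Complex.sub_re, Complex.neg_re, Complex.one_re]
        exact Real.rpow_le_rpow_of_nonpos (by positivity) (by linarith [hy.1]) (by linarith)) (convex_Icc 0 1)
      (by simp) hx
    simp only [Complex.ofReal_zero, add_zero, sub_zero] at this
    refine this.trans ?_
    rw [Real.norm_eq_abs, abs_of_nonneg hx.1]
    exact mul_le_of_le_one_right (by positivity) hx.2
  have := norm_image_sub_le_of_norm_deriv_le_segment_01' (f := fun x : ℝ => (s - 1) * (x * ((n:ℂ) + 1) ^ (-s)) + ((n:ℂ) + 1 + x) ^ (1 - s))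
    (f' := fun x : ℝ => (s - 1) * (1 * ((n:ℂ) + 1) ^ (-s)) + (1 - s) * ((n:ℂ) + 1 + x) ^ (1 - s - 1))
    (C := ‖s - 1‖ * (‖s‖ * ((n:ℝ) + 1) ^ (-s.re - 1)))
    (fun x hx => by
      have a1 : HasDerivAt (fun y : ℝ => (y : ℂ)) 1 x := Complex.ofRealCLM.hasDerivAt
      exact (((a1.mul_const _).const_mul _).add (cpow_hasDeriv n x hx.1 (1 - s))).hasDerivWithinAt)
    (fun x hx => by
      have e : (s - 1) * (1 * ((n:ℂ) + 1) ^ (-s)) + (1 - s) * ((n:ℂ) + 1 + x) ^ (1 - s - 1)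
        = -((s - 1) * (((n:ℂ) + 1 + x) ^ (-s) - ((n:ℂ) + 1) ^ (-s))) := by
        rw [show (1 : ℂ) - s - 1 = -s by ring]; ring
      rw [e, norm_neg, norm_mul]
      gcongr
      exact h1 x ⟨hx.1, hx.2.le⟩)
  rw [mul_assoc]
  refine le_trans (le_of_eq ?_) this
  unfold bz
  congr 1
  simp
  ring

lemma bz_diff (n : ℕ) : Differentiable ℂ (bz n) := by
  unfold bz
  have h1 : ((n:ℂ) + 1) ≠ 0 := by exact_mod_cast Nat.succ_ne_zero n
  have h2 : ((n:ℂ) + 1 + 1) ≠ 0 := by exact_mod_cast Nat.succ_ne_zero (n + 1)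
  intro s
  have d1 : DifferentiableAt ℂ (fun s : ℂ => ((n:ℂ) + 1) ^ (-s)) s := DifferentiableAt.const_cpow (by fun_prop) (Or.inl h1)
  have d2 : DifferentiableAt ℂ (fun s : ℂ => ((n:ℂ) + 1) ^ (1 - s)) s := DifferentiableAt.const_cpow (by fun_prop) (Or.inl h1)
  have d3 : DifferentiableAt ℂ (fun s : ℂ => ((n:ℂ) + 1 + 1) ^ (1 - s)) s := DifferentiableAt.const_cpow (by fun_prop) (Or.inl h2)
  fun_prop

lemma summable_nat_rpow (a : ℝ) (ha : 1 < a) : Summable fun n : ℕ => ((n:ℝ) + 1) ^ (-a) := by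
  have := (summable_nat_add_iff 1).mpr (Real.summable_nat_rpow.mpr (show -a < -1 by linarith))
  simpa using this

lemma bz_summable (s : ℂ) (hs : 0 < s.re) : Summable fun n => bz n s := by
  refine Summable.of_norm_bounded ((summable_nat_rpow (s.re + 1) (by linarith)).mul_left (‖s - 1‖ * ‖s‖)) fun n => ?_
  rw [show -(s.re + 1) = -s.re - 1 by ring]
  exact bz_norm n s hs

lemma bz_sum (s : ℂ) (hs : 1 < s.re) : ∑' n, bz n s = (s - 1) * riemannZeta s - 1 := by
  have hz : Summable fun n : ℕ => ((n:ℂ) + 1) ^ (-s) := by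
    have := (summable_nat_add_iff 1).mpr (Complex.summable_one_div_nat_cpow.mpr hs)
    refine this.congr fun n => ?_
    rw [Complex.cpow_neg]; simp
  have h1 : Tendsto (fun N : ℕ => ∑ n ∈ Finset.range N, (((n:ℂ) + 1 + 1) ^ (1 - s) - ((n:ℂ) + 1) ^ (1 - s))) atTop (𝓝 (0 - 1)) := by
    have e : ∀ N : ℕ, ∑ n ∈ Finset.range N, (((n:ℂ) + 1 + 1) ^ (1 - s) - ((n:ℂ) + 1) ^ (1 - s)) = ((N:ℂ) + 1) ^ (1 - s) - 1 := by
      intro N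
      have := Finset.sum_range_sub (fun n : ℕ => ((n:ℂ) + 1) ^ (1 - s)) N
      push_cast at this
      rw [this]; simp
    simp_rw [e]
    refine Tendsto.sub_const ?_ 1
    rw [tendsto_zero_iff_norm_tendsto_zero]
    have h2 : Tendsto (fun N : ℕ => ((N:ℝ) + 1) ^ (-(s.re - 1))) atTop (𝓝 0) :=
      (tendsto_rpow_neg_atTop (by linarith)).comp (tendsto_atTop_add_const_right _ 1 tendsto_natCast_atTop_atTop)
    refine h2.congr fun N => ?_
    have := natp_norm N 0 le_rfl (1 - s)
    simp only [Complex.ofReal_zero, add_zero] at this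
    rw [this]; simp
  have h2 : Tendsto (fun N : ℕ => ∑ n ∈ Finset.range N, bz n s) atTop (𝓝 ((s - 1) * riemannZeta s + (0 - 1))) := by
    simp_rw [bz, Finset.sum_add_distrib]
    refine Tendsto.add ?_ h1
    simp_rw [← Finset.mul_sum]
    refine Tendsto.const_mul _ ?_
    have := hz.hasSum.tendsto_sum_nat
    rw [zeta_eq_tsum_one_div_nat_add_one_cpow hs]
    convert this using 2
    refine tsum_congr fun n => ?_
    rw [Complex.cpow_neg]; simp
  have := tendsto_nhds_unique (bz_summable s (by linarith)).hasSum.tendsto_sum_nat h2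
  rw [this]; ring

lemma zeta1_eq (s : ℂ) (hs : 0 < s.re) : riemannZeta₁ s = 1 + ∑' n, bz n s := by
  set δ := min (s.re) 1 / 2 with hδ
  have hδ0 : 0 < δ := by positivity
  have hδs : δ < s.re := by have := min_le_left s.re 1; linarith
  have hδ1 : δ ≤ 1/2 := by have := min_le_right s.re 1; linarith
  set R := ‖s‖ + 3
  set U : Set ℂ := {z | δ < z.re} ∩ Metric.ball 0 R with hU
  have hUo : IsOpen U := (isOpen_lt continuous_const Complex.continuous_re).inter Metric.isOpen_ball
  have hconv : Convex ℝ U := (convex_halfSpace_re_gt δ).inter (convex_ball _ _)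
  have hd : DifferentiableOn ℂ (fun w : ℂ => ∑' i, bz i w) U := by
    refine Complex.differentiableOn_tsum_of_summable_norm (u := fun n => (R + 1) * R * ((n:ℝ) + 1) ^ (-(δ + 1)))
      ((summable_nat_rpow _ (by linarith)).mul_left _) (fun i => (bz_diff i).differentiableOn) hUo fun n w hw => ?_
    have hwR : ‖w‖ ≤ R := by have := hw.2; simp at this; exact this.le
    have hwδ : δ < w.re := hw.1
    refine (bz_norm n w (by linarith)).trans ?_
    have : ‖w - 1‖ ≤ R + 1 := (norm_sub_le _ _).trans (by simp; exact hwR)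
    gcongr
    · linarith
    · linarith
  have h1 : AnalyticOnNhd ℂ riemannZeta₁ U := fun z _ => differentiable_riemannZeta₁.analyticAt z
  have h2 : AnalyticOnNhd ℂ (fun w : ℂ => 1 + ∑' i, bz i w) U := (hd.const_add 1).analyticOnNhd hUo
  have h2U : (2:ℂ) ∈ U := ⟨by simp; linarith, by simp [R]; have := norm_nonneg s; linarith⟩
  refine h1.eqOn_of_preconnected_of_eventuallyEq h2 hconv.isPreconnected h2U ?_ ⟨hδs, by simp [R]⟩
  have : {z : ℂ | 1 < z.re} ∈ 𝓝 (2:ℂ) := (isOpen_lt continuous_const Complex.continuous_re).mem_nhds (by simp)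
  filter_upwards [this] with z hz
  have hz1 : z ≠ 1 := fun h => by simp [h] at hz
  rw [bz_sum z hz, riemannZeta_eq_inv_sub_mul hz1]
  have := sub_ne_zero.mpr hz1
  field_simp
  ring

lemma zeta_growth : ∃ C : ℝ, 1 ≤ C ∧ ∀ s : ℂ, 1/10 ≤ s.re → 1 ≤ s.im → ‖riemannZeta s‖ ≤ C * ‖s‖ := by
  set Z := ∑' n : ℕ, ((n:ℝ) + 1) ^ (-(11/10 : ℝ)) with hZ
  have hsum := summable_nat_rpow (11/10) (by norm_num)
  have hZ0 : 0 ≤ Z := tsum_nonneg fun n => by positivity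
  refine ⟨1 + Z, by linarith, fun s hs ht => ?_⟩
  have hs1 : s ≠ 1 := fun h => by simp [h] at ht; linarith
  have hn1 : 1 ≤ ‖s - 1‖ := by
    have := Complex.abs_im_le_norm (s - 1)
    simp at this
    exact (ht.trans (le_abs_self _)).trans this
  have hn2 : 1 ≤ ‖s‖ := (ht.trans (le_abs_self _)).trans (Complex.abs_im_le_norm s)
  have hb : ‖∑' n, bz n s‖ ≤ ‖s - 1‖ * ‖s‖ * Z := by
    rw [hZ, ← tsum_mul_left]
    refine tsum_of_norm_bounded (hsum.mul_left _).hasSum fun n => ?_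
    refine (bz_norm n s (by linarith)).trans ?_
    gcongr
    · have : (0:ℝ) ≤ n := Nat.cast_nonneg n
      linarith
    · linarith
  rw [riemannZeta_eq_inv_sub_mul hs1, zeta1_eq s (by linarith), norm_mul, norm_inv, inv_mul_le_iff₀ (by linarith)]
  refine (norm_add_le _ _).trans ?_
  rw [norm_one]
  nlinarith [mul_le_mul hn1 hn2 zero_le_one (by linarith)]

lemma zeta_two_lower (t : ℝ) : 1/3 ≤ ‖riemannZeta (2 + t * Complex.I)‖ := by
  set s : ℂ := 2 + t * Complex.I with hs
  have hre : s.re = 2 := by simp [hs]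
  have hsum : Summable fun n : ℕ => 1 / ((n:ℂ) + 1) ^ s := by
    have := (summable_nat_add_iff 1).mpr (Complex.summable_one_div_nat_cpow (p := s) |>.mpr (by rw [hre]; norm_num))
    simpa using this
  have hnorm : ∀ n : ℕ, ‖1 / ((n:ℂ) + 1) ^ s‖ = 1 / ((n:ℝ) + 1) ^ 2 := fun n => by
    have := natp_norm n 0 le_rfl s
    simp only [Complex.ofReal_zero, add_zero] at this
    rw [norm_div, norm_one, this, hre]; norm_num
  have hz2 : HasSum (fun n : ℕ => 1 / ((n:ℝ) + 1) ^ 2) (Real.pi ^ 2 / 6) := by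
    have := (hasSum_nat_add_iff' 1).mpr hasSum_zeta_two
    simpa using this
  have h2 := (hasSum_nat_add_iff' 1).mpr hz2
  have h1 : riemannZeta s = 1 + ∑' n : ℕ, 1 / (((n + 1 : ℕ):ℂ) + 1) ^ s := by
    rw [zeta_eq_tsum_one_div_nat_add_one_cpow (by rw [hre]; norm_num), hsum.tsum_eq_zero_add]
    simp
  have h3 : ‖∑' n : ℕ, 1 / (((n + 1 : ℕ):ℂ) + 1) ^ s‖ ≤ Real.pi ^ 2 / 6 - 1 := by
    have := tsum_of_norm_bounded (f := fun n : ℕ => 1 / (((n + 1 : ℕ):ℂ) + 1) ^ s) h2 (fun n => by rw [hnorm])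
    simpa using this
  have hpi := Real.pi_lt_d2
  have hpi0 := Real.pi_pos
  have : Real.pi ^ 2 ≤ 10 - 1/100 := by nlinarith
  have h4 := norm_sub_norm_le (1:ℂ) (-(∑' n : ℕ, 1 / (((n + 1 : ℕ):ℂ) + 1) ^ s))
  rw [norm_neg, norm_one, sub_neg_eq_add, ← h1] at h4
  linarith

lemma order_unit_mul (h f : ℂ → ℂ) (z : ℂ) (hh : AnalyticAt ℂ h z) (hf : AnalyticAt ℂ f z) (h0 : h z ≠ 0) :
    analyticOrderAt (h * f) z = analyticOrderAt f z := by
  rw [analyticOrderAt_mul hh hf, hh.analyticOrderAt_eq_zero.mpr h0, zero_add]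

lemma zeta_analyticAt (z : ℂ) (hz : z ≠ 1) : AnalyticAt ℂ riemannZeta z := by
  refine DifferentiableOn.analyticAt (s := {1}ᶜ) (fun w hw => (differentiableAt_riemannZeta hw).differentiableWithinAt)
    (isOpen_compl_singleton.mem_nhds hz)

lemma zeta_order_ne_top (z : ℂ) (hz : z ≠ 1) : analyticOrderAt riemannZeta z ≠ ⊤ := by
  have hU : IsPreconnected ({1}ᶜ : Set ℂ) :=
    (isConnected_compl_singleton_of_one_lt_rank (by simp) 1).isPreconnected
  have h1 : AnalyticOnNhd ℂ riemannZeta {1}ᶜ := fun w hw => zeta_analyticAt w hw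
  refine h1.analyticOrderAt_ne_top_of_isPreconnected hU (x := 2) (by simp) hz ?_
  rw [(zeta_analyticAt 2 (by norm_num)).analyticOrderAt_eq_zero.mpr]
  · simp
  · exact riemannZeta_ne_zero_of_one_le_re (by simp)

lemma zeta_ord_pos (z : ℂ) (hz : z ≠ 1) (h0 : riemannZeta z = 0) : 1 ≤ ordN riemannZeta z := by
  have h1 := (zeta_analyticAt z hz).analyticOrderAt_ne_zero.mpr h0
  rw [← Nat.cast_analyticOrderNatAt (zeta_order_ne_top z hz)] at h1
  exact Nat.one_le_iff_ne_zero.mpr (by exact_mod_cast h1)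

lemma zeta_local : ∃ A : ℝ, 1 ≤ A ∧ ∀ T : ℝ, 4 ≤ T → ∃ S : Finset ℂ,
    (∀ ρ, ρ ∈ S ↔ ‖ρ - (2 + T * Complex.I)‖ ≤ 18/10 ∧ riemannZeta ρ = 0) ∧
    (∑ ρ ∈ S, (ordN riemannZeta ρ : ℝ)) ≤ A * Real.log T ∧
    ∀ s, ‖s - (2 + T * Complex.I)‖ ≤ 16/10 → riemannZeta s ≠ 0 →
      ‖logDeriv riemannZeta s‖ ≤ ∑ ρ ∈ S, (ordN riemannZeta ρ : ℝ) * (1 / ‖s - ρ‖) + A * Real.log T := by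
  obtain ⟨C, hC1, hC⟩ := zeta_growth
  refine ⟨20000 * (1 + Real.log (6 * C)), ?_, fun T hT => ?_⟩
  · have := Real.log_nonneg (show (1:ℝ) ≤ 6 * C by linarith)
    linarith
  set s0 : ℂ := 2 + T * Complex.I with hs0
  have hlogT : 1 ≤ Real.log T := by
    rw [Real.le_log_iff_exp_le (by linarith)]
    exact Real.exp_one_lt_d9.le.trans (by norm_num; linarith)
  have h6C := Real.log_nonneg (show (1:ℝ) ≤ 6 * C by linarith)
  set M := Real.log (6 * C) + Real.log T with hM
  have hM1 : 1 ≤ M := by linarith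
  have hMA : M ≤ (1 + Real.log (6 * C)) * Real.log T := by nlinarith
  have hexpM : Real.exp M = 6 * C * T := by
    rw [hM, Real.exp_add, Real.exp_log (by linarith), Real.exp_log (by linarith)]
  have hz0 := zeta_two_lower T
  rw [← hs0] at hz0
  have hz0' : riemannZeta s0 ≠ 0 := fun h => by rw [h] at hz0; norm_num at hz0
  have him : ∀ z : ℂ, ‖z‖ ≤ 2 → 2 ≤ (s0 + z).im := fun z hz => by
    have := (abs_le.mp (Complex.abs_im_le_norm z)).1
    simp [hs0]; linarith
  have hne1 : ∀ z : ℂ, ‖z‖ ≤ 2 → s0 + z ≠ 1 := fun z hz h => by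
    have := him z hz
    rw [h] at this; norm_num at this
  set f : ℂ → ℂ := fun z => (riemannZeta s0)⁻¹ * riemannZeta (s0 + z) with hf
  have hfc : f = (fun _ => (riemannZeta s0)⁻¹) * (riemannZeta ∘ fun z => s0 + z) := rfl
  have hadd : ∀ z, AnalyticAt ℂ (fun z => s0 + z) z := fun z => by fun_prop
  have hord : ∀ z : ℂ, ‖z‖ ≤ 2 → ordN f z = ordN riemannZeta (s0 + z) := fun z hz => by
    unfold ordN analyticOrderNatAt
    rw [hfc, order_unit_mul _ _ _ analyticAt_const ((zeta_analyticAt _ (hne1 z hz)).comp (hadd z)) (inv_ne_zero hz0'),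
      analyticOrderAt_comp_of_deriv_ne_zero (hadd z) (by simp)]
  obtain ⟨S, hS, hc, hl⟩ := landau f M hM1
    (fun z hz => by
      have hz' : ‖z‖ ≤ 2 := by simpa using (Metric.mem_ball.mp hz).le
      refine DifferentiableAt.differentiableWithinAt ?_
      exact ((differentiableAt_riemannZeta (hne1 z hz')).comp z (by fun_prop)).const_mul _)
    (by simp [hf, hz0'])
    (fun z hz => by
      rw [hexpM]
      simp only [hf, norm_mul, norm_inv]
      have h1 := hC (s0 + z) (by
        have := (abs_le.mp (Complex.abs_re_le_norm z)).1
        simp [hs0]; linarith) (by linarith [him z (by linarith)])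
      have h2 : ‖s0 + z‖ ≤ 2 * T := by
        have : ‖s0‖ ≤ 2 + T := by
          refine (norm_add_le _ _).trans ?_
          simp [abs_of_nonneg (show 0 ≤ T by linarith)]
        refine (norm_add_le _ _).trans ?_
        linarith
      have h3 : ‖riemannZeta s0‖⁻¹ ≤ 3 := by
        rw [inv_le_comm₀ (by linarith) (by norm_num)]; linarith
      calc _ ≤ 3 * (C * (2 * T)) := by
            have : ‖riemannZeta (s0 + z)‖ ≤ C * (2 * T) := h1.trans (by gcongr)
            gcongr
        _ = _ := by ring)
  refine ⟨S.map (addLeftEmbedding s0), fun ρ => ?_, ?_, fun s hs hs0' => ?_⟩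
  · rw [Finset.mem_map]
    constructor
    · rintro ⟨z, hz, rfl⟩
      have := (hS z).mp hz
      simp only [addLeftEmbedding_apply, add_sub_cancel_left]
      refine ⟨this.1, ?_⟩
      simpa [hf, hz0'] using this.2
    · rintro ⟨h1, h2⟩
      exact ⟨ρ - s0, (hS _).mpr ⟨h1, by simp [hf, h2]⟩, by simp⟩
  · rw [Finset.sum_map]
    simp only [addLeftEmbedding_apply]
    have : ∑ z ∈ S, (ordN f z : ℝ) = ∑ z ∈ S, (ordN riemannZeta (s0 + z) : ℝ) :=
      Finset.sum_congr rfl fun z hz => by rw [hord z (by linarith [((hS z).mp hz).1])]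
    rw [← this]
    linarith
  · rw [Finset.sum_map]
    simp only [addLeftEmbedding_apply]
    have h1 := hl (s - s0) hs (by simp [hf, hz0', hs0'])
    have h2 : logDeriv f (s - s0) = logDeriv riemannZeta s := by
      rw [hf, logDeriv_const_mul _ _ (inv_ne_zero hz0')]
      have := logDeriv_comp (f := riemannZeta) (g := fun z => s0 + z) (x := s - s0)
        (differentiableAt_riemannZeta (hne1 _ (by linarith))) (by fun_prop)
      simp only [Function.comp_def] at this
      rw [this]
      simp
    rw [h2] at h1
    refine h1.trans (add_le_add (le_of_eq (Finset.sum_congr rfl fun z hz => ?_)) (by linarith))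
    rw [hord z (by linarith [((hS z).mp hz).1])]
    congr 3
    ring

lemma good_height : ∃ A : ℝ, 1 ≤ A ∧ ∀ U : ℝ, 4 ≤ U → ∃ t : ℝ, U < t ∧ t < U + 1 ∧
    ∀ σ : ℝ, 1/2 ≤ σ → σ ≤ 2 → riemannZeta (σ + t * Complex.I) ≠ 0 ∧
      ‖logDeriv riemannZeta (σ + t * Complex.I)‖ ≤ A * Real.log U ^ 2 := by
  obtain ⟨A, hA1, hA⟩ := zeta_local
  refine ⟨20 * A ^ 2 + 10 * A, by nlinarith, fun U hU => ?_⟩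
  obtain ⟨S, hS, hc, hl⟩ := hA (U + 1/2) (by linarith)
  have hlogU : 1 ≤ Real.log U := by
    rw [Real.le_log_iff_exp_le (by linarith)]
    exact Real.exp_one_lt_d9.le.trans (by norm_num; linarith)
  have hlogT : Real.log (U + 1/2) ≤ 2 * Real.log U := by
    rw [← Real.log_rpow (by linarith)]
    refine Real.log_le_log (by linarith) ?_
    norm_num
    nlinarith
  set L := Real.log U
  have hN : (S.card : ℝ) ≤ 2 * A * L := by
    have : (S.card : ℝ) ≤ ∑ ρ ∈ S, (ordN riemannZeta ρ : ℝ) := by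
      rw [Finset.card_eq_sum_ones]; push_cast
      refine Finset.sum_le_sum fun ρ hρ => ?_
      have h := (hS ρ).mp hρ
      exact_mod_cast zeta_ord_pos ρ (fun h1 => riemannZeta_ne_zero_of_one_le_re (by simp [h1]) h.2) h.2
    nlinarith
  set δ : ℝ := 1 / (4 * (S.card + 1)) with hδ
  have hδ0 : 0 < δ := by positivity
  obtain ⟨t, ht, htS⟩ : ∃ t ∈ Ioo U (U + 1), ∀ ρ ∈ S, δ ≤ |t - ρ.im| := by
    by_contra hcon
    push Not at hcon
    have h1 : Ioo U (U+1) ⊆ ⋃ ρ ∈ S, Ioo (ρ.im - δ) (ρ.im + δ) := fun t ht => by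
      obtain ⟨ρ, hρ, h⟩ := hcon t ht
      simp only [mem_iUnion]
      rw [abs_lt] at h
      exact ⟨ρ, hρ, by constructor <;> linarith⟩
    have h2 := (measure_mono (μ := volume) h1).trans (measure_biUnion_finset_le S _)
    simp only [Real.volume_Ioo] at h2
    rw [← ENNReal.ofReal_sum_of_nonneg (fun i _ => by linarith)] at h2
    rw [ENNReal.ofReal_le_ofReal_iff (Finset.sum_nonneg fun i _ => by linarith)] at h2
    have h3 : ∑ ρ ∈ S, ((ρ:ℂ).im + δ - (ρ.im - δ)) = S.card * (2 * δ) := by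
      rw [Finset.sum_congr rfl fun ρ _ => show (ρ:ℂ).im + δ - (ρ.im - δ) = 2 * δ by ring]
      simp
    rw [h3] at h2
    have h4 : (S.card : ℝ) * (2 * δ) ≤ 1/2 := by
      rw [hδ]; rw [show (S.card : ℝ) * (2 * (1 / (4 * (S.card + 1)))) = S.card / (2 * (S.card + 1)) by field_simp; ring]
      rw [div_le_iff₀ (by positivity)]; linarith
    linarith
  refine ⟨t, ht.1, ht.2, fun σ h1 h2 => ?_⟩
  have hd : ‖(σ + t * Complex.I : ℂ) - (2 + ((U + 1/2 : ℝ):ℂ) * Complex.I)‖ ≤ 16/10 := by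
    have : (σ + t * Complex.I : ℂ) - (2 + ((U + 1/2 : ℝ):ℂ) * Complex.I) = ((σ - 2 : ℝ):ℂ) + ((t - U - 1/2 : ℝ) : ℂ) * Complex.I := by
      push_cast; ring
    rw [this, Complex.norm_add_mul_I]
    refine Real.sqrt_le_iff.mpr ⟨by norm_num, ?_⟩
    have := ht.1
    have := ht.2
    nlinarith
  have hne : riemannZeta (σ + t * Complex.I) ≠ 0 := fun h0 => by
    have := htS _ ((hS _).mpr ⟨hd.trans (by norm_num), h0⟩)
    simp at this
    linarith
  refine ⟨hne, (hl _ hd hne).trans ?_⟩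
  have h5 : ∑ ρ ∈ S, (ordN riemannZeta ρ : ℝ) * (1 / ‖(σ + t * Complex.I : ℂ) - ρ‖) ≤
      (∑ ρ ∈ S, (ordN riemannZeta ρ : ℝ)) * (1/δ) := by
    rw [Finset.sum_mul]
    refine Finset.sum_le_sum fun ρ hρ => ?_
    have h6 : δ ≤ ‖(σ + t * Complex.I : ℂ) - ρ‖ := by
      refine (htS ρ hρ).trans ?_
      have := Complex.abs_im_le_norm ((σ + t * Complex.I : ℂ) - ρ)
      simpa using this
    gcongr
  have h7 : 1/δ ≤ 4 * (2 * A * L + 1) := by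
    rw [hδ, one_div_one_div]; linarith
  have h8 : (∑ ρ ∈ S, (ordN riemannZeta ρ : ℝ)) * (1/δ) ≤ (A * (2 * L)) * (4 * (2 * A * L + 1)) := by
    have : (∑ ρ ∈ S, (ordN riemannZeta ρ : ℝ)) ≤ A * (2 * L) := hc.trans (by gcongr)
    gcongr
  have h9 : A * Real.log (U + 1/2) ≤ A * (2 * L) := by gcongr
  have h10 : A * L ≤ A * L ^ 2 := by gcongr; nlinarith
  linarith [sq_nonneg (A * L)]

noncomputable def rI (f : ℂ → ℂ) (a b c d : ℝ) : ℂ :=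
  (∫ x in a..b, f (x + c * Complex.I)) - (∫ x in a..b, f (x + d * Complex.I)) +
  Complex.I * (∫ y in c..d, f (b + y * Complex.I)) - Complex.I * (∫ y in c..d, f (a + y * Complex.I))

def bdR (a b c d : ℝ) : Set ℂ :=
  {z | z.re ∈ Icc a b ∧ z.im ∈ Icc c d ∧ (z.re = a ∨ z.re = b ∨ z.im = c ∨ z.im = d)}

lemma rI_congr {f g : ℂ → ℂ} {a b c d : ℝ} (hab : a ≤ b) (hcd : c ≤ d) (h : ∀ z ∈ bdR a b c d, f z = g z) :
    rI f a b c d = rI g a b c d := by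
  unfold rI
  have h1 : ∀ e, (e = c ∨ e = d) → (∫ x in a..b, f (x + e * Complex.I)) = ∫ x in a..b, g (x + e * Complex.I) := fun e he => by
    refine intervalIntegral.integral_congr fun x hx => ?_
    rw [uIcc_of_le hab] at hx
    refine h _ ⟨by simpa using hx, ?_, ?_⟩ <;> rcases he with rfl | rfl <;> simp [hcd]
  have h2 : ∀ e, (e = a ∨ e = b) → (∫ y in c..d, f (e + y * Complex.I)) = ∫ y in c..d, g (e + y * Complex.I) := fun e he => by
    refine intervalIntegral.integral_congr fun x hx => ?_
    rw [uIcc_of_le hcd] at hx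
    refine h _ ⟨?_, by simpa using hx, ?_⟩ <;> rcases he with rfl | rfl <;> simp [hab]
  rw [h1 c (Or.inl rfl), h1 d (Or.inr rfl), h2 a (Or.inl rfl), h2 b (Or.inr rfl)]

lemma rI_int {f : ℂ → ℂ} {a b c d : ℝ} (hab : a ≤ b) (hcd : c ≤ d) (h : ContinuousOn f (bdR a b c d)) :
    (∀ e, (e = c ∨ e = d) → IntervalIntegrable (fun x : ℝ => f (x + e * Complex.I)) volume a b) ∧
    (∀ e, (e = a ∨ e = b) → IntervalIntegrable (fun y : ℝ => f (e + y * Complex.I)) volume c d) := by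
  constructor
  · intro e he
    refine ContinuousOn.intervalIntegrable ?_
    refine h.comp (by fun_prop) fun x hx => ?_
    rw [uIcc_of_le hab] at hx
    refine ⟨by simpa using hx, ?_, ?_⟩ <;> rcases he with rfl | rfl <;> simp [hcd]
  · intro e he
    refine ContinuousOn.intervalIntegrable ?_
    refine h.comp (by fun_prop) fun x hx => ?_
    rw [uIcc_of_le hcd] at hx
    refine ⟨?_, by simpa using hx, ?_⟩ <;> rcases he with rfl | rfl <;> simp [hab]

lemma rI_add {f g : ℂ → ℂ} {a b c d : ℝ} (hab : a ≤ b) (hcd : c ≤ d) (hf : ContinuousOn f (bdR a b c d))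
    (hg : ContinuousOn g (bdR a b c d)) : rI (fun z => f z + g z) a b c d = rI f a b c d + rI g a b c d := by
  obtain ⟨f1, f2⟩ := rI_int hab hcd hf
  obtain ⟨g1, g2⟩ := rI_int hab hcd hg
  unfold rI
  rw [intervalIntegral.integral_add (f1 c (Or.inl rfl)) (g1 c (Or.inl rfl)),
    intervalIntegral.integral_add (f1 d (Or.inr rfl)) (g1 d (Or.inr rfl)),
    intervalIntegral.integral_add (f2 a (Or.inl rfl)) (g2 a (Or.inl rfl)),
    intervalIntegral.integral_add (f2 b (Or.inr rfl)) (g2 b (Or.inr rfl))]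
  ring

lemma rI_const_mul (k : ℂ) (f : ℂ → ℂ) (a b c d : ℝ) : rI (fun z => k * f z) a b c d = k * rI f a b c d := by
  unfold rI
  simp only [intervalIntegral.integral_const_mul]
  ring

lemma rI_sum {ι : Type*} (S : Finset ι) (f : ι → ℂ → ℂ) {a b c d : ℝ} (hab : a ≤ b) (hcd : c ≤ d)
    (hf : ∀ i ∈ S, ContinuousOn (f i) (bdR a b c d)) :
    rI (fun z => ∑ i ∈ S, f i z) a b c d = ∑ i ∈ S, rI (f i) a b c d := by
  classical
  induction S using Finset.induction_on with
  | empty => simp [rI]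
  | insert i S hi ih =>
    simp only [Finset.sum_insert hi]
    rw [rI_add hab hcd (hf i (by simp)) (continuousOn_finsetSum _ fun j hj => hf j (by simp [hj])),
      ih fun j hj => hf j (by simp [hj])]

lemma rI_zero {f : ℂ → ℂ} {a b c d : ℝ} (hab : a ≤ b) (hcd : c ≤ d)
    (hf : ∀ z : ℂ, z.re ∈ Icc a b → z.im ∈ Icc c d → DifferentiableAt ℂ f z) : rI f a b c d = 0 := by
  have := Complex.integral_boundary_rect_eq_zero_of_differentiableOn f (a + c * Complex.I) (b + d * Complex.I)
    (fun z hz => by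
      simp only [Complex.add_re, Complex.ofReal_re, Complex.mul_re, Complex.I_re, mul_zero, Complex.ofReal_im, Complex.I_im,
        mul_one, sub_self, add_zero, Complex.add_im, Complex.mul_im, zero_add, uIcc_of_le hab, uIcc_of_le hcd] at hz
      exact (hf z hz.1 hz.2).differentiableWithinAt)
  simpa [rI] using this

lemma line_log (p q : ℂ) (A B : ℝ) (h : ∀ x ∈ uIcc A B, p + x * q ∈ Complex.slitPlane) :
    ∫ x in A..B, q * (p + x * q)⁻¹ = Complex.log (p + B * q) - Complex.log (p + A * q) := by
  refine intervalIntegral.integral_eq_sub_of_hasDerivAt (f := fun x : ℝ => Complex.log (p + x * q)) (fun x hx => ?_) ?_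
  · have h1 : HasDerivAt (fun z : ℂ => p + z * q) q (x:ℂ) := by
      simpa using ((hasDerivAt_id (x:ℂ)).mul_const q).const_add p
    have h2 := h1.clog (h x hx)
    rw [div_eq_mul_inv] at h2
    exact h2.comp_ofReal
  · refine ContinuousOn.intervalIntegrable ?_
    refine continuousOn_const.mul (ContinuousOn.inv₀ (by fun_prop) fun x hx => Complex.slitPlane_ne_zero (h x hx))

lemma log_neg_pos {w : ℂ} (h : 0 < w.im) : Complex.log (-w) = Complex.log w - Real.pi * Complex.I := by
  simp only [Complex.log, norm_neg, Complex.arg_neg_eq_arg_sub_pi_of_im_pos h]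
  push_cast; ring

lemma log_neg_neg {w : ℂ} (h : w.im < 0) : Complex.log (-w) = Complex.log w + Real.pi * Complex.I := by
  simp only [Complex.log, norm_neg, Complex.arg_neg_eq_arg_add_pi_of_im_neg h]
  push_cast; ring

lemma rI_inv {a b c d : ℝ} (ρ : ℂ) (h1 : a < ρ.re) (h2 : ρ.re < b) (h3 : c < ρ.im) (h4 : ρ.im < d) :
    rI (fun z => (z - ρ)⁻¹) a b c d = 2 * Real.pi * Complex.I := by
  have e1 : ∀ e : ℝ, e ≠ ρ.im → (∫ x in a..b, ((x:ℂ) + e * Complex.I - ρ)⁻¹) =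
      Complex.log (b + e * Complex.I - ρ) - Complex.log (a + e * Complex.I - ρ) := fun e he => by
    have := line_log (e * Complex.I - ρ) 1 a b (fun x _ => Complex.mem_slitPlane_iff.mpr (Or.inr (by
      simp; exact sub_ne_zero.mpr he)))
    simp only [mul_one, one_mul] at this
    convert this using 2
    · ext x; congr 1; ring
    · congr 1; ring
    · congr 1; ring
  have e2 : Complex.I * (∫ y in c..d, ((b:ℂ) + y * Complex.I - ρ)⁻¹) =
      Complex.log (b + d * Complex.I - ρ) - Complex.log (b + c * Complex.I - ρ) := by
    have := line_log (b - ρ) Complex.I c d (fun x _ => Complex.mem_slitPlane_iff.mpr (Or.inl (by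
      simp; exact h2)))
    rw [← intervalIntegral.integral_const_mul]
    simp only [show ∀ x : ℝ, (b:ℂ) - ρ + x * Complex.I = b + x * Complex.I - ρ from fun x => by ring] at this
    exact this
  have e3 : Complex.I * (∫ y in c..d, ((a:ℂ) + y * Complex.I - ρ)⁻¹) =
      Complex.log (-(a + d * Complex.I - ρ)) - Complex.log (-(a + c * Complex.I - ρ)) := by
    have := line_log (-(a - ρ)) (-Complex.I) c d (fun x _ => Complex.mem_slitPlane_iff.mpr (Or.inl (by
      simp; exact h1)))
    rw [← intervalIntegral.integral_const_mul]
    simp only [show ∀ x : ℝ, -((a:ℂ) - ρ) + x * -Complex.I = -(a + x * Complex.I - ρ) from fun x => by ring, inv_neg,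
      neg_mul_neg] at this
    exact this
  unfold rI
  rw [e1 c h3.ne, e1 d h4.ne', e2, e3, log_neg_pos (by simp; exact h4), log_neg_neg (by simp; exact h3)]
  ring

lemma arg_principle {V : Set ℂ} (hV : IsOpen V) (f g : ℂ → ℂ) (hf : DifferentiableOn ℂ f V) (hg : Differentiable ℂ g)
    {a b c d : ℝ} (hab : a ≤ b) (hcd : c ≤ d) (hR : ∀ z : ℂ, z.re ∈ Icc a b → z.im ∈ Icc c d → z ∈ V)
    (S : Finset ℂ) (hS : ∀ ρ, ρ ∈ S ↔ ρ.re ∈ Icc a b ∧ ρ.im ∈ Icc c d ∧ f ρ = 0)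
    (hord : ∀ ρ ∈ S, analyticOrderAt f ρ ≠ ⊤)
    (hint : ∀ ρ ∈ S, a < ρ.re ∧ ρ.re < b ∧ c < ρ.im ∧ ρ.im < d) :
    rI (fun s => logDeriv f s * g s) a b c d = 2 * Real.pi * Complex.I * ∑ ρ ∈ S, (ordN f ρ : ℂ) * g ρ := by
  obtain ⟨G, hG, hfG, hG0⟩ := factor_finset hV f hf (fun ρ => ordN f ρ) S (fun ρ hρ => ⟨hR ρ ((hS ρ).mp hρ).1 ((hS ρ).mp hρ).2.1,
    (Nat.cast_analyticOrderNatAt (hord ρ hρ)).symm⟩)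
  have hGne : ∀ z : ℂ, z.re ∈ Icc a b → z.im ∈ Icc c d → G z ≠ 0 := fun z h1 h2 h0 => by
    have : z ∈ S := (hS z).mpr ⟨h1, h2, by rw [hfG, h0, mul_zero]⟩
    exact hG0 z this h0
  have hbdS : ∀ z ∈ bdR a b c d, z ∉ S := fun z hz hzS => by
    obtain ⟨h1, h2, h3, h4⟩ := hint z hzS
    rcases hz.2.2 with h | h | h | h <;> linarith
  have hGd : ∀ z : ℂ, z.re ∈ Icc a b → z.im ∈ Icc c d → DifferentiableAt ℂ (logDeriv G) z := fun z h1 h2 => by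
    have hz : V ∈ 𝓝 z := hV.mem_nhds (hR z h1 h2)
    exact ((hG.deriv hV).differentiableAt hz).div (hG.differentiableAt hz) (hGne z h1 h2)
  set h : ℂ → ℂ := fun z => ∑ ρ ∈ S, (ordN f ρ : ℂ) * dslope g ρ z + logDeriv G z * g z with hh
  have hhd : ∀ z : ℂ, z.re ∈ Icc a b → z.im ∈ Icc c d → DifferentiableAt ℂ h z := fun z h1 h2 => by
    refine DifferentiableAt.add (DifferentiableAt.fun_sum fun ρ hρ => DifferentiableAt.const_mul ?_ _) ((hGd z h1 h2).mul (hg z))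
    exact ((Complex.differentiableOn_dslope (c := ρ) (s := univ) (by simp)).mpr hg.differentiableOn).differentiableAt (by simp)
  have hci : ∀ ρ ∈ S, ContinuousOn (fun z => (ordN f ρ : ℂ) * g ρ * (z - ρ)⁻¹) (bdR a b c d) := fun ρ hρ => by
    refine continuousOn_const.mul (ContinuousOn.inv₀ (by fun_prop) fun z hz h0 => ?_)
    exact hbdS z hz ((sub_eq_zero.mp h0) ▸ hρ)
  have hch : ContinuousOn h (bdR a b c d) := fun z hz => (hhd z hz.1 hz.2.1).continuousAt.continuousWithinAt
  have key : rI (fun s => logDeriv f s * g s) a b c d = rI (fun z => (∑ ρ ∈ S, (ordN f ρ : ℂ) * g ρ * (z - ρ)⁻¹) + h z) a b c d := by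
    refine rI_congr hab hcd fun z hz => ?_
    have hzS := hbdS z hz
    have hfz : f z ≠ 0 := fun h0 => hzS ((hS z).mpr ⟨hz.1, hz.2.1, h0⟩)
    rw [logDeriv_factor hV f G hG _ S hfG z (hR z hz.1 hz.2.1) hfz]
    simp only [hh]
    rw [add_mul, ← add_assoc, ← Finset.sum_add_distrib, Finset.sum_mul]
    congr 1
    refine Finset.sum_congr rfl fun ρ hρ => ?_
    have hne : z ≠ ρ := fun h => hzS (h ▸ hρ)
    rw [dslope_of_ne _ hne, slope_def_field]
    have := sub_ne_zero.mpr hne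
    field_simp
    ring
  rw [key, rI_add hab hcd (continuousOn_finsetSum _ hci) hch, rI_zero hab hcd hhd, add_zero, rI_sum S _ hab hcd hci, Finset.mul_sum]
  refine Finset.sum_congr rfl fun ρ hρ => ?_
  obtain ⟨h1, h2, h3, h4⟩ := hint ρ hρ
  rw [rI_const_mul, rI_inv ρ h1 h2 h3 h4]
  ring

lemma XX_eq (s : ℂ) (hs : 0 < s.re) : completedRiemannZeta s = Complex.Gammaℝ s * riemannZeta s := by
  have h0 : s ≠ 0 := fun h => by simp [h] at hs
  rw [riemannZeta_def_of_ne_zero h0, mul_div_cancel₀ _ (Complex.Gammaℝ_ne_zero_of_re_pos hs)]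

lemma re_pos_nhds (s : ℂ) (hs : 0 < s.re) : {z : ℂ | 0 < z.re} ∈ 𝓝 s :=
  (isOpen_lt continuous_const Complex.continuous_re).mem_nhds hs

lemma half_not_neg (s : ℂ) (hs : 0 < s.re) : ∀ m : ℕ, s / 2 ≠ -m := fun m h => by
  have := congrArg Complex.re h
  simp at this
  have : (0:ℝ) ≤ m := by positivity
  linarith

lemma GammaR_diffAt (s : ℂ) (hs : 0 < s.re) : DifferentiableAt ℂ Complex.Gammaℝ s := by
  unfold Complex.Gammaℝ
  have h1 : DifferentiableAt ℂ (fun s => Complex.Gamma (s/2)) s :=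
    (Complex.differentiableAt_Gamma (s/2) (half_not_neg s hs)).comp s (by fun_prop)
  refine DifferentiableAt.mul ?_ h1
  exact DifferentiableAt.const_cpow (by fun_prop) (Or.inl (by simp [Real.pi_ne_zero]))

lemma GammaR_analyticAt (s : ℂ) (hs : 0 < s.re) : AnalyticAt ℂ Complex.Gammaℝ s :=
  DifferentiableOn.analyticAt (s := {z : ℂ | 0 < z.re}) (fun z hz => (GammaR_diffAt z hz).differentiableWithinAt) (re_pos_nhds s hs)

lemma XX_order (s : ℂ) (hs : 0 < s.re) (h1 : s ≠ 1) : analyticOrderAt completedRiemannZeta s = analyticOrderAt riemannZeta s := by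
  rw [← order_unit_mul Complex.Gammaℝ riemannZeta s (GammaR_analyticAt s hs) (zeta_analyticAt s h1)
    (Complex.Gammaℝ_ne_zero_of_re_pos hs)]
  refine analyticOrderAt_congr ?_
  filter_upwards [re_pos_nhds s hs] with z hz
  simp [XX_eq z hz]

lemma XX_conj (s : ℂ) (hs : 0 < s.re) : completedRiemannZeta (starRingEnd ℂ s) = starRingEnd ℂ (completedRiemannZeta s) := by
  rw [XX_eq s hs, XX_eq _ (by simpa using hs), map_mul, riemannZeta_conj]
  congr 1
  rw [Complex.Gammaℝ_def, Complex.Gammaℝ_def, map_mul, ← Complex.Gamma_conj]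
  have h1 : starRingEnd ℂ (s / 2) = starRingEnd ℂ s / 2 := by simp [Complex.conj_ofNat]
  have h2 := Complex.cpow_conj (Real.pi : ℂ) (-s / 2) (by
    rw [Complex.arg_ofReal_of_nonneg Real.pi_pos.le]; exact Real.pi_ne_zero.symm)
  rw [h1, ← Complex.conj_conj ((Real.pi : ℂ) ^ (-starRingEnd ℂ s / 2))]
  congr 2
  rw [show -starRingEnd ℂ s / 2 = starRingEnd ℂ (-s / 2) by simp [Complex.conj_ofNat], h2, Complex.conj_conj, Complex.conj_ofReal]

lemma XX_logDeriv_symm (s : ℂ) (hs : 0 < s.re) :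
    logDeriv completedRiemannZeta (1 - starRingEnd ℂ s) = - starRingEnd ℂ (logDeriv completedRiemannZeta s) := by
  have h1 : ∀ z, deriv completedRiemannZeta (1 - z) = - deriv completedRiemannZeta z := fun z => by
    have := deriv_comp_const_sub (f := completedRiemannZeta) 1 z
    simp only [completedRiemannZeta_one_sub] at this
    rw [this, neg_neg]
  have h2 : deriv completedRiemannZeta (starRingEnd ℂ s) = starRingEnd ℂ (deriv completedRiemannZeta s) := by
    have h3 := congrFun (deriv_conj_conj (f := completedRiemannZeta)) (starRingEnd ℂ s)
    have h4 : deriv completedRiemannZeta (starRingEnd ℂ s) = deriv (starRingEnd ℂ ∘ completedRiemannZeta ∘ starRingEnd ℂ) (starRingEnd ℂ s) := by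
      refine Filter.EventuallyEq.deriv_eq ?_
      filter_upwards [re_pos_nhds (starRingEnd ℂ s) (by simpa using hs)] with z hz
      simp [XX_conj z hz]
    rw [h4, h3]; simp
  rw [logDeriv_apply, logDeriv_apply, h1, completedRiemannZeta_one_sub, h2, XX_conj s hs, map_div₀, neg_div]

lemma iteratedDeriv_conj (f : ℂ → ℂ) (n : ℕ) : ∀ z, iteratedDeriv n (starRingEnd ℂ ∘ f ∘ starRingEnd ℂ) z =
    starRingEnd ℂ (iteratedDeriv n f (starRingEnd ℂ z)) := by
  induction n with
  | zero => intro z; simp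
  | succ n ih =>
    intro z
    have h := congrFun (deriv_conj_conj (f := iteratedDeriv n f)) z
    simp only [Function.comp_apply] at h
    rw [iteratedDeriv_succ, iteratedDeriv_succ, ← h]
    congr 1
    ext w
    exact ih w

lemma zetaMult_conj (ρ : ℂ) : zetaMult (starRingEnd ℂ ρ) = zetaMult ρ := by
  unfold zetaMult
  have h : starRingEnd ℂ ∘ riemannZeta ∘ starRingEnd ℂ = riemannZeta := by
    ext z; simp [riemannZeta_conj]
  congr 1
  ext n
  have := iteratedDeriv_conj riemannZeta n ρ
  rw [h] at this
  simp [this]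

lemma zetaMult_eq (ρ : ℂ) (h : ρ ≠ 1) : zetaMult ρ = ordN riemannZeta ρ := by
  unfold zetaMult
  have ha := zeta_analyticAt ρ h
  have hc := Nat.cast_analyticOrderNatAt (zeta_order_ne_top ρ h)
  refine le_antisymm (Nat.sInf_le ?_) (le_csInf ?_ ?_)
  · by_contra hcon
    simp only [mem_ofPred_eq, not_not] at hcon
    have h1 := (natCast_le_analyticOrderAt_iff_iteratedDeriv_eq_zero ha (n := ordN riemannZeta ρ)).mp hc.le
    have h2 := (natCast_le_analyticOrderAt_iff_iteratedDeriv_eq_zero ha (n := ordN riemannZeta ρ + 1)).mpr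
      (fun i hi => by
        rcases Nat.lt_succ_iff_lt_or_eq.mp hi with h | h
        · exact h1 i h
        · rw [h]; exact hcon)
    rw [← hc] at h2
    norm_cast at h2
    simp only [ordN] at h2
    omega
  · by_contra hcon
    rw [Set.not_nonempty_iff_eq_empty, Set.eq_empty_iff_forall_notMem] at hcon
    simp only [mem_ofPred_eq, not_not] at hcon
    have h2 := (natCast_le_analyticOrderAt_iff_iteratedDeriv_eq_zero ha (n := ordN riemannZeta ρ + 1)).mpr
      (fun i hi => hcon i)
    rw [← hc] at h2
    norm_cast at h2
    simp only [ordN] at h2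
    omega
  · intro n hn
    by_contra hlt
    push Not at hlt
    have h1 := (natCast_le_analyticOrderAt_iff_iteratedDeriv_eq_zero ha (n := ordN riemannZeta ρ)).mp hc.le
    exact hn (h1 n hlt)

lemma zetaMult_symm (ρ : ℂ) (h0 : 0 < ρ.re) (h1 : ρ.re < 1) : zetaMult (1 - starRingEnd ℂ ρ) = zetaMult ρ := by
  have hne : ∀ z : ℂ, z.re < 1 → z ≠ 1 := fun z hz h => by simp [h] at hz
  rw [← zetaMult_conj]
  simp only [map_sub, map_one, Complex.conj_conj]
  rw [zetaMult_eq _ (hne _ (by simpa using h0)), zetaMult_eq _ (hne _ h1)]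
  unfold ordN analyticOrderNatAt
  rw [← XX_order _ (by simpa using h1) (hne _ (by simpa using h0)), ← XX_order _ h0 (hne _ h1)]
  have := analyticOrderAt_comp_of_deriv_ne_zero (f := completedRiemannZeta) (g := fun z => 1 - z) (z₀ := ρ) (by fun_prop) (by simp)
  rw [← this]
  congr 2
  ext z
  simp [completedRiemannZeta_one_sub]

lemma zeta_symm_zero (ρ : ℂ) (h0 : 0 < ρ.re) (h1 : ρ.re < 1) (hz : riemannZeta ρ = 0) :
    riemannZeta (1 - starRingEnd ℂ ρ) = 0 := by
  have h2 : 1 ≤ zetaMult ρ := by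
    rw [zetaMult_eq _ (fun h => by simp [h] at h1)]
    exact zeta_ord_pos _ (fun h => by simp [h] at h1) hz
  by_contra h
  have : zetaMult (1 - starRingEnd ℂ ρ) = 0 := Nat.sInf_eq_zero.mpr (Or.inl (by simpa using h))
  rw [zetaMult_symm ρ h0 h1] at this
  omega

lemma logDeriv_GammaR (s : ℂ) (hs : 0 < s.re) :
    logDeriv Complex.Gammaℝ s = -Complex.log Real.pi / 2 + Complex.digamma (s / 2) / 2 := by
  have hpi : (Real.pi : ℂ) ≠ 0 := by simp [Real.pi_ne_zero]
  have h1 : HasDerivAt (fun s : ℂ => (Real.pi : ℂ) ^ (-s / 2)) ((Real.pi : ℂ) ^ (-s/2) * Complex.log Real.pi * (-1/2)) s :=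
    HasDerivAt.const_cpow (((hasDerivAt_id s).neg).div_const 2) (Or.inl hpi)
  have hd : DifferentiableAt ℂ (fun s : ℂ => Complex.Gamma (s / 2)) s :=
    (Complex.differentiableAt_Gamma (s/2) (half_not_neg s hs)).comp s (by fun_prop)
  have h0 : (Real.pi : ℂ) ^ (-s/2) ≠ 0 := by simp [Complex.cpow_eq_zero_iff, hpi]
  have hg0 : Complex.Gamma (s/2) ≠ 0 := Complex.Gamma_ne_zero (half_not_neg s hs)
  have e : Complex.Gammaℝ = fun s => (Real.pi : ℂ) ^ (-s / 2) * Complex.Gamma (s / 2) := rfl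
  rw [e, logDeriv_mul (f := fun s : ℂ => (Real.pi : ℂ) ^ (-s / 2)) (g := fun s : ℂ => Complex.Gamma (s / 2)) s h0 hg0 h1.differentiableAt hd]
  congr 1
  · rw [logDeriv_apply, h1.deriv]; field_simp
  · have := logDeriv_comp (f := Complex.Gamma) (g := fun z => z / 2) (x := s)
      (Complex.differentiableAt_Gamma (s/2) (half_not_neg s hs)) (by fun_prop)
    simp only [Function.comp_def] at this
    rw [this, Complex.digamma]
    simp
    ring

lemma log_line (σ t : ℝ) (hσ : 0 < σ) (ht : 0 < t) :
    ‖Complex.log (((σ : ℂ) + t * Complex.I) / 2) - ((Real.log (t / 2) : ℝ) + (Real.pi / 2) * Complex.I)‖ ≤ σ / t := by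
  have hsl : ∀ z : ℂ, 0 < z.im → z ∈ Complex.slitPlane := fun z hz => Complex.mem_slitPlane_iff.mpr (Or.inr hz.ne')
  have := Convex.norm_image_sub_le_of_norm_hasDerivWithin_le (s := {z : ℂ | t / 2 ≤ z.im}) (f := Complex.log)
    (f' := fun z => z⁻¹) (C := 2 / t) (x := t / 2 * Complex.I) (y := ((σ : ℂ) + t * Complex.I) / 2)
    (fun z hz => (Complex.hasDerivAt_log (hsl z (lt_of_lt_of_le (by positivity) hz))).hasDerivWithinAt)
    (fun z hz => by
      rw [norm_inv, inv_le_comm₀ (norm_pos_iff.mpr (Complex.slitPlane_ne_zero (hsl z (lt_of_lt_of_le (by positivity) hz)))) (by positivity)]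
      rw [inv_div]
      exact (show t / 2 ≤ z.im from hz).trans ((le_abs_self _).trans (Complex.abs_im_le_norm z)))
    (convex_halfSpace_im_ge _) (by simp) (by simp)
  have e1 : Complex.log ((t:ℂ) / 2 * Complex.I) = (Real.log (t / 2) : ℝ) + (Real.pi / 2) * Complex.I := by
    rw [show (t:ℂ) / 2 = ((t / 2 : ℝ) : ℂ) by push_cast; rfl, Complex.log_ofReal_mul (by positivity) Complex.I_ne_zero, Complex.log_I]
  rw [e1] at this
  refine this.trans (le_of_eq ?_)
  rw [show ((σ : ℂ) + t * Complex.I) / 2 - t / 2 * Complex.I = ((σ / 2 : ℝ) : ℂ) by push_cast; ring, Complex.norm_real,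
    Real.norm_of_nonneg (by positivity)]
  field_simp

lemma gam_bound (σ t : ℝ) (hσ : 0 < σ) (hσ2 : σ ≤ 2) (ht : 4 ≤ t) :
    ‖logDeriv Complex.Gammaℝ (σ + t * Complex.I) - ((Real.log (t / (2 * Real.pi)) / 2 : ℝ) + (Real.pi / 4) * Complex.I)‖ ≤ 5 / t := by
  rw [logDeriv_GammaR _ (by simpa using hσ)]
  have h1 := digamma_bound (((σ : ℂ) + t * Complex.I) / 2) (by simpa using hσ) (by simp; linarith)
  have h2 := log_line σ t hσ (by linarith)
  have e : Real.log (t / (2 * Real.pi)) = Real.log (t / 2) - Real.log Real.pi := by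
    rw [← Real.log_div (by linarith) Real.pi_ne_zero, div_div]
  rw [e, ← Complex.ofReal_log Real.pi_pos.le]
  set D := Complex.digamma (((σ : ℂ) + t * Complex.I) / 2)
  set G := Complex.log (((σ : ℂ) + t * Complex.I) / 2)
  have e2 : -(Real.log Real.pi : ℂ) / 2 + D / 2 - (((Real.log (t / 2) - Real.log Real.pi) / 2 : ℝ) + (Real.pi / 4) * Complex.I)
     = (1/2 : ℝ) * ((D - G) + (G - ((Real.log (t / 2) : ℝ) + (Real.pi / 2) * Complex.I))) := by
    push_cast; ring
  rw [e2, norm_mul, Complex.norm_real, Real.norm_of_nonneg (by norm_num)]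
  have h3 : (((σ : ℂ) + t * Complex.I) / 2).im = t / 2 := by simp
  rw [h3] at h1
  have h4 : 4 / (t / 2) = 8 / t := by field_simp; norm_num
  have h5 : σ / t ≤ 2 / t := by gcongr
  have := norm_add_le (D - G) (G - ((Real.log (t / 2) : ℝ) + (Real.pi / 2) * Complex.I))
  have h6 : 5 / t = 1/2 * (8 / t + 2 / t) := by ring
  rw [h6]
  gcongr
  linarith

lemma logDeriv_XX (s : ℂ) (hs : 0 < s.re) (h1 : s ≠ 1) (hz : riemannZeta s ≠ 0) :
    logDeriv completedRiemannZeta s = logDeriv Complex.Gammaℝ s + logDeriv riemannZeta s := by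
  rw [← logDeriv_mul s (Complex.Gammaℝ_ne_zero_of_re_pos hs) hz (GammaR_diffAt s hs) (differentiableAt_riemannZeta h1),
    logDeriv_apply, logDeriv_apply, XX_eq s hs]
  congr 1
  refine Filter.EventuallyEq.deriv_eq ?_
  filter_upwards [re_pos_nhds s hs] with z hz
  exact XX_eq z hz

lemma XX_diff (z : ℂ) (hz : 0 < z.im) : DifferentiableAt ℂ completedRiemannZeta z :=
  differentiableAt_completedZeta (fun h => by simp [h] at hz) (fun h => by simp [h] at hz)

lemma XX_zero_iff (z : ℂ) (hz : 0 < z.im) : completedRiemannZeta z = 0 ↔ riemannZeta z = 0 ∧ 0 < z.re ∧ z.re < 1 := by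
  have key : ∀ w : ℂ, w.im ≠ 0 → 0 < w.re → completedRiemannZeta w = 0 → riemannZeta w = 0 ∧ w.re < 1 := fun w hi hw h => by
    rw [XX_eq w hw] at h
    have h0 := (mul_eq_zero.mp h).resolve_left (Complex.Gammaℝ_ne_zero_of_re_pos hw)
    refine ⟨h0, ?_⟩
    by_contra hcon
    exact riemannZeta_ne_zero_of_one_le_re (not_lt.mp hcon) h0
  constructor
  · intro h
    have hp : 0 < z.re := by
      by_contra hcon
      have h1 : completedRiemannZeta (1 - z) = 0 := by rw [completedRiemannZeta_one_sub, h]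
      have h2 := (key (1 - z) (by simpa using hz.ne') (by simp; linarith) h1).2
      simp at h2
      linarith
    have := key z hz.ne' hp h
    exact ⟨this.1, hp, this.2⟩
  · rintro ⟨h1, h2, -⟩
    rw [XX_eq z h2, h1, mul_zero]

/-- horizontal bound -/
lemma XX_horiz : ∃ A : ℝ, 1 ≤ A ∧ ∀ U : ℝ, 4 ≤ U → ∃ t : ℝ, U < t ∧ t < U + 1 ∧
    ∀ σ : ℝ, -1 ≤ σ → σ ≤ 2 → completedRiemannZeta (σ + t * Complex.I) ≠ 0 ∧ ‖logDeriv completedRiemannZeta (σ + t * Complex.I)‖ ≤ A * Real.log U ^ 2 := by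
  obtain ⟨A, hA1, hA⟩ := good_height
  refine ⟨A + 10, by linarith, fun U hU => ?_⟩
  obtain ⟨t, h1, h2, h3⟩ := hA U hU
  have hlogU : 1 ≤ Real.log U := by
    rw [Real.le_log_iff_exp_le (by linarith)]
    exact Real.exp_one_lt_d9.le.trans (by norm_num; linarith)
  have key : ∀ σ : ℝ, 1/2 ≤ σ → σ ≤ 2 → completedRiemannZeta (σ + t * Complex.I) ≠ 0 ∧ ‖logDeriv completedRiemannZeta (σ + t * Complex.I)‖ ≤ (A + 10) * Real.log U ^ 2 := by
    intro σ hσ hσ2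
    obtain ⟨hz, hb⟩ := h3 σ hσ hσ2
    have hre : 0 < ((σ : ℂ) + t * Complex.I).re := by simp; linarith
    refine ⟨?_, ?_⟩
    · rw [XX_eq _ hre]
      exact mul_ne_zero (Complex.Gammaℝ_ne_zero_of_re_pos hre) hz
    · rw [logDeriv_XX _ hre (fun h => by have := congrArg Complex.im h; simp at this; linarith) hz]
      have hg := gam_bound σ t (by linarith) hσ2 (by linarith)
      have e1 : ‖((Real.log (t / (2 * Real.pi)) / 2 : ℝ) : ℂ) + (Real.pi / 4) * Complex.I‖ ≤ Real.log U + 1 := by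
        refine (norm_add_le _ _).trans ?_
        rw [Complex.norm_real, norm_mul, Complex.norm_I, mul_one, Real.norm_eq_abs]
        have hpi := Real.pi_gt_three
        have hpi4 := Real.pi_lt_four
        have : ‖((Real.pi : ℂ) / 4)‖ = Real.pi / 4 := by
          rw [show ((Real.pi : ℂ) / 4) = ((Real.pi / 4 : ℝ) : ℂ) by push_cast; rfl, Complex.norm_real, Real.norm_of_nonneg (by positivity)]
        rw [this, abs_div, abs_two]
        have : |Real.log (t / (2 * Real.pi))| ≤ 2 * Real.log U := by
          rw [abs_le]
          constructor
          · rw [neg_le, ← Real.log_inv, inv_div, ← Real.log_rpow (by linarith)]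
            refine Real.log_le_log (by have : 0 < t := by linarith
                                       positivity) ?_
            rw [div_le_iff₀ (by linarith)]
            norm_num
            nlinarith
          · rw [← Real.log_rpow (by linarith)]
            refine Real.log_le_log (by have : 0 < t := by linarith
                                       positivity) ?_
            rw [div_le_iff₀ (by linarith)]
            norm_num
            nlinarith
        linarith
      have h5 : 5 / t ≤ 2 := by rw [div_le_iff₀ (by linarith)]; linarith
      have e2 : ‖logDeriv Complex.Gammaℝ (σ + t * Complex.I)‖ ≤ Real.log U + 3 := by
        have := norm_add_le (logDeriv Complex.Gammaℝ (σ + t * Complex.I) - (((Real.log (t / (2 * Real.pi)) / 2 : ℝ) : ℂ) + (Real.pi / 4) * Complex.I)) (((Real.log (t / (2 * Real.pi)) / 2 : ℝ) : ℂ) + (Real.pi / 4) * Complex.I)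
        rw [sub_add_cancel] at this
        linarith
      refine (norm_add_le _ _).trans ?_
      nlinarith
  refine ⟨t, h1, h2, fun σ hσ hσ2 => ?_⟩
  rcases le_total (1/2) σ with h | h
  · exact key σ h hσ2
  · obtain ⟨k1, k2⟩ := key (1 - σ) (by linarith) (by linarith)
    have hre : 0 < (((1 - σ : ℝ) : ℂ) + t * Complex.I).re := by simp; linarith
    have e : (σ : ℂ) + t * Complex.I = 1 - starRingEnd ℂ (((1 - σ : ℝ) : ℂ) + t * Complex.I) := by
      simp
      ring
    constructor
    · rw [e, completedRiemannZeta_one_sub, XX_conj _ hre]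
      simpa using k1
    · rw [e, XX_logDeriv_symm _ hre, norm_neg, RCLike.norm_conj]
      exact k2

lemma zeros_finset (T₁ T₂ : ℝ) : ∃ S : Finset ℂ, ∀ ρ, ρ ∈ S ↔ riemannZeta ρ = 0 ∧ 0 < ρ.re ∧ ρ.re < 1 ∧ T₁ ≤ ρ.im ∧ ρ.im ≤ T₂ := by
  have hc : IsCompact (Icc (0:ℝ) 1 ×ℂ Icc T₁ T₂) := isCompact_Icc.reProdIm isCompact_Icc
  have hf := (hc.inter_riemannZetaZeros_finite).subset
    (t := {ρ : ℂ | riemannZeta ρ = 0 ∧ 0 < ρ.re ∧ ρ.re < 1 ∧ T₁ ≤ ρ.im ∧ ρ.im ≤ T₂})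
    (fun ρ h => ⟨⟨⟨h.2.1.le, h.2.2.1.le⟩, ⟨h.2.2.2.1, h.2.2.2.2⟩⟩, h.1⟩)
  exact ⟨hf.toFinset, fun ρ => by simp⟩

lemma XX_line_cont (c : ℝ) (hc1 : 1 < c) : ContinuousOn (fun t : ℝ => logDeriv completedRiemannZeta (c + t * Complex.I)) (Ioi 0) := by
  intro t ht
  have hpos : 0 < ((c:ℂ) + t * Complex.I).im := by simpa using ht
  have hne : completedRiemannZeta (c + t * Complex.I) ≠ 0 := fun h => by
    have := ((XX_zero_iff _ hpos).mp h).2.2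
    simp at this
    linarith
  have hd : DifferentiableOn ℂ completedRiemannZeta {z : ℂ | 0 < z.im} := fun z hz => (XX_diff z hz).differentiableWithinAt
  have ho : IsOpen {z : ℂ | 0 < z.im} := isOpen_lt continuous_const Complex.continuous_im
  have hc : ContinuousAt (logDeriv completedRiemannZeta) (c + t * Complex.I) :=
    (((hd.deriv ho).differentiableAt (ho.mem_nhds hpos)).div (XX_diff _ hpos) hne).continuousAt
  exact (ContinuousAt.comp (f := fun t : ℝ => (c:ℂ) + t * Complex.I) hc (by fun_prop)).continuousWithinAt

lemma contour : ∃ A : ℝ, 1 ≤ A ∧ ∀ U : ℝ, 4 ≤ U → ∃ T₁ T₂ : ℝ, ∃ S : Finset ℂ, U < T₁ ∧ T₁ < U + 1 ∧ 2 * U + 2 < T₂ ∧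
    T₂ < 2 * U + 3 ∧ (∀ ρ, ρ ∈ S ↔ riemannZeta ρ = 0 ∧ 0 < ρ.re ∧ ρ.re < 1 ∧ T₁ ≤ ρ.im ∧ ρ.im ≤ T₂) ∧
    ∀ c : ℝ, 1 < c → c ≤ 2 → ∀ u : ℝ, 0 ≤ u →
      ‖2 * Real.pi * ∑ ρ ∈ S, (zetaMult ρ : ℂ) * Complex.exp (u * (ρ - 1/2)) -
        ∫ t in T₁..T₂, (logDeriv completedRiemannZeta (c + t * Complex.I) * Real.exp (u * (c - 1/2)) +
          starRingEnd ℂ (logDeriv completedRiemannZeta (c + t * Complex.I)) * Real.exp (-(u * (c - 1/2)))) * Complex.exp (u * t * Complex.I)‖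
      ≤ A * Real.log U ^ 2 * Real.exp (u * (c - 1/2)) := by
  obtain ⟨A, hA1, hA⟩ := XX_horiz
  refine ⟨30 * A, by linarith, fun U hU => ?_⟩
  obtain ⟨T₁, a1, a2, a3⟩ := hA U hU
  obtain ⟨T₂, b1, b2, b3⟩ := hA (2 * U + 2) (by linarith)
  have hlog2 : Real.log (2 * U + 2) ≤ 2 * Real.log U := by
    rw [← Real.log_rpow (by linarith)]
    refine Real.log_le_log (by linarith) ?_
    norm_num
    nlinarith
  have hlog0 : 0 ≤ Real.log (2 * U + 2) := Real.log_nonneg (by linarith)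
  set L := Real.log U
  obtain ⟨S, hS⟩ := zeros_finset T₁ T₂
  refine ⟨T₁, T₂, S, a1, a2, b1, by linarith, hS, fun c hc1 hc2 u hu => ?_⟩
  set g : ℂ → ℂ := fun s => Complex.exp (u * (s - 1/2)) with hg
  have hSim : ∀ ρ ∈ S, 0 < ρ.im := fun ρ hρ => by
    have := ((hS ρ).mp hρ).2.2.2.1; linarith
  have hSne : ∀ ρ ∈ S, ρ ≠ 1 := fun ρ hρ h => by have := hSim ρ hρ; simp [h] at this
  have hline : ∀ t e : ℝ, (e:ℂ) + t * Complex.I = ⟨e, t⟩ := fun t e => by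
    apply Complex.ext <;> simp
  have key := arg_principle (V := {z : ℂ | 0 < z.im}) (isOpen_lt continuous_const Complex.continuous_im) completedRiemannZeta g
    (fun z hz => (XX_diff z hz).differentiableWithinAt) (by fun_prop) (a := 1 - c) (b := c) (c := T₁) (d := T₂)
    (by linarith) (by linarith) (fun z h1 h2 => by
      have := h2.1
      show 0 < z.im
      linarith) S (fun ρ => by
      rw [hS]
      constructor
      · rintro ⟨h1, h2, h3, h4, h5⟩
        exact ⟨⟨by linarith, by linarith⟩, ⟨h4, h5⟩, (XX_zero_iff ρ (by linarith)).mpr ⟨h1, h2, h3⟩⟩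
      · rintro ⟨h1, h2, h3⟩
        have := (XX_zero_iff ρ (by linarith [h2.1])).mp h3
        exact ⟨this.1, this.2.1, this.2.2, h2.1, h2.2⟩) (fun ρ hρ => by
      rw [XX_order ρ ((hS ρ).mp hρ).2.1 (hSne ρ hρ)]
      exact zeta_order_ne_top ρ (hSne ρ hρ)) (fun ρ hρ => by
      obtain ⟨h1, h2, h3, h4, h5⟩ := (hS ρ).mp hρ
      have hX := (XX_zero_iff ρ (hSim ρ hρ)).mpr ⟨h1, h2, h3⟩
      refine ⟨by linarith, by linarith, lt_of_le_of_ne h4 fun h => ?_, lt_of_le_of_ne h5 fun h => ?_⟩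
      · refine (a3 ρ.re (by linarith) (by linarith)).1 ?_
        rw [h, Complex.re_add_im, hX]
      · refine (b3 ρ.re (by linarith) (by linarith)).1 ?_
        rw [← h, Complex.re_add_im, hX])
  have hsum : ∑ ρ ∈ S, (zetaMult ρ : ℂ) * Complex.exp (u * (ρ - 1/2)) = ∑ ρ ∈ S, (ordN completedRiemannZeta ρ : ℂ) * g ρ := by
    refine Finset.sum_congr rfl fun ρ hρ => ?_
    rw [zetaMult_eq ρ (hSne ρ hρ)]
    unfold ordN analyticOrderNatAt
    rw [XX_order ρ ((hS ρ).mp hρ).2.1 (hSne ρ hρ)]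
  have hgn : ∀ σ t : ℝ, ‖g (σ + t * Complex.I)‖ = Real.exp (u * (σ - 1/2)) := fun σ t => by
    simp only [hg]
    rw [Complex.norm_exp]
    congr 1
    simp
  have hH : ∀ t M : ℝ, 0 ≤ M → (∀ σ : ℝ, -1 ≤ σ → σ ≤ 2 → ‖logDeriv completedRiemannZeta (σ + t * Complex.I)‖ ≤ M) →
      ‖∫ x in (1-c)..c, logDeriv completedRiemannZeta (x + t * Complex.I) * g (x + t * Complex.I)‖ ≤ M * Real.exp (u * (c - 1/2)) * 3 := by
    intro t M hM h
    refine (intervalIntegral.norm_integral_le_of_norm_le_const (C := M * Real.exp (u * (c - 1/2))) fun x hx => ?_).trans ?_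
    · rw [uIoc_of_le (by linarith)] at hx
      rw [norm_mul, hgn]
      have := h x (by linarith [hx.1]) (by linarith [hx.2])
      have := hx.2
      gcongr
    · rw [abs_of_nonneg (by linarith)]
      have : 0 ≤ M * Real.exp (u * (c - 1/2)) := by positivity
      nlinarith
  have h1 := hH T₁ (A * L ^ 2) (by positivity) (fun σ h1 h2 => (a3 σ h1 h2).2)
  have h2 := hH T₂ (A * Real.log (2 * U + 2) ^ 2) (by positivity) (fun σ h1 h2 => (b3 σ h1 h2).2)
  have hsq : Real.log (2 * U + 2) ^ 2 ≤ 4 * L ^ 2 := by nlinarith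
  have gex : ∀ e t : ℝ, g (e + t * Complex.I) = Real.exp (u * (e - 1/2)) * Complex.exp (u * t * Complex.I) := fun e t => by
    simp only [hg]
    rw [Complex.ofReal_exp, ← Complex.exp_add]
    congr 1
    push_cast
    ring
  have hcont : Continuous (fun t : ℝ => Complex.exp (u * t * Complex.I)) := by fun_prop
  have hright : (∫ y in T₁..T₂, logDeriv completedRiemannZeta (c + y * Complex.I) * g (c + y * Complex.I)) =
      ∫ t in T₁..T₂, logDeriv completedRiemannZeta (c + t * Complex.I) * Real.exp (u * (c - 1/2)) * Complex.exp (u * t * Complex.I) := by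
    refine intervalIntegral.integral_congr fun t _ => ?_
    simp only [gex]; ring
  have hleft : (∫ y in T₁..T₂, logDeriv completedRiemannZeta ((1 - c : ℝ) + y * Complex.I) * g ((1 - c : ℝ) + y * Complex.I)) =
      ∫ t in T₁..T₂, -(starRingEnd ℂ (logDeriv completedRiemannZeta (c + t * Complex.I)) * Real.exp (-(u * (c - 1/2))) * Complex.exp (u * t * Complex.I)) := by
    refine intervalIntegral.integral_congr fun t _ => ?_
    have : (((1 - c : ℝ) : ℂ) + t * Complex.I) = 1 - starRingEnd ℂ ((c : ℂ) + t * Complex.I) := by simp; ring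
    simp only [gex]
    rw [this, XX_logDeriv_symm _ (by simp; linarith)]
    rw [show u * (1 - c - 1/2) = -(u * (c - 1/2)) by ring]
    ring
  have hZc : ContinuousOn (fun t : ℝ => logDeriv completedRiemannZeta (c + t * Complex.I)) (uIcc T₁ T₂) :=
    (XX_line_cont c hc1).mono fun t ht => by
      rw [uIcc_of_le (by linarith)] at ht
      have := ht.1
      show 0 < t
      linarith
  have hint1 : IntervalIntegrable (fun t : ℝ => logDeriv completedRiemannZeta (c + t * Complex.I) * Real.exp (u * (c - 1/2)) * Complex.exp (u * t * Complex.I)) volume T₁ T₂ :=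
    ((hZc.mul continuousOn_const).mul hcont.continuousOn).intervalIntegrable
  have hint2 : IntervalIntegrable (fun t : ℝ => starRingEnd ℂ (logDeriv completedRiemannZeta (c + t * Complex.I)) * Real.exp (-(u * (c - 1/2))) * Complex.exp (u * t * Complex.I)) volume T₁ T₂ :=
    (((Complex.continuous_conj.comp_continuousOn hZc).mul continuousOn_const).mul hcont.continuousOn).intervalIntegrable
  have hJ : (∫ t in T₁..T₂, (logDeriv completedRiemannZeta (c + t * Complex.I) * Real.exp (u * (c - 1/2)) +
          starRingEnd ℂ (logDeriv completedRiemannZeta (c + t * Complex.I)) * Real.exp (-(u * (c - 1/2)))) * Complex.exp (u * t * Complex.I)) =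
      (∫ y in T₁..T₂, logDeriv completedRiemannZeta (c + y * Complex.I) * g (c + y * Complex.I)) -
      ∫ y in T₁..T₂, logDeriv completedRiemannZeta ((1 - c : ℝ) + y * Complex.I) * g ((1 - c : ℝ) + y * Complex.I) := by
    rw [hright, hleft, intervalIntegral.integral_neg, sub_neg_eq_add, ← intervalIntegral.integral_add hint1 hint2]
    refine intervalIntegral.integral_congr fun t _ => ?_
    simp only [add_mul]
  rw [hsum, hJ]
  unfold rI at key
  set I1 := ∫ x in (1-c)..c, logDeriv completedRiemannZeta (x + T₁ * Complex.I) * g (x + T₁ * Complex.I)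
  set I2 := ∫ x in (1-c)..c, logDeriv completedRiemannZeta (x + T₂ * Complex.I) * g (x + T₂ * Complex.I)
  set J1 := ∫ y in T₁..T₂, logDeriv completedRiemannZeta (c + y * Complex.I) * g (c + y * Complex.I)
  set J2 := ∫ y in T₁..T₂, logDeriv completedRiemannZeta ((1 - c : ℝ) + y * Complex.I) * g ((1 - c : ℝ) + y * Complex.I)
  have hfin : 2 * Real.pi * ∑ ρ ∈ S, (ordN completedRiemannZeta ρ : ℂ) * g ρ - (J1 - J2) = -Complex.I * (I1 - I2) := by
    linear_combination Complex.I * key + (2 * Real.pi * ∑ ρ ∈ S, (ordN completedRiemannZeta ρ : ℂ) * g ρ - J1 + J2) * Complex.I_sq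
  rw [hfin, norm_mul, norm_neg, Complex.norm_I, one_mul]
  refine (norm_sub_le _ _).trans ?_
  have : 0 ≤ A * Real.exp (u * (c - 1/2)) := by positivity
  nlinarith [mul_le_mul_of_nonneg_left hsq this]

lemma mertens : ∃ C : ℝ, 0 ≤ C ∧ ∀ N : ℕ, 1 ≤ N →
    |∑ n ∈ Finset.Ioc 0 N, ArithmeticFunction.vonMangoldt n / n - Real.log N| ≤ C := by
  refine ⟨Real.log 4 + 4, by positivity, fun N hN => ?_⟩
  have hN0 : (0:ℝ) < N := by exact_mod_cast hN
  have h1 := ArithmeticFunction.sum_Ioc_mul_zeta_eq_sum ArithmeticFunction.vonMangoldt N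
  have h2 : ∑ n ∈ Finset.Ioc 0 N, (ArithmeticFunction.vonMangoldt * (ArithmeticFunction.zeta : ArithmeticFunction ℝ)) n = Real.log (N.factorial) := by
    rw [ArithmeticFunction.vonMangoldt_mul_zeta]
    simp only [ArithmeticFunction.log_apply]
    clear h1 hN hN0
    induction N with
    | zero => simp
    | succ k ih =>
      rw [Finset.sum_Ioc_succ_top (Nat.zero_le _), ih, Nat.factorial_succ]
      push_cast
      rw [Real.log_mul (by positivity) (by positivity)]; ring
  have hub : Real.log (N.factorial) ≤ N * Real.log N := by
    have : ((N.factorial : ℕ) : ℝ) ≤ (N:ℝ)^N := by exact_mod_cast Nat.factorial_le_pow N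
    calc _ ≤ Real.log ((N:ℝ)^N) := Real.log_le_log (by positivity) this
      _ = _ := by rw [Real.log_pow]
  have hlb : N * Real.log N - N ≤ Real.log (N.factorial) := by
    have := Stirling.le_log_factorial_stirling (n := N) (by omega)
    have h3 : 0 ≤ Real.log N := Real.log_natCast_nonneg N
    have h4 : 0 ≤ Real.log (2 * Real.pi) := Real.log_nonneg (by linarith [Real.pi_gt_three])
    linarith
  have hpsi := Chebyshev.psi_le_const_mul_self (x := N) hN0.le
  simp only [Chebyshev.psi, Nat.floor_natCast] at hpsi
  have ha : ∀ n ∈ Finset.Ioc 0 N, ArithmeticFunction.vonMangoldt n * ((N / n : ℕ):ℝ) ≤ N * (ArithmeticFunction.vonMangoldt n / n) := by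
    intro n hn
    have hl : (0:ℝ) ≤ ArithmeticFunction.vonMangoldt n := ArithmeticFunction.vonMangoldt_nonneg
    have : ((N / n : ℕ):ℝ) ≤ N / n := Nat.cast_div_le
    calc _ ≤ ArithmeticFunction.vonMangoldt n * (N / n : ℝ) := by gcongr
      _ = _ := by ring
  have hc : ∀ n ∈ Finset.Ioc 0 N, N * (ArithmeticFunction.vonMangoldt n / n) ≤ ArithmeticFunction.vonMangoldt n * ((N / n : ℕ):ℝ) + ArithmeticFunction.vonMangoldt n := by
    intro n hn
    have hn0 : 0 < n := (Finset.mem_Ioc.mp hn).1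
    have hl : (0:ℝ) ≤ ArithmeticFunction.vonMangoldt n := ArithmeticFunction.vonMangoldt_nonneg
    have h5 : (N:ℝ) / n ≤ ((N / n : ℕ):ℝ) + 1 := by
      rw [div_le_iff₀ (by exact_mod_cast hn0)]
      have := Nat.lt_div_mul_add (a := N) hn0
      have h6 : N ≤ (N/n + 1) * n := by linarith
      exact_mod_cast h6
    calc _ = ArithmeticFunction.vonMangoldt n * (N / n : ℝ) := by ring
      _ ≤ ArithmeticFunction.vonMangoldt n * (((N / n : ℕ):ℝ) + 1) := by gcongr
      _ = _ := by ring
  have ha' := Finset.sum_le_sum ha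
  have hc' := Finset.sum_le_sum hc
  rw [Finset.sum_add_distrib] at hc'
  rw [← Finset.mul_sum] at ha' hc'
  rw [← h1, h2] at ha' hc'
  set S := ∑ n ∈ Finset.Ioc 0 N, ArithmeticFunction.vonMangoldt n / n
  have hl4 : 0 ≤ Real.log 4 := Real.log_nonneg (by norm_num)
  rw [abs_le]; constructor
  · have : N * (-(Real.log 4 + 4)) ≤ N * (S - Real.log N) := by nlinarith
    exact le_of_mul_le_mul_left this hN0
  · have : N * (S - Real.log N) ≤ N * (Real.log 4 + 4) := by linarith
    exact le_of_mul_le_mul_left this hN0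

lemma psum (C : ℝ) (hC : 0 ≤ C) (hM : ∀ N : ℕ, 1 ≤ N →
    |∑ n ∈ Finset.Ioc 0 N, ArithmeticFunction.vonMangoldt n / n - Real.log N| ≤ C)
    (φ : ℝ → ℝ) (hφ : Continuous φ) (h0 : φ 0 = 0) (M B L : ℝ) (hM0 : 0 ≤ M) (hL : 1 ≤ L)
    (hlip : ∀ x ∈ Icc 0 B, ∀ y ∈ Icc 0 B, |φ x - φ y| ≤ M * |x - y|)
    (N : ℕ) (hN : 1 ≤ N) (hNB : Real.log N ≤ B * L) :
    |∑ n ∈ Finset.Ioc 0 N, φ (Real.log n / L) * (ArithmeticFunction.vonMangoldt n / n)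
      - L * ∫ x in (0:ℝ)..(Real.log N / L), φ x| ≤ (2 * C + 1) * M * B := by
  have hL0 : 0 < L := by linarith
  set e : ℕ → ℝ := fun N => ∑ n ∈ Finset.Ioc 0 N, ArithmeticFunction.vonMangoldt n / n - Real.log N with he
  have key : |∑ n ∈ Finset.Ioc 0 N, φ (Real.log n / L) * (ArithmeticFunction.vonMangoldt n / n)
      - L * (∫ x in (0:ℝ)..(Real.log N / L), φ x) - φ (Real.log N / L) * e N|
      ≤ (C + 1) * M * (Real.log N / L) := by
    induction N, hN using Nat.le_induction with
    | base => simp [h0]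
    | succ k hk ih =>
      have hk0 : (0:ℝ) < k := by exact_mod_cast hk
      have hlog : Real.log k ≤ Real.log (k+1:ℕ) := Real.log_le_log hk0 (by push_cast; linarith)
      have hlog0 : 0 ≤ Real.log k := Real.log_natCast_nonneg k
      specialize ih (by linarith)
      set p := Real.log k / L with hp
      set q := Real.log (k+1:ℕ) / L with hq
      have hpq : p ≤ q := by rw [hp, hq]; gcongr
      have hp0 : 0 ≤ p := by positivity
      have hqB : q ≤ B := by rw [hq, div_le_iff₀ hL0]; exact hNB
      have hd : L * (q - p) ≤ 1 := by
        have h1 : L * (q - p) = Real.log (k+1:ℕ) - Real.log k := by rw [hp, hq]; field_simp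
        rw [h1, ← Real.log_div (by positivity) hk0.ne']
        have h2 : ((k+1:ℕ):ℝ)/k ≤ 2 := by
          rw [div_le_iff₀ hk0]; push_cast
          have : (1:ℝ) ≤ k := by exact_mod_cast hk
          linarith
        have := Real.log_le_sub_one_of_pos (x := ((k+1:ℕ):ℝ)/k) (by positivity)
        linarith
      have hsplit : ∫ x in (0:ℝ)..q, φ x = (∫ x in (0:ℝ)..p, φ x) + ∫ x in p..q, φ x :=
        (intervalIntegral.integral_add_adjacent_intervals (hφ.intervalIntegrable _ _) (hφ.intervalIntegrable _ _)).symm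
      have hI : |(q - p) * φ q - ∫ x in p..q, φ x| ≤ M * (q - p) * (q - p) := by
        have h1 : (q - p) * φ q - ∫ x in p..q, φ x = ∫ x in p..q, (φ q - φ x) := by
          rw [intervalIntegral.integral_sub (by simp) (hφ.intervalIntegrable _ _)]; simp
        rw [h1]
        have := intervalIntegral.norm_integral_le_of_norm_le_const (a := p) (b := q) (f := fun x => φ q - φ x) (C := M * (q-p)) ?_
        · rw [abs_of_nonneg (sub_nonneg.mpr hpq)] at this; exact this
        · intro x hx
          rw [uIoc_of_le hpq] at hx
          have := hlip q ⟨by linarith, hqB⟩ x ⟨by linarith [hx.1], by linarith [hx.2]⟩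
          refine this.trans ?_
          gcongr
          rw [abs_of_nonneg] <;> linarith [hx.1, hx.2]
      have hl := hlip q ⟨by linarith, hqB⟩ p ⟨hp0, by linarith⟩
      rw [abs_of_nonneg (sub_nonneg.mpr hpq)] at hl
      have hek := hM k hk
      have hes : e (k+1) = e k + ArithmeticFunction.vonMangoldt (k+1) / (k+1:ℕ) - L * (q - p) := by
        have h1 : L * (q - p) = Real.log (k+1:ℕ) - Real.log k := by rw [hp, hq]; field_simp
        rw [h1]; simp only [he]
        rw [Finset.sum_Ioc_succ_top (Nat.zero_le _)]; ring
      rw [Finset.sum_Ioc_succ_top (Nat.zero_le _), hsplit, hes]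
      change |e k| ≤ C at hek
      have hprod : |(φ q - φ p) * e k| ≤ M * (q - p) * C := by
        rw [abs_mul]; gcongr
      have hI2 : |L * ((q - p) * φ q - ∫ x in p..q, φ x)| ≤ M * (q - p) := by
        rw [abs_mul, abs_of_pos hL0]
        calc _ ≤ L * (M * (q - p) * (q - p)) := by gcongr
          _ = M * (q - p) * (L * (q - p)) := by ring
          _ ≤ M * (q - p) * 1 := by
            have : 0 ≤ M * (q - p) := mul_nonneg hM0 (by linarith)
            gcongr
          _ = _ := by ring
      rw [← hq]
      set I1 := ∫ x in (0:ℝ)..p, φ x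
      set I2 := ∫ x in p..q, φ x
      rw [abs_le] at *
      constructor <;> linarith [hprod.1, hprod.2, hI2.1, hI2.2, ih.1, ih.2]
  have hlog0 : 0 ≤ Real.log N := Real.log_natCast_nonneg N
  have hq0 : 0 ≤ Real.log N / L := by positivity
  have hqB : Real.log N / L ≤ B := by rw [div_le_iff₀ hL0]; exact hNB
  have h1 := hlip (Real.log N / L) ⟨hq0, hqB⟩ 0 ⟨le_rfl, hq0.trans hqB⟩
  rw [h0, sub_zero, sub_zero, abs_of_nonneg hq0] at h1
  have h2 : |φ (Real.log N / L) * e N| ≤ M * B * C := by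
    rw [abs_mul]
    have := hM N hN
    have h3 : |φ (Real.log N / L)| ≤ M * B := h1.trans (by gcongr)
    have h4 : 0 ≤ M * B := (abs_nonneg _).trans h3
    gcongr
  have h5 : (C+1) * M * (Real.log N / L) ≤ (C+1) * M * B := by gcongr
  rw [abs_le] at *
  constructor <;> linarith [key.1, key.2, h2.1, h2.2]

noncomputable def rr (b θ α : ℝ) : ℝ := (1 - α/θ) / Real.cosh (b * α)

lemma rr_cont (b θ : ℝ) : Continuous (rr b θ) := by
  unfold rr
  exact Continuous.div (by fun_prop) (by fun_prop) (fun x => (Real.cosh_pos _).ne')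

lemma rr_lip (b θ B : ℝ) : ∃ M, 0 ≤ M ∧ ∀ x ∈ Icc 0 B, ∀ y ∈ Icc 0 B, |rr b θ x - rr b θ y| ≤ M * |x - y| := by
  have hc : ContDiff ℝ 1 (rr b θ) := by
    unfold rr
    exact ContDiff.div (by fun_prop) (by fun_prop) (fun x => (Real.cosh_pos _).ne')
  obtain ⟨K, hK⟩ := (hc.locallyLipschitz.locallyLipschitzOn (s := Icc 0 B)).exists_lipschitzOnWith_of_compact isCompact_Icc
  refine ⟨K, K.2, fun x hx y hy => ?_⟩
  simpa [Real.dist_eq] using hK.dist_le_mul x hx y hy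

lemma prime_sum (b θ C0 : ℝ) (hθ : 0 < θ) (hC0 : 0 ≤ C0) : ∃ C, 0 ≤ C ∧ ∀ L, 1 ≤ L → ∀ N : ℕ, 1 ≤ N →
    Real.log N ≤ θ * L + 1 → (∀ n ∈ Finset.Ioc 0 N, 0 ≤ rr b θ (Real.log n / L) + C0 / L) →
    ∑ n ∈ Finset.Ioc 0 N, ArithmeticFunction.vonMangoldt n ^ 2 / n * (rr b θ (Real.log n / L) + C0 / L)
      ≤ L^2 * (∫ α in (0:ℝ)..θ, α * rr b θ α) + C * L := by
  obtain ⟨Cm, hCm, hmer⟩ := mertens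
  set B := θ + 1 with hB
  obtain ⟨M1, hM1, hlip1⟩ := rr_lip b θ B
  have hc : Continuous (fun x => x * rr b θ x) := continuous_id.mul (rr_cont b θ)
  obtain ⟨Q, hQ⟩ := (isCompact_Icc (a := (0:ℝ)) (b := B)).exists_bound_of_continuousOn (rr_cont b θ).continuousOn
  have hQ0 : 0 ≤ Q := (norm_nonneg _).trans (hQ 0 ⟨le_rfl, by linarith⟩)
  set M := B * M1 + Q with hMdef
  have hlip : ∀ x ∈ Icc 0 B, ∀ y ∈ Icc 0 B, |x * rr b θ x - y * rr b θ y| ≤ M * |x - y| := by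
    intro x hx y hy
    have h1 := hlip1 x hx y hy
    have h2 := hQ y hy
    rw [Real.norm_eq_abs] at h2
    have : x * rr b θ x - y * rr b θ y = x * (rr b θ x - rr b θ y) + (x - y) * rr b θ y := by ring
    rw [this]
    refine (abs_add_le _ _).trans ?_
    rw [abs_mul, abs_mul, abs_of_nonneg hx.1]
    calc _ ≤ B * (M1 * |x - y|) + |x - y| * Q := by
          have := hx.2; gcongr
      _ = _ := by rw [hMdef]; ring
  have hM0 : 0 ≤ M := by positivity
  refine ⟨(2 * Cm + 1) * M * B + C0 * B * (B + Cm), by positivity, fun L hL N hN hNL hpos => ?_⟩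
  have hL0 : 0 < L := by linarith
  have hNB : Real.log N ≤ B * L := by rw [hB]; linarith
  have hps := (abs_le.mp (psum Cm hCm hmer _ hc (by simp) M B L hM0 hL hlip N hN hNB)).2
  have hlog0 : 0 ≤ Real.log N := Real.log_natCast_nonneg N
  have hint : ∫ x in (0:ℝ)..(Real.log N / L), x * rr b θ x ≤ ∫ x in (0:ℝ)..θ, x * rr b θ x := by
    have h0 : 0 ≤ Real.log N / L := by positivity
    rw [← sub_nonneg, intervalIntegral.integral_interval_sub_left (hc.intervalIntegrable _ _) (hc.intervalIntegrable _ _)]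
    rcases le_total (Real.log N / L) θ with h | h
    · refine intervalIntegral.integral_nonneg h fun x hx => ?_
      refine mul_nonneg (h0.trans hx.1) (div_nonneg ?_ (Real.cosh_pos _).le)
      rw [sub_nonneg, div_le_one hθ]; exact hx.2
    · rw [intervalIntegral.integral_symm, neg_nonneg]
      rw [← neg_nonneg, ← intervalIntegral.integral_neg]
      refine intervalIntegral.integral_nonneg h fun x hx => neg_nonneg.mpr ?_
      refine mul_nonpos_of_nonneg_of_nonpos (hθ.le.trans hx.1) (div_nonpos_of_nonpos_of_nonneg ?_ (Real.cosh_pos _).le)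
      rw [sub_nonpos, one_le_div hθ]; exact hx.1
  have hm := (abs_le.mp (hmer N hN)).2
  have hterm : ∀ n ∈ Finset.Ioc 0 N, ArithmeticFunction.vonMangoldt n ^ 2 / n * (rr b θ (Real.log n / L) + C0 / L) ≤
      L * ((Real.log n / L * rr b θ (Real.log n / L)) * (ArithmeticFunction.vonMangoldt n / n)) + C0 / L * Real.log N * (ArithmeticFunction.vonMangoldt n / n) := by
    intro n hn
    have hl : (0:ℝ) ≤ ArithmeticFunction.vonMangoldt n := ArithmeticFunction.vonMangoldt_nonneg
    have hn0 : (0:ℝ) < n := by exact_mod_cast (Finset.mem_Ioc.mp hn).1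
    have hlN : Real.log n ≤ Real.log N := Real.log_le_log hn0 (by exact_mod_cast (Finset.mem_Ioc.mp hn).2)
    calc _ = ArithmeticFunction.vonMangoldt n * ((ArithmeticFunction.vonMangoldt n / n) * (rr b θ (Real.log n / L) + C0 / L)) := by ring
      _ ≤ Real.log n * ((ArithmeticFunction.vonMangoldt n / n) * (rr b θ (Real.log n / L) + C0 / L)) := by
          have := hpos n hn
          have h2 := ArithmeticFunction.vonMangoldt_le_log (n := n)
          gcongr
      _ = L * ((Real.log n / L * rr b θ (Real.log n / L)) * (ArithmeticFunction.vonMangoldt n / n)) + C0 / L * Real.log n * (ArithmeticFunction.vonMangoldt n / n) := by field_simp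
      _ ≤ _ := by gcongr
  refine (Finset.sum_le_sum hterm).trans ?_
  rw [Finset.sum_add_distrib, ← Finset.mul_sum, ← Finset.mul_sum]
  set S1 := ∑ n ∈ Finset.Ioc 0 N, (Real.log n / L * rr b θ (Real.log n / L)) * (ArithmeticFunction.vonMangoldt n / n)
  set S2 := ∑ n ∈ Finset.Ioc 0 N, (ArithmeticFunction.vonMangoldt n / n)
  have a1 : L * S1 ≤ L * (L * (∫ x in (0:ℝ)..θ, x * rr b θ x) + (2 * Cm + 1) * M * B) := by
    have : L * (∫ x in (0:ℝ)..(Real.log N / L), x * rr b θ x) ≤ L * (∫ x in (0:ℝ)..θ, x * rr b θ x) := by gcongr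
    gcongr; linarith
  have a2 : C0 / L * Real.log N * S2 ≤ C0 * B * (B + Cm) * L := by
    calc _ ≤ C0 / L * (B * L) * (B * L + Cm * L) := by
          gcongr
          · nlinarith
      _ = _ := by field_simp
  linarith

lemma sI_mul_le (T₁ T₂ v : ℝ) : |v| * ‖sI T₁ T₂ v‖ ≤ 2 := by
  by_cases hv : v = 0
  · simp [hv]
  · have := sI_norm_le' (T₁ := T₁) (T₂ := T₂) (v := v) hv
    rwa [le_div_iff₀ (abs_pos.mpr hv), mul_comm] at this

lemma sI_far (T₁ T₂ v : ℝ) (hv : 1/2 ≤ |v|) : ‖sI T₁ T₂ v‖ ≤ 4 := by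
  have := sI_mul_le T₁ T₂ v
  nlinarith [norm_nonneg (sI T₁ T₂ v)]

noncomputable def WW (c : ℝ) (n : ℕ) : ℝ := ArithmeticFunction.vonMangoldt n / (n:ℝ) ^ c

lemma WW_nonneg (c : ℝ) (n : ℕ) : 0 ≤ WW c n :=
  div_nonneg ArithmeticFunction.vonMangoldt_nonneg (by positivity)

lemma WW_summable (c : ℝ) (hc : 1 < c) : Summable (WW c) := by
  have h := (ArithmeticFunction.LSeriesSummable_vonMangoldt (s := (c:ℂ)) (by simpa using hc)).norm
  refine h.congr fun n => ?_
  rw [LSeries.norm_term_eq]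
  split_ifs with h0
  · simp [WW, h0]
  · simp [WW, abs_of_nonneg ArithmeticFunction.vonMangoldt_nonneg]

lemma harm_shift (M n0 : ℕ) (h : n0 ≤ M) :
    ∑ n ∈ Finset.range (M+1), 1 / |(n:ℝ) - n0| ≤ 2 * (1 + Real.log M) := by
  have hh : ∀ k : ℕ, k ≤ M → ∑ i ∈ Finset.range k, 1 / ((i:ℝ)+1) ≤ 1 + Real.log M := by
    intro k hk
    have h1 := harmonic_le_one_add_log k
    have h2 : ((harmonic k : ℚ) : ℝ) = ∑ i ∈ Finset.range k, 1 / ((i:ℝ)+1) := by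
      simp [harmonic]
    rw [h2] at h1
    rcases Nat.eq_zero_or_pos k with h0 | h0
    · subst h0
      have := Real.log_natCast_nonneg M
      simp; linarith
    · have : Real.log k ≤ Real.log M := Real.log_le_log (by exact_mod_cast h0) (by exact_mod_cast hk)
      linarith
  have e1 : ∑ n ∈ Finset.range n0, 1 / |(n:ℝ) - n0| = ∑ i ∈ Finset.range n0, 1 / ((i:ℝ)+1) := by
    rw [← Finset.sum_range_reflect]
    refine Finset.sum_congr rfl fun i hi => ?_
    have hi' := Finset.mem_range.mp hi
    have : ((n0 - 1 - i : ℕ) : ℝ) = n0 - 1 - i := by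
      rw [Nat.cast_sub (by omega), Nat.cast_sub (by omega)]; simp
    rw [this, show (n0:ℝ) - 1 - i - n0 = -((i:ℝ)+1) by ring, abs_neg, abs_of_pos (by positivity)]
  have e2 : ∑ n ∈ Finset.range (M - n0), 1 / |((n0 + 1 + n : ℕ):ℝ) - n0| = ∑ i ∈ Finset.range (M - n0), 1 / ((i:ℝ)+1) := by
    refine Finset.sum_congr rfl fun i hi => ?_
    push_cast
    rw [show (n0:ℝ) + 1 + i - n0 = ((i:ℝ)+1) by ring, abs_of_pos (by positivity)]
  rw [show M + 1 = n0 + 1 + (M - n0) by omega, Finset.sum_range_add, Finset.sum_range_succ, e1, e2]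
  have a := hh n0 h
  have b := hh (M - n0) (by omega)
  simp only [sub_self, abs_zero, div_zero, add_zero]
  linarith

lemma log_gap (x y : ℝ) (hx : 0 < x) (hy : 0 < y) (hne : x ≠ y) :
    1 / (y * |Real.log x - Real.log y|) ≤ 1 / |x - y| + 1 / y := by
  have hd : 0 < |x - y| := abs_pos.mpr (sub_ne_zero.mpr hne)
  have key : |x - y| ≤ (y + |x - y|) * |Real.log x - Real.log y| := by
    rcases lt_or_gt_of_ne hne with h | h
    · have h1 : Real.log x < Real.log y := Real.log_lt_log hx h
      rw [abs_of_neg (by linarith : x - y < 0), abs_of_neg (by linarith : Real.log x - Real.log y < 0)]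
      have h2 := Real.log_le_sub_one_of_pos (x := x / y) (by positivity)
      rw [Real.log_div hx.ne' hy.ne'] at h2
      have h3 : y * (Real.log x - Real.log y) ≤ x - y := by
        calc _ ≤ y * (x / y - 1) := by gcongr
          _ = _ := by field_simp
      nlinarith
    · have h1 : Real.log y < Real.log x := Real.log_lt_log hy h
      rw [abs_of_pos (by linarith : 0 < x - y), abs_of_pos (by linarith : 0 < Real.log x - Real.log y)]
      have h2 := Real.log_le_sub_one_of_pos (x := y / x) (by positivity)
      rw [Real.log_div hy.ne' hx.ne'] at h2
      have h3 : x * (Real.log y - Real.log x) ≤ y - x := by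
        calc _ ≤ x * (y / x - 1) := by gcongr
          _ = _ := by field_simp
      linarith
  have hl : 0 < |Real.log x - Real.log y| := by
    by_contra h0
    have : |Real.log x - Real.log y| = 0 := le_antisymm (not_lt.mp h0) (abs_nonneg _)
    rw [this] at key; linarith
  rw [div_add_div _ _ hd.ne' hy.ne', div_le_div_iff₀ (by positivity) (by positivity)]
  nlinarith

lemma exp_diff (κ u v : ℝ) (hκ : 0 ≤ κ) : |Real.exp (u*κ) - Real.exp (v*κ)| ≤ κ * |u - v| * Real.exp (max u v * κ) := by
  wlog h : v ≤ u generalizing u v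
  · have := this v u (by linarith)
    rwa [abs_sub_comm, abs_sub_comm u v, max_comm]
  rw [max_eq_left h, abs_of_nonneg (by linarith : 0 ≤ u - v), abs_of_nonneg (by
    have : Real.exp (v*κ) ≤ Real.exp (u*κ) := Real.exp_le_exp.mpr (by gcongr)
    linarith)]
  have h1 := Real.add_one_le_exp ((v-u)*κ)
  have h2 : Real.exp (v*κ) = Real.exp (u*κ) * Real.exp ((v-u)*κ) := by rw [← Real.exp_add]; congr 1; ring
  rw [h2]
  linarith [mul_le_mul_of_nonneg_left h1 (Real.exp_pos (u*κ)).le]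

set_option maxHeartbeats 1000000 in
lemma zsum (c : ℝ) (hc : 1 < c) (hc2 : c ≤ 2) : ∃ C, 0 ≤ C ∧ ∀ T₁ T₂ L u : ℝ, ∀ n0 : ℕ, 1 ≤ L → 0 ≤ u → u ≤ L →
    |Real.exp u - n0| ≤ 1/2 →
    ‖(∑' n, (WW c n : ℂ) * (Real.exp (u*(c-1/2)) * sI T₁ T₂ (u - Real.log n) + Real.exp (-(u*(c-1/2))) * sI T₁ T₂ (u + Real.log n)))
      - (WW (1/2) n0 : ℂ) * sI T₁ T₂ (u - Real.log n0)‖ ≤ C * L^2 * Real.exp (u*(c-1/2)) := by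
  have hs := WW_summable c hc
  set V := ∑' n, WW c n with hV
  have hV0 : 0 ≤ V := tsum_nonneg (WW_nonneg c)
  refine ⟨8 * V + 200 + 64, by positivity, fun T₁ T₂ L u n0 hL hu huL hn0 => ?_⟩
  set κ := c - 1/2 with hκ
  have hκ0 : 0 < κ := by linarith
  have hκ2 : κ ≤ 2 := by linarith
  set x := Real.exp u with hx
  have hx1 : 1 ≤ x := Real.one_le_exp hu
  have hn0' := abs_le.mp hn0
  have hn1 : 1 ≤ n0 := by
    by_contra h
    have : n0 = 0 := by omega
    subst this; simp at hn0'; linarith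
  have hn1r : (1:ℝ) ≤ n0 := by exact_mod_cast hn1
  set M := ⌊2 * x⌋₊ with hM
  have hMle : (M:ℝ) ≤ 2 * x := Nat.floor_le (by positivity)
  have hn0M : n0 ≤ M := Nat.le_floor (by linarith)
  have hM1 : 1 ≤ M := hn1.trans hn0M
  have hlog2x : Real.log (2 * x) ≤ 2 * L := by
    rw [Real.log_mul (by norm_num) (by positivity), hx, Real.log_exp]
    linarith [Real.log_two_lt_d9]
  have hlogM : Real.log M ≤ 2 * L := (Real.log_le_log (by exact_mod_cast hM1) hMle).trans hlog2x
  have hE1 : 1 ≤ Real.exp (u*κ) := Real.one_le_exp (by positivity)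
  have hEn : Real.exp (-(u*κ)) ≤ Real.exp (u*κ) := Real.exp_le_exp.mpr (by linarith [mul_nonneg hu hκ0.le])
  set f : ℕ → ℂ := fun n => (WW c n : ℂ) * (Real.exp (u*κ) * sI T₁ T₂ (u - Real.log n) + Real.exp (-(u*κ)) * sI T₁ T₂ (u + Real.log n)) with hf
  set P : ℕ → ℝ := fun n => if n ∈ Finset.range (M+1) then 4 * L * (2 * (1 / |(n:ℝ) - n0|) + 1 / n) else 0 with hP
  set D : ℕ → ℝ := fun n => if n = n0 then 64 else 0 with hD
  set G : ℕ → ℂ := fun n => if n = n0 then (WW (1/2) n0 : ℂ) * sI T₁ T₂ (u - Real.log n0) else 0 with hG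
  -- far bound
  have hplus : ∀ n, WW c n * ‖sI T₁ T₂ (u + Real.log n)‖ ≤ 4 * WW c n := by
    intro n
    rcases Nat.lt_or_ge n 2 with h | h
    · have : WW c n = 0 := by
        interval_cases n <;> simp [WW]
      simp [this]
    · have h1 : Real.log 2 ≤ Real.log n := Real.log_le_log (by norm_num) (by exact_mod_cast h)
      have := sI_far T₁ T₂ (u + Real.log n) (by
        rw [abs_of_nonneg] <;> linarith [Real.log_two_gt_d9])
      linarith [mul_le_mul_of_nonneg_left this (WW_nonneg c n)]
  have hWle : ∀ n : ℕ, 1 ≤ n → WW c n ≤ Real.log n / n := by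
    intro n hn
    have hnr : (1:ℝ) ≤ n := by exact_mod_cast hn
    unfold WW
    have h1 : (n:ℝ) ≤ (n:ℝ)^c := by
      calc (n:ℝ) = (n:ℝ)^(1:ℝ) := by simp
        _ ≤ _ := Real.rpow_le_rpow_of_exponent_le hnr hc.le
    have := ArithmeticFunction.vonMangoldt_le_log (n := n)
    have h0 := Real.log_natCast_nonneg n
    gcongr
  have hP0 : ∀ n, 0 ≤ P n := by
    intro n; simp only [hP]; split_ifs <;> positivity
  have hminus : ∀ n, n ≠ n0 → WW c n * ‖sI T₁ T₂ (u - Real.log n)‖ ≤ 4 * WW c n + P n := by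
    intro n hn
    rcases Nat.eq_zero_or_pos n with h0 | h0
    · have := hP0 n
      simpa [WW, h0] using this
    have hnr : (0:ℝ) < n := by exact_mod_cast h0
    by_cases hnM : n ∈ Finset.range (M+1)
    · have hgap : 1/2 ≤ |x - n| := by
        have h1 : (1:ℝ) ≤ |(n:ℝ) - n0| := by
          have h2 : (1:ℤ) ≤ |(n:ℤ) - n0| := Int.one_le_abs (by omega)
          exact_mod_cast h2
        have h3 : |(n:ℝ) - n0| ≤ |x - n| + |x - n0| := by
          rw [abs_sub_comm x n]
          exact abs_sub_le _ _ _
        linarith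
      have hd : |(n:ℝ) - n0| ≤ 2 * |x - n| := by
        have h3 : |(n:ℝ) - n0| ≤ |x - n| + |x - n0| := by
          rw [abs_sub_comm x n]
          exact abs_sub_le _ _ _
        linarith
      have hne : x ≠ n := by
        intro h; rw [h] at hgap; simp at hgap; linarith
      have h1 := log_gap x n (by linarith) hnr hne
      have hlogx : Real.log x = u := by rw [hx, Real.log_exp]
      rw [hlogx] at h1
      have hnn : (0:ℝ) < |(n:ℝ) - n0| := by
        rw [abs_pos, sub_ne_zero]; exact_mod_cast hn
      have h2 : 1 / |x - n| ≤ 2 * (1 / |(n:ℝ) - n0|) := by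
        rw [mul_one_div, div_le_div_iff₀ (by linarith) hnn]; linarith
      have hvne : u - Real.log n ≠ 0 := by
        intro h
        apply hne
        rw [hx, show u = Real.log n by linarith, Real.exp_log hnr]
      have h3 := sI_norm_le' T₁ T₂ _ hvne
      have hlogn : Real.log n ≤ 2 * L := by
        refine le_trans (Real.log_le_log hnr ?_) hlogM
        have := Finset.mem_range.mp hnM
        exact_mod_cast (by omega : n ≤ M)
      have h4 := hWle n h0
      have : WW c n * ‖sI T₁ T₂ (u - Real.log n)‖ ≤ P n := by
        simp only [hP, if_pos hnM]
        calc _ ≤ (2 * L / n) * (2 / |u - Real.log n|) := by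
              have : WW c n ≤ 2 * L / n := h4.trans (by gcongr)
              gcongr
          _ = 4 * L * (1 / (n * |u - Real.log n|)) := by
              have := abs_pos.mpr hvne
              field_simp; norm_num
          _ ≤ _ := by gcongr; linarith
      linarith [WW_nonneg c n]
    · simp only [hP, if_neg hnM, add_zero]
      have h1 : 2 * x ≤ n := by
        have : M + 1 ≤ n := by simpa using hnM
        have h2 := Nat.lt_floor_add_one (2 * x)
        have h3 : ((M:ℝ) + 1) ≤ n := by exact_mod_cast this
        linarith
      have h2 : Real.log 2 + u ≤ Real.log n := by
        have := Real.log_le_log (by positivity) h1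
        rwa [Real.log_mul (by norm_num) (by positivity), hx, Real.log_exp] at this
      have := sI_far T₁ T₂ (u - Real.log n) (by
        rw [abs_sub_comm, abs_of_nonneg] <;> linarith [Real.log_two_gt_d9])
      linarith [mul_le_mul_of_nonneg_left this (WW_nonneg c n)]
  have hmain : |WW c n0 * Real.exp (u*κ) - WW (1/2) n0| * ‖sI T₁ T₂ (u - Real.log n0)‖ ≤ 64 * Real.exp (u*κ) := by
    have hnpos : (0:ℝ) < n0 := by linarith
    have h1 : WW (1/2) n0 = WW c n0 * Real.exp (Real.log n0 * κ) := by
      simp only [WW]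
      rw [Real.rpow_def_of_pos hnpos, Real.rpow_def_of_pos hnpos, div_mul_eq_mul_div, div_eq_div_iff (Real.exp_pos _).ne' (Real.exp_pos _).ne', mul_assoc, ← Real.exp_add, hκ]
      congr 2; ring
    rw [h1, ← mul_sub, abs_mul, abs_of_nonneg (WW_nonneg _ _)]
    have h2 := exp_diff κ u (Real.log n0) hκ0.le
    have h3 := sI_mul_le T₁ T₂ (u - Real.log n0)
    have h4 : WW c n0 ≤ 1 := (hWle n0 hn1).trans (by
      rw [div_le_one hnpos]; linarith [Real.log_le_sub_one_of_pos hnpos])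
    have h5 : Real.exp (max u (Real.log n0) * κ) ≤ 16 * Real.exp (u*κ) := by
      have h6 : max u (Real.log n0) ≤ u + Real.log 2 := by
        apply max_le; linarith [Real.log_two_gt_d9]
        have : Real.log n0 ≤ Real.log (2 * x) := Real.log_le_log hnpos (by linarith)
        rw [Real.log_mul (by norm_num) (by positivity), hx, Real.log_exp] at this; linarith
      calc _ ≤ Real.exp (u*κ + 2) := by
            apply Real.exp_le_exp.mpr
            linarith [mul_le_mul_of_nonneg_right h6 hκ0.le, mul_le_mul Real.log_two_lt_d9.le hκ2 hκ0.le (by norm_num)]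
        _ = Real.exp 1 * Real.exp 1 * Real.exp (u*κ) := by rw [← Real.exp_add, ← Real.exp_add]; congr 1; ring
        _ ≤ 16 * Real.exp (u*κ) := by
            have := Real.exp_one_lt_d9
            have h0 := Real.exp_pos 1
            gcongr; nlinarith
    calc _ ≤ 1 * (κ * |u - Real.log n0| * (16 * Real.exp (u*κ))) * ‖sI T₁ T₂ (u - Real.log n0)‖ := by
            gcongr; exact h2.trans (by gcongr)
      _ = 16 * κ * Real.exp (u*κ) * (|u - Real.log n0| * ‖sI T₁ T₂ (u - Real.log n0)‖) := by ring
      _ ≤ 16 * 2 * Real.exp (u*κ) * 2 := by gcongr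
      _ = _ := by ring
  have hbound : ∀ n, ‖f n - G n‖ ≤ Real.exp (u*κ) * (8 * WW c n + P n + D n) := by
    intro n
    have hE : Real.exp (-(u*κ)) * (WW c n * ‖sI T₁ T₂ (u + Real.log n)‖) ≤ Real.exp (u*κ) * (4 * WW c n) := by
      have := hplus n
      have h0 := WW_nonneg c n
      gcongr
    have hnE : ∀ r : ℝ, ‖(Real.exp r : ℂ)‖ = Real.exp r := fun r => by
      rw [Complex.norm_real, Real.norm_eq_abs, abs_of_pos (Real.exp_pos _)]
    have hnW : ‖(WW c n : ℂ)‖ = WW c n := by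
      rw [Complex.norm_real, Real.norm_eq_abs, abs_of_nonneg (WW_nonneg _ _)]
    by_cases hn : n = n0
    · have e : f n - G n = ((WW c n0 * Real.exp (u*κ) - WW (1/2) n0 : ℝ) : ℂ) * sI T₁ T₂ (u - Real.log n0) + Real.exp (-(u*κ)) * (WW c n * sI T₁ T₂ (u + Real.log n)) := by
        simp only [hf, hG, hn]; push_cast; ring
      rw [e]
      refine (norm_add_le _ _).trans ?_
      rw [norm_mul, norm_mul, norm_mul, hnE, hnW, Complex.norm_real, Real.norm_eq_abs]
      simp only [hD, if_pos hn]
      have z1 := mul_nonneg (Real.exp_pos (u*κ)).le (WW_nonneg c n)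
      have z2 := mul_nonneg (Real.exp_pos (u*κ)).le (hP0 n)
      rw [mul_add, mul_add]
      linarith
    · have e : f n - G n = Real.exp (u*κ) * (WW c n * sI T₁ T₂ (u - Real.log n)) + Real.exp (-(u*κ)) * (WW c n * sI T₁ T₂ (u + Real.log n)) := by
        simp only [hf, hG, if_neg hn]; ring
      rw [e]
      refine (norm_add_le _ _).trans ?_
      rw [norm_mul, norm_mul, norm_mul, norm_mul, hnE, hnE, hnW]
      simp only [hD, if_neg hn]
      have z1 := mul_le_mul_of_nonneg_left (hminus n hn) (Real.exp_pos (u*κ)).le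
      rw [mul_add] at z1
      rw [mul_add, mul_add]
      linarith
  have hPs : HasSum P (∑ n ∈ Finset.range (M+1), 4 * L * (2 * (1 / |(n:ℝ) - n0|) + 1 / n)) := by
    have h := hasSum_sum_of_ne_finset_zero (L := SummationFilter.unconditional ℕ) (f := P) (s := Finset.range (M+1)) (fun n hn => by simp only [hP, if_neg hn])
    have e : ∑ n ∈ Finset.range (M+1), P n = ∑ n ∈ Finset.range (M+1), 4 * L * (2 * (1 / |(n:ℝ) - n0|) + 1 / n) :=
      Finset.sum_congr rfl (fun n hn => by simp only [hP, if_pos hn])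
    rwa [e] at h
  have hDs : HasSum D 64 := by simpa [hD] using hasSum_ite_eq n0 (64:ℝ)
  have hGs : HasSum G ((WW (1/2) n0 : ℂ) * sI T₁ T₂ (u - Real.log n0)) := hasSum_ite_eq n0 _
  have hall := ((((hs.hasSum.mul_left 8).add hPs).add hDs).mul_left (Real.exp (u*κ)))
  have hfs : Summable f := by
    have h1 : Summable (fun n => f n - G n) := Summable.of_norm_bounded hall.summable hbound
    simpa using h1.add hGs.summable
  have hfin := tsum_of_norm_bounded hall hbound
  rw [hfs.tsum_sub hGs.summable, hGs.tsum_eq] at hfin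
  refine hfin.trans ?_
  have hPb : ∑ n ∈ Finset.range (M+1), 4 * L * (2 * (1 / |(n:ℝ) - n0|) + 1 / n) ≤ 200 * L^2 := by
    have h1 := harm_shift M n0 hn0M
    have h2 := harm_shift M 0 (Nat.zero_le _)
    simp only [Nat.cast_zero, sub_zero, Nat.abs_cast] at h2
    rw [← Finset.mul_sum, Finset.sum_add_distrib, ← Finset.mul_sum]
    have h3 := add_le_add (mul_le_mul_of_nonneg_left h1 zero_le_two) h2
    have h4 := mul_le_mul_of_nonneg_left (h3.trans (show _ ≤ 18 * L by linarith)) (show 0 ≤ 4 * L by linarith)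
    linarith [sq_nonneg L]
  have hL2 : 1 ≤ L^2 := by nlinarith
  rw [mul_comm]
  gcongr
  linarith [mul_le_mul_of_nonneg_left hL2 hV0]

lemma hasSum_fcongr {f g : ℕ → ℂ} {a : ℂ} (h : HasSum g a) (e : ∀ n, f n = g n) : HasSum f a :=
  (funext e : f = g) ▸ h

lemma line_ne (c t : ℝ) (hc : 1 < c) : (c + t * Complex.I : ℂ) ≠ 1 ∧ riemannZeta (c + t * Complex.I) ≠ 0 := by
  constructor
  · intro h
    have := congrArg Complex.re h
    simp at this; linarith
  · exact riemannZeta_ne_zero_of_one_lt_re (by simpa using hc)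

lemma zeta_line_cont (c : ℝ) (hc : 1 < c) : Continuous (fun t : ℝ => logDeriv riemannZeta (c + t * Complex.I)) := by
  rw [continuous_iff_continuousAt]
  intro t
  obtain ⟨h1, h2⟩ := line_ne c t hc
  have ha := zeta_analyticAt _ h1
  have : ContinuousAt (logDeriv riemannZeta) (c + t * Complex.I) := by
    unfold logDeriv
    exact ha.deriv.continuousAt.div ha.continuousAt h2
  exact ContinuousAt.comp (f := fun t : ℝ => (c + t * Complex.I : ℂ)) this (by fun_prop)

lemma zeta_hasSum (c t : ℝ) (hc : 1 < c) :
    HasSum (fun n : ℕ => -(WW c n : ℂ) * Complex.exp (-(Real.log n * t * Complex.I))) (logDeriv riemannZeta (c + t * Complex.I)) := by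
  have hs : 1 < (c + t * Complex.I : ℂ).re := by simpa using hc
  have h := (ArithmeticFunction.LSeriesSummable_vonMangoldt hs).hasSum
  have e := ArithmeticFunction.LSeries_vonMangoldt_eq_deriv_riemannZeta_div hs
  rw [LSeries] at e
  rw [e] at h
  have h' := h.neg
  rw [neg_div, neg_neg, ← logDeriv_apply] at h'
  refine hasSum_fcongr h' fun n => ?_
  rcases Nat.eq_zero_or_pos n with h0 | h0
  · simp [h0, WW]
  · have hn : (n:ℂ) ≠ 0 := by exact_mod_cast h0.ne'
    have hnr : (0:ℝ) ≤ n := by positivity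
    rw [LSeries.term_of_ne_zero h0.ne', WW]
    push_cast
    rw [Complex.ofReal_cpow hnr, Complex.cpow_add _ _ hn, Complex.ofReal_natCast]
    rw [Complex.cpow_def_of_ne_zero hn (t * Complex.I), Complex.exp_neg]
    have : Complex.log n * (t * Complex.I) = Complex.log n * t * Complex.I := by ring
    rw [this]
    field_simp

lemma zint (c u T₁ T₂ : ℝ) (hc : 1 < c) :
    ∫ t in T₁..T₂, (logDeriv riemannZeta (c + t * Complex.I) * Real.exp (u*(c-1/2)) + starRingEnd ℂ (logDeriv riemannZeta (c + t * Complex.I)) * Real.exp (-(u*(c-1/2)))) * Complex.exp (u * t * Complex.I)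
     = -∑' n, (WW c n : ℂ) * (Real.exp (u*(c-1/2)) * sI T₁ T₂ (u - Real.log n) + Real.exp (-(u*(c-1/2))) * sI T₁ T₂ (u + Real.log n)) := by
  set E := Real.exp (u*(c-1/2))
  set E' := Real.exp (-(u*(c-1/2)))
  have hE : 0 < E := Real.exp_pos _
  have hE' : 0 < E' := Real.exp_pos _
  have hW : Summable (WW c) := WW_summable c hc
  set F : ℕ → ℝ → ℂ := fun n t => -(WW c n : ℂ) * (E * Complex.exp ((u - Real.log n : ℝ) * t * Complex.I) + E' * Complex.exp ((u + Real.log n : ℝ) * t * Complex.I)) with hF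
  have hsum : ∀ t : ℝ, HasSum (fun n => F n t) ((logDeriv riemannZeta (c + t * Complex.I) * E + starRingEnd ℂ (logDeriv riemannZeta (c + t * Complex.I)) * E') * Complex.exp (u * t * Complex.I)) := by
    intro t
    have h1 := zeta_hasSum c t hc
    have h2 := Complex.hasSum_conj'.mpr h1
    have h3 := ((h1.mul_right (E:ℂ)).add (h2.mul_right (E':ℂ))).mul_right (Complex.exp (u * t * Complex.I))
    refine hasSum_fcongr h3 fun n => ?_
    simp only [hF, map_mul, map_neg, Complex.conj_ofReal, ← Complex.exp_conj, Complex.conj_I]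
    push_cast
    rw [show ((u:ℂ) - Complex.log n) * t * Complex.I = -(Complex.log n * t * Complex.I) + u * t * Complex.I by ring,
      show ((u:ℂ) + Complex.log n) * t * Complex.I = -(Complex.log n * t * -Complex.I) + u * t * Complex.I by ring,
      Complex.exp_add, Complex.exp_add]
    ring
  have hdom := intervalIntegral.hasSum_integral_of_dominated_convergence (μ := volume) (a := T₁) (b := T₂) (F := F)
    (f := fun t : ℝ => (logDeriv riemannZeta (c + t * Complex.I) * E + starRingEnd ℂ (logDeriv riemannZeta (c + t * Complex.I)) * E') * Complex.exp (u * t * Complex.I))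
    (fun n _ => WW c n * (E + E')) (fun n => by
      apply Continuous.aestronglyMeasurable; simp only [hF]; fun_prop)
    (fun n => by
      refine Eventually.of_forall fun t _ => ?_
      simp only [hF]
      rw [norm_mul, norm_neg, Complex.norm_real, Real.norm_eq_abs, abs_of_nonneg (WW_nonneg c n)]
      refine mul_le_mul_of_nonneg_left ((norm_add_le _ _).trans ?_) (WW_nonneg c n)
      rw [norm_mul, norm_mul, norm_exp_vt, norm_exp_vt, Complex.norm_real, Complex.norm_real, Real.norm_eq_abs, Real.norm_eq_abs, abs_of_pos hE, abs_of_pos hE']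
      simp)
    (Eventually.of_forall fun t _ => hW.mul_right _) (by simp) (Eventually.of_forall fun t _ => hsum t)
  rw [← hdom.tsum_eq, ← tsum_neg]
  congr 1; ext n
  simp only [hF]
  rw [intervalIntegral.integral_const_mul, intervalIntegral.integral_add (Continuous.intervalIntegrable (by fun_prop) _ _) (Continuous.intervalIntegrable (by fun_prop) _ _),
    intervalIntegral.integral_const_mul, intervalIntegral.integral_const_mul]
  simp only [sI]; ring

noncomputable def FF (T₁ T₂ u : ℝ) : ℂ := ∫ t in T₁..T₂, (Real.log (t / (2 * Real.pi)) : ℂ) * Complex.exp (u * t * Complex.I)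

lemma gint (c u U T₁ T₂ : ℝ) (hc : 1 < c) (hc2 : c ≤ 2) (hu : 0 ≤ u) (hU : 4 ≤ U) (h1 : U < T₁) (h12 : T₁ ≤ T₂) (h2 : T₂ < 2 * U + 3) :
    ‖(∫ t in T₁..T₂, (logDeriv Complex.Gammaℝ (c + t * Complex.I) * Real.exp (u*(c-1/2)) + starRingEnd ℂ (logDeriv Complex.Gammaℝ (c + t * Complex.I)) * Real.exp (-(u*(c-1/2)))) * Complex.exp (u * t * Complex.I)) - Real.cosh (u*(c-1/2)) * FF T₁ T₂ u‖ ≤ 30 * Real.exp (u*(c-1/2))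
    ∧ IntervalIntegrable (fun t : ℝ => (logDeriv Complex.Gammaℝ (c + t * Complex.I) * Real.exp (u*(c-1/2)) + starRingEnd ℂ (logDeriv Complex.Gammaℝ (c + t * Complex.I)) * Real.exp (-(u*(c-1/2)))) * Complex.exp (u * t * Complex.I)) volume T₁ T₂ := by
  set κ := c - 1/2 with hκ
  have hκ0 : 0 < κ := by linarith
  have hκ2 : κ ≤ 2 := by linarith
  set E := Real.exp (u*κ) with hE
  set E' := Real.exp (-(u*κ)) with hE'
  have hEE : E' ≤ E := Real.exp_le_exp.mpr (by nlinarith [mul_nonneg hu hκ0.le])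
  have hE0 : 0 < E := Real.exp_pos _
  have hE'0 : 0 < E' := Real.exp_pos _
  set g : ℝ → ℂ := fun t => logDeriv Complex.Gammaℝ (c + t * Complex.I) with hg
  have hgc : ContinuousOn g (Ioi 0) := by
    have : ContinuousOn (fun t : ℝ => logDeriv completedRiemannZeta (c + t * Complex.I) - logDeriv riemannZeta (c + t * Complex.I)) (Ioi 0) :=
      (XX_line_cont c hc).sub (zeta_line_cont c hc).continuousOn
    refine this.congr fun t ht => ?_
    obtain ⟨a1, a2⟩ := line_ne c t hc
    simp only [hg]
    rw [logDeriv_XX _ (by simp; linarith) a1 a2]; ring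
  have hsub : uIcc T₁ T₂ ⊆ Ioi 0 := by
    rw [uIcc_of_le h12]; intro t ht; exact lt_of_lt_of_le (by linarith) ht.1
  have hgc' := hgc.mono hsub
  have hint : IntervalIntegrable (fun t : ℝ => (g t * E + starRingEnd ℂ (g t) * E') * Complex.exp (u * t * Complex.I)) volume T₁ T₂ := by
    apply ContinuousOn.intervalIntegrable
    refine ContinuousOn.mul (ContinuousOn.add (hgc'.mul continuousOn_const) (ContinuousOn.mul ?_ continuousOn_const)) (by fun_prop)
    exact Complex.continuous_conj.comp_continuousOn hgc'
  refine ⟨?_, hint⟩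
  have hlogc : ContinuousOn (fun t : ℝ => (Real.log (t / (2 * Real.pi)) : ℂ)) (uIcc T₁ T₂) := by
    refine Complex.continuous_ofReal.comp_continuousOn ?_
    refine ContinuousOn.log (by fun_prop) fun t ht => ?_
    have : (0:ℝ) < t := hsub ht
    positivity
  have hintF : IntervalIntegrable (fun t : ℝ => (Real.log (t / (2 * Real.pi)) : ℂ) * Complex.exp (u * t * Complex.I)) volume T₁ T₂ := by
    apply ContinuousOn.intervalIntegrable
    exact hlogc.mul (by fun_prop)
  set q : ℂ := (Real.pi / 2 * Real.sinh (u*κ) : ℝ) * Complex.I with hq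
  have hints : IntervalIntegrable (fun t : ℝ => q * Complex.exp (u * t * Complex.I)) volume T₁ T₂ :=
    Continuous.intervalIntegrable (by fun_prop) _ _
  have hrem : ‖∫ t in T₁..T₂, ((g t * E + starRingEnd ℂ (g t) * E') * Complex.exp (u * t * Complex.I)
      - Real.cosh (u*κ) * ((Real.log (t / (2 * Real.pi)) : ℂ) * Complex.exp (u * t * Complex.I))
      - q * Complex.exp (u * t * Complex.I))‖ ≤ 20 * E := by
    have := intervalIntegral.norm_integral_le_of_norm_le_const (a := T₁) (b := T₂) (C := 10 / U * E)
      (f := fun t : ℝ => ((g t * E + starRingEnd ℂ (g t) * E') * Complex.exp (u * t * Complex.I)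
      - Real.cosh (u*κ) * ((Real.log (t / (2 * Real.pi)) : ℂ) * Complex.exp (u * t * Complex.I))
      - q * Complex.exp (u * t * Complex.I))) ?_
    · refine this.trans ?_
      rw [abs_of_nonneg (by linarith)]
      calc _ ≤ 10 / U * E * (2 * U) := by gcongr; linarith
        _ = _ := by field_simp; ring
    · intro t ht
      rw [uIoc_of_le h12] at ht
      have ht4 : U ≤ t := by linarith [ht.1]
      have hb := gam_bound c t (by linarith) hc2 (by linarith)
      set D : ℂ := g t - ((Real.log (t/(2*Real.pi))/2 : ℝ) + (Real.pi/4) * Complex.I) with hD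
      have hb' : ‖D‖ ≤ 5 / U := hb.trans (by gcongr)
      have e : (g t * E + starRingEnd ℂ (g t) * E') * Complex.exp (u * t * Complex.I)
        - Real.cosh (u*κ) * ((Real.log (t / (2 * Real.pi)) : ℂ) * Complex.exp (u * t * Complex.I))
        - q * Complex.exp (u * t * Complex.I) = (D * E + starRingEnd ℂ D * E') * Complex.exp (u * t * Complex.I) := by
        have hgD : g t = D + ((Real.log (t/(2*Real.pi))/2 : ℝ) + (Real.pi/4) * Complex.I) := by rw [hD]; ring
        have hcD : starRingEnd ℂ (g t) = starRingEnd ℂ D + ((Real.log (t/(2*Real.pi))/2 : ℝ) - (Real.pi/4) * Complex.I) := by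
          rw [hgD, map_add, map_add, map_mul, map_div₀, Complex.conj_ofReal, Complex.conj_ofReal, Complex.conj_I, Complex.conj_ofNat]; ring
        rw [hcD, hgD, hq, Real.cosh_eq, Real.sinh_eq, ← hE, ← hE']
        push_cast; ring
      rw [e, norm_mul, norm_exp_vt, mul_one]
      refine (norm_add_le _ _).trans ?_
      rw [norm_mul, norm_mul, Complex.norm_conj, Complex.norm_real, Complex.norm_real, Real.norm_eq_abs, Real.norm_eq_abs, abs_of_pos hE0, abs_of_pos hE'0]
      calc _ ≤ 5 / U * E + 5 / U * E := by gcongr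
        _ = _ := by ring
  rw [intervalIntegral.integral_sub (hint.sub (hintF.const_mul _)) hints, intervalIntegral.integral_sub hint (hintF.const_mul _), intervalIntegral.integral_const_mul, intervalIntegral.integral_const_mul] at hrem
  have hqs : ‖q * sI T₁ T₂ u‖ ≤ 10 * E := by
    have hs0 : 0 ≤ Real.sinh (u*κ) := Real.sinh_nonneg_iff.mpr (by positivity)
    have hsE : Real.sinh (u*κ) ≤ u * κ * E := by
      have h1 := Real.add_one_le_exp (-(2*(u*κ)))
      have h2 : E' = E * Real.exp (-(2*(u*κ))) := by rw [hE, hE', ← Real.exp_add]; congr 1; ring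
      rw [Real.sinh_eq, ← hE, ← hE', h2]
      nlinarith
    have hm := sI_mul_le T₁ T₂ u
    rw [abs_of_nonneg hu] at hm
    rw [hq, norm_mul, norm_mul, Complex.norm_I, Complex.norm_real, Real.norm_eq_abs, abs_of_nonneg (by positivity)]
    calc _ ≤ 4 / 2 * (u * κ * E) * 1 * ‖sI T₁ T₂ u‖ := by
          gcongr; exact Real.pi_le_four
      _ = 2 * κ * E * (u * ‖sI T₁ T₂ u‖) := by ring
      _ ≤ 2 * 2 * E * 2 := by gcongr
      _ ≤ _ := by linarith
  unfold sI at hqs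
  unfold FF
  calc _ = ‖((∫ t in T₁..T₂, (g t * E + starRingEnd ℂ (g t) * E') * Complex.exp (u * t * Complex.I)) - Real.cosh (u*κ) * (∫ t in T₁..T₂, (Real.log (t / (2 * Real.pi)) : ℂ) * Complex.exp (u * t * Complex.I)) - q * ∫ t in T₁..T₂, Complex.exp (u * t * Complex.I)) + q * ∫ t in T₁..T₂, Complex.exp (u * t * Complex.I)‖ := by
        congr 1; ring
    _ ≤ _ := (norm_add_le _ _).trans (by linarith)

lemma RR_bound (u U T₁ T₂ : ℝ) (hu : 0 ≤ u) (hU : 4 ≤ U) (h1 : U < T₁) (h12 : T₁ ≤ T₂) (h2 : T₂ < 2 * U + 3) :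
    ‖FF T₁ T₂ u - Real.log U * sI T₁ T₂ u‖ ≤ 4 * U ∧ u * ‖FF T₁ T₂ u - Real.log U * sI T₁ T₂ u‖ ≤ 6 := by
  have hU0 : 0 < U := by linarith
  have hpi := Real.pi_gt_three
  have hpos : ∀ t ∈ uIcc T₁ T₂, U < t ∧ t < 2*U+3 := by
    rw [uIcc_of_le h12]; intro t ht; exact ⟨lt_of_lt_of_le h1 ht.1, lt_of_le_of_lt ht.2 h2⟩
  set g : ℝ → ℝ := fun t => Real.log (t / (2 * Real.pi)) - Real.log U with hg
  have hgb : ∀ t ∈ uIcc T₁ T₂, |g t| ≤ 2 := by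
    intro t ht
    obtain ⟨a, b⟩ := hpos t ht
    have ht0 : 0 < t := by linarith
    have hlt : Real.log U ≤ Real.log t := Real.log_le_log hU0 a.le
    have hp : Real.log (2 * Real.pi) ≤ 2 := by
      rw [Real.log_le_iff_le_exp (by positivity)]
      have := Real.exp_one_gt_d9
      have h3 : Real.exp 2 = Real.exp 1 * Real.exp 1 := by rw [← Real.exp_add]; norm_num
      nlinarith [Real.pi_lt_d2]
    have hub : Real.log t ≤ Real.log (2 * Real.pi) + Real.log U := by
      rw [← Real.log_mul (by positivity) (by positivity)]
      exact Real.log_le_log ht0 (by nlinarith)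
    simp only [hg]
    rw [Real.log_div ht0.ne' (by positivity), abs_le]; constructor <;> linarith
  have hgc : ContinuousOn (fun t => (g t : ℂ)) (uIcc T₁ T₂) := by
    refine Complex.continuous_ofReal.comp_continuousOn ?_
    refine ContinuousOn.sub (ContinuousOn.log (by fun_prop) fun t ht => ?_) continuousOn_const
    have := (hpos t ht).1
    have : 0 < t := by linarith
    positivity
  have e : FF T₁ T₂ u - Real.log U * sI T₁ T₂ u = ∫ t in T₁..T₂, (g t : ℂ) * Complex.exp (u * t * Complex.I) := by
    have hc2 : ContinuousOn (fun t : ℝ => (Real.log (t / (2 * Real.pi)) : ℂ)) (uIcc T₁ T₂) := by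
      refine (hgc.add (continuousOn_const (c := (Real.log U : ℂ)))).congr fun t ht => ?_
      simp only [hg, Pi.add_apply]; push_cast; ring
    unfold FF sI
    rw [← intervalIntegral.integral_const_mul, ← intervalIntegral.integral_sub]
    · congr 1; ext t; simp only [hg]; push_cast; ring
    · exact ContinuousOn.intervalIntegrable (hc2.mul (by fun_prop))
    · exact Continuous.intervalIntegrable (by fun_prop) _ _
  rw [e]
  constructor
  · have := intervalIntegral.norm_integral_le_of_norm_le_const (a := T₁) (b := T₂) (C := 2)
      (f := fun t : ℝ => (g t : ℂ) * Complex.exp (u * t * Complex.I)) (fun t ht => by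
        rw [norm_mul, norm_exp_vt, mul_one, Complex.norm_real]; exact hgb t (uIoc_subset_uIcc ht))
    rw [abs_of_nonneg (by linarith)] at this
    linarith
  · rcases hu.eq_or_lt with h0 | h0
    · rw [← h0]; norm_num
    have hd : ∀ t ∈ uIcc T₁ T₂, HasDerivAt (fun t : ℝ => (g t : ℂ)) ((1 / t : ℝ) : ℂ) t := by
      intro t ht
      have ht0 : 0 < t := by linarith [(hpos t ht).1]
      have h3 : HasDerivAt g (1 / t) t := by
        have := ((hasDerivAt_id t).div_const (2 * Real.pi)).log (by simp only [id]; positivity) |>.sub_const (Real.log U)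
        refine this.congr_deriv ?_
        simp only [id]; field_simp
      exact h3.ofReal_comp
    have hv : ∀ t ∈ uIcc T₁ T₂, HasDerivAt (fun t : ℝ => Complex.exp (u * t * Complex.I)) (Complex.exp (u * t * Complex.I) * (u * Complex.I)) t := by
      intro t ht
      have h3 : HasDerivAt (fun z : ℂ => Complex.exp (u * z * Complex.I)) (Complex.exp (u * t * Complex.I) * (u * Complex.I)) (t:ℂ) := by
        have := (((hasDerivAt_id (t:ℂ)).const_mul (u:ℂ)).mul_const Complex.I).cexp
        refine this.congr_deriv ?_
        simp
      exact h3.comp_ofReal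
    have hdc : ContinuousOn (fun t : ℝ => ((1 / t : ℝ) : ℂ)) (uIcc T₁ T₂) := by
      refine Complex.continuous_ofReal.comp_continuousOn (ContinuousOn.div continuousOn_const continuousOn_id fun t ht => ?_)
      exact (by linarith [(hpos t ht).1] : (0:ℝ) < t).ne'
    have hparts := intervalIntegral.integral_mul_deriv_eq_deriv_mul hd hv hdc.intervalIntegrable (Continuous.intervalIntegrable (by fun_prop) _ _)
    have hI : (∫ t in T₁..T₂, (g t : ℂ) * (Complex.exp (u * t * Complex.I) * (u * Complex.I))) = (∫ t in T₁..T₂, (g t : ℂ) * Complex.exp (u * t * Complex.I)) * (u * Complex.I) := by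
      rw [← intervalIntegral.integral_mul_const]; congr 1; ext t; ring
    rw [hI] at hparts
    have hn := congrArg norm hparts
    rw [norm_mul, norm_mul, Complex.norm_I, mul_one, Complex.norm_real, Real.norm_eq_abs, abs_of_pos h0] at hn
    rw [mul_comm, hn]
    have hlast := intervalIntegral.norm_integral_le_of_norm_le_const (a := T₁) (b := T₂) (C := 1 / U)
      (f := fun t : ℝ => ((1 / t : ℝ) : ℂ) * Complex.exp (u * t * Complex.I)) (fun t ht => by
        have := (hpos t (uIoc_subset_uIcc ht)).1
        rw [norm_mul, norm_exp_vt, mul_one, Complex.norm_real, Real.norm_eq_abs, abs_of_pos (by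
          have : 0 < t := by linarith
          positivity)]
        gcongr)
    rw [abs_of_nonneg (by linarith)] at hlast
    have hl2 : 1 / U * (T₂ - T₁) ≤ 2 := by
      rw [one_div_mul_eq_div, div_le_iff₀ hU0]; linarith
    refine (norm_sub_le _ _).trans ?_
    have b1 : ‖(g T₂ : ℂ) * Complex.exp (u * T₂ * Complex.I)‖ ≤ 2 := by
      rw [norm_mul, norm_exp_vt, mul_one, Complex.norm_real]; exact hgb _ right_mem_uIcc
    have b2 : ‖(g T₁ : ℂ) * Complex.exp (u * T₁ * Complex.I)‖ ≤ 2 := by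
      rw [norm_mul, norm_exp_vt, mul_one, Complex.norm_real]; exact hgb _ left_mem_uIcc
    have b3 := norm_sub_le ((g T₂ : ℂ) * Complex.exp (u * T₂ * Complex.I)) ((g T₁ : ℂ) * Complex.exp (u * T₁ * Complex.I))
    linarith

noncomputable def aa (L : ℝ) (n : ℕ) : ℝ := if n = 1 then L else -WW (1/2) n

set_option maxHeartbeats 1000000 in
lemma approx (c : ℝ) (hc : 1 < c) (hc2 : c ≤ 2) : ∃ C : ℝ, 0 ≤ C ∧ ∀ U : ℝ, 4 ≤ U → ∃ T₁ T₂ : ℝ, ∃ S : Finset ℂ,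
    U < T₁ ∧ T₁ < U + 1 ∧ 2 * U + 2 < T₂ ∧ T₂ < 2 * U + 3 ∧
    (∀ ρ, ρ ∈ S ↔ riemannZeta ρ = 0 ∧ 0 < ρ.re ∧ ρ.re < 1 ∧ T₁ ≤ ρ.im ∧ ρ.im ≤ T₂) ∧
    ∀ u : ℝ, ∀ n0 : ℕ, 0 ≤ u → u ≤ Real.log U → |Real.exp u - n0| ≤ 1/2 →
      ‖2 * Real.pi * ∑ ρ ∈ S, (zetaMult ρ : ℂ) * Complex.exp (u * (ρ - 1/2)) -
        aa (Real.log U) n0 * sI T₁ T₂ (u - Real.log n0)‖ ^ 2 ≤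
        C * (U^2 / (1 + (U*u)^2)) + C * Real.log U ^ 4 * Real.exp (2 * (u * (c - 1/2))) := by
  obtain ⟨A, hA, hcon⟩ := contour
  obtain ⟨Cz, hCz, hz⟩ := zsum c hc hc2
  set Q := A + Cz + 100 with hQ
  refine ⟨104 + 2 * Q^2, by positivity, fun U hU => ?_⟩
  obtain ⟨T₁, T₂, S, h1, h1', h2, h2', hS, hJ⟩ := hcon U hU
  refine ⟨T₁, T₂, S, h1, h1', h2, h2', hS, fun u n0 hu huL hn0 => ?_⟩
  have h12 : T₁ ≤ T₂ := by linarith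
  set L := Real.log U with hLdef
  have hL1 : 1 ≤ L := by
    rw [hLdef, Real.le_log_iff_exp_le (by linarith)]
    linarith [Real.exp_one_lt_d9]
  have hJ := hJ c hc hc2 u hu
  have hz := hz T₁ T₂ L u n0 hL1 hu huL hn0
  obtain ⟨hg, hgi⟩ := gint c u U T₁ T₂ hc hc2 hu hU h1 h12 h2'
  obtain ⟨hR1, hR2⟩ := RR_bound u U T₁ T₂ hu hU h1 h12 h2'
  have hsplit : (∫ t in T₁..T₂, (logDeriv completedRiemannZeta (c+t*Complex.I) * Real.exp (u*(c-1/2)) + starRingEnd ℂ (logDeriv completedRiemannZeta (c+t*Complex.I)) * Real.exp (-(u*(c-1/2)))) * Complex.exp (u*t*Complex.I))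
     = (∫ t in T₁..T₂, (logDeriv Complex.Gammaℝ (c + t * Complex.I) * Real.exp (u*(c-1/2)) + starRingEnd ℂ (logDeriv Complex.Gammaℝ (c + t * Complex.I)) * Real.exp (-(u*(c-1/2)))) * Complex.exp (u * t * Complex.I))
     + -∑' n, (WW c n : ℂ) * (Real.exp (u*(c-1/2)) * sI T₁ T₂ (u - Real.log n) + Real.exp (-(u*(c-1/2))) * sI T₁ T₂ (u + Real.log n)) := by
    rw [← zint c u T₁ T₂ hc, ← intervalIntegral.integral_add hgi]
    · refine intervalIntegral.integral_congr fun t ht => ?_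
      obtain ⟨a1, a2⟩ := line_ne c t hc
      rw [logDeriv_XX _ (by simp; linarith) a1 a2, map_add]; ring
    · apply Continuous.intervalIntegrable
      have := zeta_line_cont c hc
      have h2 := Complex.continuous_conj.comp this
      simp only [Function.comp_def] at h2
      exact ((this.mul continuous_const).add (h2.mul continuous_const)).mul (by fun_prop)
  rw [hsplit] at hJ
  set κ := c - 1/2 with hκ
  have hκ0 : 0 < κ := by linarith
  have hκ2 : κ ≤ 2 := by linarith
  set E := Real.exp (u*κ) with hE
  have hE1 : 1 ≤ E := Real.one_le_exp (by positivity)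
  set JG := ∫ t in T₁..T₂, (logDeriv Complex.Gammaℝ (c + t * Complex.I) * E + starRingEnd ℂ (logDeriv Complex.Gammaℝ (c + t * Complex.I)) * Real.exp (-(u*κ))) * Complex.exp (u * t * Complex.I)
  set JZ := ∑' n, (WW c n : ℂ) * (E * sI T₁ T₂ (u - Real.log n) + Real.exp (-(u*κ)) * sI T₁ T₂ (u + Real.log n))
  set B := 2 * Real.pi * ∑ ρ ∈ S, (zetaMult ρ : ℂ) * Complex.exp (u * (ρ - 1/2))
  set R := FF T₁ T₂ u - L * sI T₁ T₂ u with hR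
  have hL2 : L ≤ L^2 := by nlinarith
  have hch : Real.cosh (u*κ) ≤ E := by
    rw [Real.cosh_eq, ← hE]
    have : Real.exp (-(u*κ)) ≤ E := Real.exp_le_exp.mpr (by linarith [mul_nonneg hu hκ0.le])
    linarith
  have hch0 := Real.cosh_pos (u*κ)
  have hF : u * ‖FF T₁ T₂ u‖ ≤ 8 * L := by
    have e : FF T₁ T₂ u = R + L * sI T₁ T₂ u := by rw [hR]; ring
    have h3 := sI_mul_le T₁ T₂ u
    rw [abs_of_nonneg hu] at h3
    have h4 := norm_add_le R (L * sI T₁ T₂ u)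
    rw [← e, norm_mul, Complex.norm_real, Real.norm_eq_abs, abs_of_nonneg (by linarith)] at h4
    calc _ ≤ u * (‖R‖ + L * ‖sI T₁ T₂ u‖) := by gcongr
      _ = u * ‖R‖ + L * (u * ‖sI T₁ T₂ u‖) := by ring
      _ ≤ 6 + L * 2 := by gcongr
      _ ≤ _ := by linarith
  have hcase : ‖B - aa L n0 * sI T₁ T₂ (u - Real.log n0)‖ ≤ ‖R‖ + Q * L^2 * E := by
    have hsum3 : ‖B - (Real.cosh (u*κ) * FF T₁ T₂ u - (WW (1/2) n0 : ℂ) * sI T₁ T₂ (u - Real.log n0))‖ ≤ A * L^2 * E + 30 * E + Cz * L^2 * E := by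
      have e : B - (Real.cosh (u*κ) * FF T₁ T₂ u - (WW (1/2) n0 : ℂ) * sI T₁ T₂ (u - Real.log n0))
        = (B - (JG + -JZ)) + (JG - Real.cosh (u*κ) * FF T₁ T₂ u) - (JZ - (WW (1/2) n0 : ℂ) * sI T₁ T₂ (u - Real.log n0)) := by ring
      rw [e]
      refine (norm_sub_le _ _).trans (add_le_add ((norm_add_le _ _).trans (add_le_add hJ hg)) hz)
    by_cases hn : n0 = 1
    · have e : B - aa L n0 * sI T₁ T₂ (u - Real.log n0) = (B - (Real.cosh (u*κ) * FF T₁ T₂ u - (WW (1/2) n0 : ℂ) * sI T₁ T₂ (u - Real.log n0))) + (Real.cosh (u*κ) - 1 : ℝ) * FF T₁ T₂ u + R := by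
        have hw : WW (1/2) 1 = 0 := by simp [WW]
        rw [hn, hw, hR]; simp [aa]; ring
      rw [e]
      have hc1 : Real.cosh (u*κ) - 1 ≤ u * κ * E := by
        have h3 := Real.add_one_le_exp (-(u*κ))
        have h4 : E * Real.exp (-(u*κ)) = 1 := by rw [hE, ← Real.exp_add]; simp
        have h5 : Real.exp (-(u*κ)) ≤ 1 := by rw [Real.exp_le_one_iff]; linarith [mul_nonneg hu hκ0.le]
        rw [Real.cosh_eq, ← hE]
        linarith [mul_le_mul_of_nonneg_left h3 (show 0 ≤ E by linarith)]
      have hc0 := Real.one_le_cosh (u*κ)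
      have h3 : ‖((Real.cosh (u*κ) - 1 : ℝ) : ℂ) * FF T₁ T₂ u‖ ≤ 16 * L * E := by
        rw [norm_mul, Complex.norm_real, Real.norm_eq_abs, abs_of_nonneg (by linarith)]
        calc _ ≤ u * κ * E * ‖FF T₁ T₂ u‖ := by gcongr
          _ = κ * E * (u * ‖FF T₁ T₂ u‖) := by ring
          _ ≤ 2 * E * (8 * L) := by gcongr
          _ = _ := by ring
      have h4 : 30 * E + 16 * L * E ≤ 100 * L^2 * E := by
        linarith [mul_le_mul_of_nonneg_right hL2 (show 0 ≤ E by linarith), mul_le_mul_of_nonneg_right (show 1 ≤ L by linarith) (show 0 ≤ E by linarith)]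
      have h5 := norm_add₃_le (a := B - (Real.cosh (u*κ) * FF T₁ T₂ u - (WW (1/2) n0 : ℂ) * sI T₁ T₂ (u - Real.log n0))) (b := ((Real.cosh (u*κ) - 1 : ℝ) : ℂ) * FF T₁ T₂ u) (c := R)
      rw [hQ]; linarith
    · have e : B - aa L n0 * sI T₁ T₂ (u - Real.log n0) = (B - (Real.cosh (u*κ) * FF T₁ T₂ u - (WW (1/2) n0 : ℂ) * sI T₁ T₂ (u - Real.log n0))) + Real.cosh (u*κ) * FF T₁ T₂ u := by
        simp [aa, hn]; ring
      rw [e]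
      have hu3 : 1/3 ≤ u := by
        have hn1 : n0 ≠ 0 := by
          rintro rfl
          have := Real.one_le_exp hu
          have h3 := (abs_le.mp hn0).2
          simp at h3; linarith
        have hn2 : (2:ℝ) ≤ n0 := by exact_mod_cast (by omega : 2 ≤ n0)
        have h3 : 3/2 ≤ Real.exp u := by linarith [(abs_le.mp hn0).1]
        by_contra hlt
        push Not at hlt
        have h4 := Real.add_one_le_exp (-u)
        have h5 : Real.exp u * Real.exp (-u) = 1 := by rw [← Real.exp_add]; simp
        nlinarith
      have h3 : ‖(Real.cosh (u*κ) : ℂ) * FF T₁ T₂ u‖ ≤ 24 * L * E := by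
        rw [norm_mul, Complex.norm_real, Real.norm_eq_abs, abs_of_pos hch0]
        have : ‖FF T₁ T₂ u‖ ≤ 24 * L := by linarith [mul_le_mul_of_nonneg_right hu3 (norm_nonneg (FF T₁ T₂ u))]
        calc _ ≤ E * (24 * L) := by gcongr
          _ = _ := by ring
      have h4 : 30 * E + 24 * L * E ≤ 100 * L^2 * E := by
        linarith [mul_le_mul_of_nonneg_right hL2 (show 0 ≤ E by linarith), mul_le_mul_of_nonneg_right (show 1 ≤ L by linarith) (show 0 ≤ E by linarith)]
      have h5 := norm_add_le (B - (Real.cosh (u*κ) * FF T₁ T₂ u - (WW (1/2) n0 : ℂ) * sI T₁ T₂ (u - Real.log n0))) ((Real.cosh (u*κ) : ℂ) * FF T₁ T₂ u)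
      rw [hQ]; linarith [norm_nonneg R]
  have hRsq : ‖R‖^2 ≤ 52 * (U^2 / (1 + (U*u)^2)) := by
    rw [mul_div_assoc', le_div_iff₀ (by positivity)]
    have a1 : ‖R‖^2 ≤ (4*U)^2 := by gcongr
    have a2 : (u*‖R‖)^2 ≤ 6^2 := by gcongr
    linarith [mul_le_mul_of_nonneg_left a2 (sq_nonneg U)]
  have hE2 : Real.exp (2 * (u*κ)) = E^2 := by rw [hE, ← Real.exp_nat_mul]; norm_num
  rw [hE2]
  calc _ ≤ (‖R‖ + Q * L^2 * E)^2 := by gcongr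
    _ ≤ 2 * ‖R‖^2 + 2 * (Q * L^2 * E)^2 := by linarith [sq_nonneg (‖R‖ - Q * L^2 * E)]
    _ ≤ 2 * (52 * (U^2 / (1 + (U*u)^2))) + 2 * (Q * L^2 * E)^2 := by gcongr
    _ ≤ _ := by
      have a1 : 0 ≤ U^2 / (1 + (U*u)^2) := by positivity
      have a2 : 0 ≤ L^4*E^2 := by positivity
      linarith [mul_nonneg (sq_nonneg Q) a1]

noncomputable def sft (S : Finset ℂ) (u : ℝ) : ℂ := ∑ ρ ∈ S, (zetaMult ρ : ℂ) * Complex.exp (u * (ρ - 1/2))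

lemma sft_sq (S : Finset ℂ) (u : ℝ) : ‖sft S u‖ ^ 2 = ∑ ρ ∈ S, ∑ ρ' ∈ S, (zetaMult ρ : ℝ) * zetaMult ρ' *
    (Real.exp (u * (ρ.re + ρ'.re - 1)) * Real.cos (u * (ρ.im - ρ'.im))) := by
  have hre : (sft S u).re = ∑ ρ ∈ S, (zetaMult ρ : ℝ) * (Real.exp (u * (ρ.re - 1/2)) * Real.cos (u * ρ.im)) := by
    rw [sft, Complex.re_sum]
    refine Finset.sum_congr rfl fun ρ _ => ?_
    rw [← Complex.ofReal_natCast, Complex.re_ofReal_mul, Complex.exp_re]; simp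
  have him : (sft S u).im = ∑ ρ ∈ S, (zetaMult ρ : ℝ) * (Real.exp (u * (ρ.re - 1/2)) * Real.sin (u * ρ.im)) := by
    rw [sft, Complex.im_sum]
    refine Finset.sum_congr rfl fun ρ _ => ?_
    rw [← Complex.ofReal_natCast, Complex.im_ofReal_mul, Complex.exp_im]; simp
  rw [← Complex.normSq_eq_norm_sq, Complex.normSq_apply, hre, him, Finset.sum_mul_sum, Finset.sum_mul_sum, ← Finset.sum_add_distrib]
  refine Finset.sum_congr rfl fun ρ _ => ?_
  rw [← Finset.sum_add_distrib]
  refine Finset.sum_congr rfl fun ρ' _ => ?_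
  rw [show u * (ρ.re + ρ'.re - 1) = u * (ρ.re - 1/2) + u * (ρ'.re - 1/2) by ring, Real.exp_add, mul_sub u ρ.im, Real.cos_sub]
  ring

lemma sft_sq_cosh (S : Finset ℂ) (hst : ∀ ρ ∈ S, 1 - starRingEnd ℂ ρ ∈ S) (hm : ∀ ρ ∈ S, zetaMult (1 - starRingEnd ℂ ρ) = zetaMult ρ) (u : ℝ) :
    ‖sft S u‖ ^ 2 = ∑ ρ ∈ S, ∑ ρ' ∈ S, (zetaMult ρ : ℝ) * zetaMult ρ' *
    (Real.cosh (u * (ρ.re + ρ'.re - 1)) * Real.cos (u * (ρ.im - ρ'.im))) := by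
  have hre : ∀ g : ℂ → ℝ, ∑ ρ ∈ S, g (1 - starRingEnd ℂ ρ) = ∑ ρ ∈ S, g ρ := fun g =>
    Finset.sum_nbij' (fun ρ => 1 - starRingEnd ℂ ρ) (fun ρ => 1 - starRingEnd ℂ ρ) hst hst (by simp) (by simp) (by simp)
  have h1 := sft_sq S u
  have h2 : ‖sft S u‖ ^ 2 = ∑ ρ ∈ S, ∑ ρ' ∈ S, (zetaMult ρ : ℝ) * zetaMult ρ' *
    (Real.exp (-(u * (ρ.re + ρ'.re - 1))) * Real.cos (u * (ρ.im - ρ'.im))) := by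
    rw [h1, ← hre]
    refine Finset.sum_congr rfl fun ρ hρ => ?_
    rw [← hre]
    refine Finset.sum_congr rfl fun ρ' hρ' => ?_
    rw [hm ρ hρ, hm ρ' hρ']
    simp only [Complex.sub_re, Complex.one_re, Complex.conj_re, Complex.sub_im, Complex.one_im, Complex.conj_im]
    congr 3 <;> ring
  have h3 : ‖sft S u‖ ^ 2 = (‖sft S u‖ ^ 2 + ‖sft S u‖ ^ 2) / 2 := by ring
  rw [h3]
  nth_rewrite 1 [h1]
  rw [h2, ← Finset.sum_add_distrib, Finset.sum_div]
  refine Finset.sum_congr rfl fun ρ _ => ?_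
  rw [← Finset.sum_add_distrib, Finset.sum_div]
  refine Finset.sum_congr rfl fun ρ' _ => ?_
  rw [Real.cosh_eq]; ring

lemma sft_lower (S : Finset ℂ) (hst : ∀ ρ ∈ S, 1 - starRingEnd ℂ ρ ∈ S) (hm : ∀ ρ ∈ S, zetaMult (1 - starRingEnd ℂ ρ) = zetaMult ρ)
    (b θ L : ℝ) (hb : 0 < b) (hθ : 0 < θ) (hL : 0 < L) (hbd : ∀ ρ ∈ S, |ρ.re - 1/2| ≤ b / (2 * L)) :
    (∫ α in (0:ℝ)..θ, rr b θ α) * (∑ ρ ∈ S, (zetaMult ρ : ℝ)^2 + ∑ ρ ∈ S with ρ.re ≠ 1/2, (zetaMult ρ : ℝ)^2)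
      ≤ ∫ α in (0:ℝ)..θ, rr b θ α * ‖sft S (L * α)‖ ^ 2 := by
  set K : ℂ → ℂ → ℝ := fun ρ ρ' => ∫ x in (0:ℝ)..θ, (1 - x/θ) * (Real.cosh ((L * (ρ.re + ρ'.re - 1))*x)/Real.cosh (b*x)) * Real.cos ((L * (ρ.im - ρ'.im))*x) with hK
  have hcont : ∀ p q : ℝ, Continuous (fun x => (1 - x/θ) * (Real.cosh (p*x)/Real.cosh (b*x)) * Real.cos (q*x)) := by
    intro p q
    refine Continuous.mul (Continuous.mul (by fun_prop) (Continuous.div (by fun_prop) (by fun_prop) fun x => (Real.cosh_pos _).ne')) (by fun_prop)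
  have hI : ∫ α in (0:ℝ)..θ, rr b θ α * ‖sft S (L * α)‖ ^ 2 = ∑ ρ ∈ S, ∑ ρ' ∈ S, (zetaMult ρ : ℝ) * zetaMult ρ' * K ρ ρ' := by
    have e : ∀ α, rr b θ α * ‖sft S (L * α)‖ ^ 2 = ∑ ρ ∈ S, ∑ ρ' ∈ S, (zetaMult ρ : ℝ) * zetaMult ρ' * ((1 - α/θ) * (Real.cosh ((L * (ρ.re + ρ'.re - 1))*α)/Real.cosh (b*α)) * Real.cos ((L * (ρ.im - ρ'.im))*α)) := by
      intro α
      rw [sft_sq_cosh S hst hm, Finset.mul_sum]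
      refine Finset.sum_congr rfl fun ρ _ => ?_
      rw [Finset.mul_sum]
      refine Finset.sum_congr rfl fun ρ' _ => ?_
      rw [rr, mul_right_comm L α, mul_right_comm L α]; ring
    simp only [e]
    rw [intervalIntegral.integral_finsetSum]
    · refine Finset.sum_congr rfl fun ρ _ => ?_
      rw [intervalIntegral.integral_finsetSum]
      · refine Finset.sum_congr rfl fun ρ' _ => ?_
        rw [intervalIntegral.integral_const_mul]
      · exact fun ρ' _ => ((hcont _ _).intervalIntegrable _ _).const_mul _
    · refine fun ρ _ => Continuous.intervalIntegrable ?_ _ _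
      exact continuous_finsetSum _ fun ρ' _ => continuous_const.mul (hcont _ _)
  have hK0 : ∀ ρ ∈ S, ∀ ρ' ∈ S, 0 ≤ K ρ ρ' := by
    intro ρ hρ ρ' hρ'
    refine cosPos_kernel θ hθ b _ hb ?_ _
    have h1 := hbd ρ hρ
    have h2 := hbd ρ' hρ'
    rw [abs_mul, abs_of_pos hL]
    have h3 : |ρ.re + ρ'.re - 1| ≤ b / (2*L) + b / (2*L) := by
      rw [show ρ.re + ρ'.re - 1 = (ρ.re - 1/2) + (ρ'.re - 1/2) by ring]
      exact (abs_add_le _ _).trans (add_le_add h1 h2)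
    calc _ ≤ L * (b / (2*L) + b / (2*L)) := by gcongr
      _ = b := by field_simp; ring
  have hKI : ∀ ρ ρ' : ℂ, ρ.im = ρ'.im → (∫ α in (0:ℝ)..θ, rr b θ α) ≤ K ρ ρ' := by
    intro ρ ρ' h
    refine intervalIntegral.integral_mono_on hθ.le ((rr_cont b θ).intervalIntegrable _ _) ((hcont _ _).intervalIntegrable _ _) fun x hx => ?_
    rw [h, sub_self, mul_zero, zero_mul, Real.cos_zero, mul_one, rr, div_eq_mul_inv, ← one_div]
    have : 0 ≤ 1 - x/θ := by rw [sub_nonneg, div_le_one hθ]; exact hx.2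
    have h1 := Real.one_le_cosh ((L * (ρ.re + ρ'.re - 1))*x)
    have h2 := Real.cosh_pos (b*x)
    gcongr
  rw [hI, Finset.sum_filter, ← Finset.sum_add_distrib, Finset.mul_sum]
  refine Finset.sum_le_sum fun ρ hρ => ?_
  have hnn : ∀ ρ' ∈ S, 0 ≤ (zetaMult ρ : ℝ) * zetaMult ρ' * K ρ ρ' := fun ρ' hρ' => mul_nonneg (by positivity) (hK0 ρ hρ ρ' hρ')
  have hm2 : (0:ℝ) ≤ (zetaMult ρ : ℝ) * zetaMult ρ := by positivity
  have k1 := mul_le_mul_of_nonneg_left (hKI ρ ρ rfl) hm2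
  split_ifs with h
  · have hne : ρ ≠ 1 - starRingEnd ℂ ρ := by
      intro h'
      have := congrArg Complex.re h'
      simp at this
      exact h (by linarith)
    have hsub : ({ρ, 1 - starRingEnd ℂ ρ} : Finset ℂ) ⊆ S := by
      intro z hz
      simp only [Finset.mem_insert, Finset.mem_singleton] at hz
      rcases hz with rfl | rfl
      · exact hρ
      · exact hst ρ hρ
    have := Finset.sum_le_sum_of_subset_of_nonneg hsub (fun ρ' hρ' _ => hnn ρ' hρ')
    rw [Finset.sum_pair hne, hm ρ hρ] at this
    have k2 := mul_le_mul_of_nonneg_left (hKI ρ (1 - starRingEnd ℂ ρ) (by simp)) hm2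
    nlinarith
  · have := Finset.single_le_sum hnn hρ
    nlinarith

lemma sft_cont (S : Finset ℂ) : Continuous (sft S) := by
  unfold sft
  exact continuous_finsetSum _ fun ρ _ => by fun_prop

lemma norm_sq_split (x y : ℂ) (η : ℝ) (hη : 0 < η) : ‖x‖^2 ≤ (1+η) * ‖y‖^2 + (1+1/η) * ‖x - y‖^2 := by
  have h : ‖x‖ ≤ ‖y‖ + ‖x - y‖ := by
    have := norm_add_le y (x - y)
    rwa [add_sub_cancel] at this
  have h2 : ‖x‖^2 ≤ (‖y‖ + ‖x - y‖)^2 := by gcongr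
  have h3 : 2 * ‖y‖ * ‖x - y‖ ≤ η * ‖y‖^2 + 1/η * ‖x-y‖^2 := by
    have : η * ‖y‖^2 + 1/η * ‖x-y‖^2 - 2 * ‖y‖ * ‖x - y‖ = (1/η) * (η * ‖y‖ - ‖x-y‖)^2 := by field_simp; ring
    have h4 : 0 ≤ (1/η) * (η * ‖y‖ - ‖x-y‖)^2 := by positivity
    linarith
  nlinarith

lemma aa_sq (L : ℝ) (n : ℕ) (hn : n ≠ 1) : aa L n ^ 2 = ArithmeticFunction.vonMangoldt n ^ 2 / n := by
  rw [aa, if_neg hn, WW, neg_sq, div_pow, ← Real.rpow_natCast ((n:ℝ)^(1/2:ℝ)) 2, ← Real.rpow_mul (by positivity)]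
  norm_num

set_option maxHeartbeats 1000000 in
lemma upper (b θ η c : ℝ) (hθ : 0 < θ) (hθ1 : θ ≤ 1) (hη : 0 < η) (hc : 1 < c) (hc2 : c ≤ 2) :
    ∃ C : ℝ, 0 ≤ C ∧ ∀ U : ℝ, 4 ≤ U → ∃ T₁ T₂ : ℝ, ∃ S : Finset ℂ,
    U < T₁ ∧ T₁ < U + 1 ∧ 2 * U + 2 < T₂ ∧ T₂ < 2 * U + 3 ∧
    (∀ ρ, ρ ∈ S ↔ riemannZeta ρ = 0 ∧ 0 < ρ.re ∧ ρ.re < 1 ∧ T₁ ≤ ρ.im ∧ ρ.im ≤ T₂) ∧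
    4 * Real.pi^2 * (∫ α in (0:ℝ)..θ, rr b θ α * ‖sft S (Real.log U * α)‖ ^ 2) ≤
      (1+η) * (Real.pi * (U + 3)) * (Real.log U * (1 + 2 * ∫ α in (0:ℝ)..θ, α * rr b θ α) + C)
      + C * (U / Real.log U + Real.log U ^ 4 * Real.exp (θ * (2 * c - 1) * Real.log U)) := by
  obtain ⟨Ca, hCa, happ⟩ := approx c hc hc2
  obtain ⟨M, hM, hlip⟩ := rr_lip b θ (θ+1)
  set C0 := M + 1/θ with hC0
  have hC00 : 0 ≤ C0 := by positivity
  obtain ⟨Cp, hCp, hprime⟩ := prime_sum b θ C0 hθ hC00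
  set C1 := C0 + 2 * Cp with hC1
  set C2 := (1+1/η) * (2 * Ca) with hC2
  have hC20 : 0 ≤ C2 := by positivity
  refine ⟨C1 + C2, by positivity, fun U hU => ?_⟩
  obtain ⟨T₁, T₂, S, h1, h1', h2, h2', hS, hap⟩ := happ U hU
  refine ⟨T₁, T₂, S, h1, h1', h2, h2', hS, ?_⟩
  set L := Real.log U with hLdef
  have hL1 : 1 ≤ L := by
    rw [hLdef, Real.le_log_iff_exp_le (by linarith)]
    linarith [Real.exp_one_lt_d9]
  have hL0 : 0 < L := by linarith
  have hU0 : 0 < U := by linarith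
  set N := ⌊Real.exp (θ * L) + 1/2⌋₊ with hN
  have hexp1 : 1 ≤ Real.exp (θ * L) := Real.one_le_exp (by positivity)
  have hNle : (N:ℝ) ≤ Real.exp (θ*L) + 1/2 := Nat.floor_le (by positivity)
  have hN1 : 1 ≤ N := Nat.le_floor (by push_cast; linarith)
  have hlogn : ∀ n ∈ Finset.Ioc 0 N, Real.log n ≤ θ * L + 1 ∧ 0 ≤ Real.log n := by
    intro n hn
    have hn' := Finset.mem_Ioc.mp hn
    refine ⟨?_, Real.log_natCast_nonneg n⟩
    have h3 : (n:ℝ) ≤ N := by exact_mod_cast hn'.2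
    have h4 : (n:ℝ) ≤ Real.exp (θ*L+1) := by
      rw [Real.exp_add]; linarith [mul_le_mul_of_nonneg_left (show (2:ℝ) ≤ Real.exp 1 by linarith [Real.exp_one_gt_d9]) (Real.exp_pos (θ*L)).le]
    have := Real.log_le_log (by exact_mod_cast hn'.1) h4
    rwa [Real.log_exp] at this
  set w : ℕ → ℝ := fun n => rr b θ (Real.log n / L) + C0 / L with hw
  have hw0 : ∀ n ∈ Finset.Ioc 0 N, 0 ≤ w n := by
    intro n hn
    obtain ⟨a1, a2⟩ := hlogn n hn
    simp only [hw, rr]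
    have hch := Real.one_le_cosh (b * (Real.log n / L))
    have h3 : -(1/θ) / L ≤ (1 - Real.log n / L / θ) / Real.cosh (b * (Real.log n / L)) := by
      rw [le_div_iff₀ (by linarith)]
      have h4 : -(1/θ)/L ≤ 1 - Real.log n / L / θ := by
        have : 1 - Real.log n / L / θ - -(1/θ)/L = (θ * L + 1 - Real.log n) / (L * θ) := by field_simp; ring
        have h5 : 0 ≤ (θ * L + 1 - Real.log n) / (L * θ) := div_nonneg (by linarith) (by positivity)
        linarith
      have h6 : -(1/θ)/L ≤ 0 := by
        rw [neg_div]; simp; positivity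
      linarith [mul_le_mul_of_nonpos_left hch h6]
    have h7 : C0 / L = M / L + (1/θ)/L := by rw [hC0]; ring
    have h8 : 0 ≤ M / L := by positivity
    rw [h7]
    rw [neg_div] at h3
    linarith
  have hrr : ∀ α ∈ Icc 0 θ, 0 ≤ rr b θ α ∧ rr b θ α ≤ 1 := by
    intro α hα
    have h3 : 0 ≤ 1 - α/θ := by rw [sub_nonneg, div_le_one hθ]; exact hα.2
    have h5 : 0 ≤ α/θ := div_nonneg hα.1 hθ.le
    have h4 := Real.one_le_cosh (b*α)
    refine ⟨div_nonneg h3 (by linarith), ?_⟩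
    rw [rr, div_le_one (by linarith)]; linarith
  set X := Real.exp (θ * (2*c-1) * L) with hX
  -- pointwise
  have hpt : ∀ α ∈ Icc 0 θ, 4 * Real.pi^2 * (rr b θ α * ‖sft S (L * α)‖^2) ≤
      (1+η) * (∑ n ∈ Finset.Ioc 0 N, w n * aa L n^2 * ‖sI T₁ T₂ (L * α - Real.log n)‖^2)
      + (1+1/η) * (Ca * (U^2 / (1 + (U * L * α)^2)) + Ca * L^4 * X) := by
    intro α hα
    obtain ⟨hr0, hr1⟩ := hrr α hα
    set u := L * α with hu
    have hu0 : 0 ≤ u := mul_nonneg hL0.le hα.1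
    have huL : u ≤ θ * L := by rw [hu, mul_comm]; exact mul_le_mul_of_nonneg_right hα.2 hL0.le
    set n0 := ⌊Real.exp u + 1/2⌋₊ with hn0
    have he1 : 1 ≤ Real.exp u := Real.one_le_exp hu0
    have f1 : (n0:ℝ) ≤ Real.exp u + 1/2 := Nat.floor_le (by positivity)
    have f2 : Real.exp u + 1/2 < n0 + 1 := Nat.lt_floor_add_one _
    have habs : |Real.exp u - n0| ≤ 1/2 := by rw [abs_le]; constructor <;> linarith
    have hn1 : 1 ≤ n0 := Nat.le_floor (by push_cast; linarith)
    have hn1r : (1:ℝ) ≤ n0 := by exact_mod_cast hn1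
    have hmem : n0 ∈ Finset.Ioc 0 N := by
      rw [Finset.mem_Ioc]
      refine ⟨by omega, Nat.floor_le_floor ?_⟩
      have := Real.exp_le_exp.mpr huL
      linarith
    have happ := hap u n0 hu0 (huL.trans (mul_le_of_le_one_left hL0.le hθ1)) habs
    have hsft : 2 * Real.pi * ∑ ρ ∈ S, (zetaMult ρ : ℂ) * Complex.exp (u * (ρ - 1/2)) = 2 * Real.pi * sft S u := rfl
    rw [hsft] at happ
    have hsp := norm_sq_split (2 * Real.pi * sft S u) (aa L n0 * sI T₁ T₂ (u - Real.log n0)) η hη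
    have hnorm : ‖(2 * Real.pi * sft S u : ℂ)‖^2 = 4 * Real.pi^2 * ‖sft S u‖^2 := by
      rw [norm_mul, norm_mul, Complex.norm_real, Real.norm_eq_abs, abs_of_pos Real.pi_pos, Complex.norm_ofNat]; ring
    have hnorm2 : ‖(aa L n0 * sI T₁ T₂ (u - Real.log n0) : ℂ)‖^2 = aa L n0^2 * ‖sI T₁ T₂ (u - Real.log n0)‖^2 := by
      rw [norm_mul, mul_pow, Complex.norm_real, Real.norm_eq_abs, sq_abs]
    rw [hnorm, hnorm2] at hsp
    have hrw : rr b θ α ≤ w n0 := by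
      obtain ⟨a1, a2⟩ := hlogn n0 hmem
      have hin : Real.log n0 / L ∈ Icc 0 (θ+1) := by
        refine ⟨by positivity, ?_⟩
        rw [div_le_iff₀ hL0, add_mul]; linarith
      have h3 := hlip α ⟨hα.1, by linarith [hα.2]⟩ _ hin
      have h4 : |u - Real.log n0| ≤ 1 := by
        have hl2 := Real.exp_one_gt_d9
        rw [abs_le]; constructor
        · have : Real.log n0 ≤ u + 1 := by
            have h5 : (n0:ℝ) ≤ Real.exp (u+1) := by rw [Real.exp_add]; linarith [mul_le_mul_of_nonneg_left (show (2:ℝ) ≤ Real.exp 1 by linarith) (Real.exp_pos u).le]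
            have := Real.log_le_log (by linarith) h5
            rwa [Real.log_exp] at this
          linarith
        · have : u ≤ Real.log n0 + 1 := by
            have h5 : Real.exp u ≤ Real.exp (Real.log n0 + 1) := by
              rw [Real.exp_add, Real.exp_log (by linarith)]; linarith [mul_le_mul_of_nonneg_left (show (2:ℝ) ≤ Real.exp 1 by linarith) (show (0:ℝ) ≤ n0 by linarith)]
            exact Real.exp_le_exp.mp h5
          linarith
      have h5 : |α - Real.log n0 / L| = |u - Real.log n0| / L := by
        rw [← abs_of_pos hL0, ← abs_div, abs_of_pos hL0]; congr 1; rw [hu]; field_simp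
      rw [h5] at h3
      have h6 : M * (|u - Real.log n0| / L) ≤ C0 / L := by
        rw [mul_div_assoc']
        gcongr
        have : 0 ≤ 1/θ := by positivity
        linarith [mul_le_mul_of_nonneg_left h4 hM]
      have := (abs_le.mp h3).2
      simp only [hw]; linarith
    have hmain : rr b θ α * (aa L n0^2 * ‖sI T₁ T₂ (u - Real.log n0)‖^2) ≤ ∑ n ∈ Finset.Ioc 0 N, w n * aa L n^2 * ‖sI T₁ T₂ (u - Real.log n)‖^2 := by
      have hs := Finset.single_le_sum (f := fun n => w n * aa L n^2 * ‖sI T₁ T₂ (u - Real.log n)‖^2) (fun n hn => by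
        have := hw0 n hn
        positivity) hmem
      refine le_trans ?_ hs
      rw [mul_assoc]
      gcongr
    have hX' : Real.exp (2 * (u * (c - 1/2))) ≤ X := by
      apply Real.exp_le_exp.mpr
      have : 0 ≤ 2 * c - 1 := by linarith
      linarith [mul_le_mul_of_nonneg_right huL this]
    have hrem : rr b θ α * ‖2 * Real.pi * sft S u - aa L n0 * sI T₁ T₂ (u - Real.log n0)‖^2 ≤ Ca * (U^2 / (1 + (U * L * α)^2)) + Ca * L^4 * X := by
      rw [mul_assoc U L α, ← hu]
      calc _ ≤ 1 * ‖2 * Real.pi * sft S u - aa L n0 * sI T₁ T₂ (u - Real.log n0)‖^2 := by gcongr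
        _ ≤ _ := by
          rw [one_mul]
          refine happ.trans ?_
          gcongr
    calc _ = rr b θ α * (4 * Real.pi^2 * ‖sft S u‖^2) := by ring
      _ ≤ rr b θ α * ((1+η) * (aa L n0^2 * ‖sI T₁ T₂ (u - Real.log n0)‖^2) + (1+1/η) * ‖2 * Real.pi * sft S u - aa L n0 * sI T₁ T₂ (u - Real.log n0)‖^2) := by gcongr
      _ = (1+η) * (rr b θ α * (aa L n0^2 * ‖sI T₁ T₂ (u - Real.log n0)‖^2)) + (1+1/η) * (rr b θ α * ‖2 * Real.pi * sft S u - aa L n0 * sI T₁ T₂ (u - Real.log n0)‖^2) := by ring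
      _ ≤ _ := by gcongr
  -- integrate
  have hsc := sI_continuous T₁ T₂
  have hc1 : Continuous (fun α => ∑ n ∈ Finset.Ioc 0 N, w n * aa L n^2 * ‖sI T₁ T₂ (L * α - Real.log n)‖^2) :=
    continuous_finsetSum _ fun n _ => by fun_prop
  have hc3 : Continuous (fun α => U^2 / (1 + (U * L * α)^2)) :=
    Continuous.div (by fun_prop) (by fun_prop) (fun x => by positivity)
  have hsf := sft_cont S
  have hrc := rr_cont b θ
  have hc4 : Continuous (fun α => (1+η) * ∑ n ∈ Finset.Ioc 0 N, w n * aa L n^2 * ‖sI T₁ T₂ (L * α - Real.log n)‖^2) := hc1.const_mul _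
  have hc5 : Continuous (fun α => Ca * (U^2 / (1 + (U * L * α)^2))) := hc3.const_mul _
  have hc6 : Continuous (fun α => (1+1/η) * (Ca * (U^2 / (1 + (U * L * α)^2)) + Ca * L^4 * X)) := (hc5.add continuous_const).const_mul _
  have hc7 : Continuous (fun α => 4 * Real.pi^2 * (rr b θ α * ‖sft S (L * α)‖^2)) := by fun_prop
  have hc8 : Continuous (fun α => (1+η) * (∑ n ∈ Finset.Ioc 0 N, w n * aa L n^2 * ‖sI T₁ T₂ (L * α - Real.log n)‖^2)
      + (1+1/η) * (Ca * (U^2 / (1 + (U * L * α)^2)) + Ca * L^4 * X)) := hc4.add hc6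
  have hmono := intervalIntegral.integral_mono_on (μ := volume) hθ.le
    (hc7.intervalIntegrable 0 θ) (hc8.intervalIntegrable 0 θ) hpt
  rw [intervalIntegral.integral_const_mul, intervalIntegral.integral_add (hc4.intervalIntegrable _ _) (hc6.intervalIntegrable _ _),
    intervalIntegral.integral_const_mul, intervalIntegral.integral_const_mul, intervalIntegral.integral_add (hc5.intervalIntegrable _ _) (by simp),
    intervalIntegral.integral_const_mul, intervalIntegral.integral_const, intervalIntegral.integral_finsetSum (fun n _ => Continuous.intervalIntegrable (by fun_prop) _ _)] at hmono
  simp only [intervalIntegral.integral_const_mul] at hmono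
  have hpart2 : ∫ α in (0:ℝ)..θ, U^2 / (1 + (U * L * α)^2) ≤ 2 * (U / L) := by
    have e := intervalIntegral.integral_comp_mul_left (a := 0) (b := θ) (fun x : ℝ => U^2 * (1 / (1 + x^2))) (c := U * L) (by positivity)
    simp only [mul_one_div] at e
    rw [e]
    simp only [← mul_one_div (U^2)]
    rw [intervalIntegral.integral_const_mul, integral_one_div_one_add_sq, mul_zero, Real.arctan_zero, sub_zero, smul_eq_mul]
    have h3 := Real.arctan_lt_pi_div_two (U * L * θ)
    have h4 := Real.pi_le_four
    calc _ ≤ (U * L)⁻¹ * (U^2 * 2) := by gcongr; linarith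
      _ = _ := by field_simp
  have hT : T₁ < T₂ := by linarith
  have hHU : T₂ - T₁ ≤ U + 3 := by linarith
  have hcell : ∀ n : ℕ, n ∈ Finset.Ioc 0 N → ∫ α in (0:ℝ)..θ, ‖sI T₁ T₂ (L * α - Real.log n)‖^2 ≤ 1 / L * (2 * (Real.pi * (U+3))) := by
    intro n hn
    obtain ⟨a1, a2⟩ := hlogn n hn
    rw [intervalIntegral.integral_comp_mul_sub (fun x => ‖sI T₁ T₂ x‖^2) hL0.ne', smul_eq_mul, ← one_div]
    gcongr
    have hnn : ∀ x, 0 ≤ ‖sI T₁ T₂ x‖^2 := fun x => by positivity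
    have hii : ∀ p q, IntervalIntegrable (fun x => ‖sI T₁ T₂ x‖^2) volume p q := fun p q => Continuous.intervalIntegrable (by fun_prop) _ _
    have h3 := intervalIntegral.integral_mono_interval (c := -Real.log n) (d := L * θ + 1 - Real.log n) (μ := volume) (f := fun x => ‖sI T₁ T₂ x‖^2) (a := L * 0 - Real.log n) (b := L * θ - Real.log n) (by simp) (by simp; positivity) (by linarith) (Eventually.of_forall hnn) (hii _ _)
    have h4 := sI_integral_le_two T₁ T₂ (Real.log n) (L * θ + 1 - Real.log n) hT a2 (by linarith)
    linarith [mul_le_mul_of_nonneg_left hHU Real.pi_pos.le]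
  have hcell1 : ∫ α in (0:ℝ)..θ, ‖sI T₁ T₂ (L * α - Real.log (1:ℕ))‖^2 ≤ 1 / L * (Real.pi * (U+3)) := by
    rw [intervalIntegral.integral_comp_mul_sub (fun x => ‖sI T₁ T₂ x‖^2) hL0.ne', smul_eq_mul, ← one_div]
    gcongr
    have h4 := sI_integral_le T₁ T₂ (L * θ) hT (by positivity)
    simp only [Nat.cast_one, Real.log_one, mul_zero, sub_zero]
    linarith [mul_le_mul_of_nonneg_left hHU Real.pi_pos.le]
  have h1mem : 1 ∈ Finset.Ioc 0 N := by simp; omega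
  have hps := hprime L hL1 N hN1 (hlogn N (by simp; omega)).1 hw0
  have hw1 : w 1 ≤ 1 + C0 / L := by
    simp [hw, rr]
  have hsumb : ∑ n ∈ Finset.Ioc 0 N, w n * aa L n^2 * ∫ α in (0:ℝ)..θ, ‖sI T₁ T₂ (L * α - Real.log n)‖^2
      ≤ Real.pi * (U+3) * (L * (1 + 2 * ∫ α in (0:ℝ)..θ, α * rr b θ α) + C1) := by
    set P := 1 / L * (Real.pi * (U+3)) with hP
    have hP0 : 0 ≤ P := by positivity
    have ht : ∀ n ∈ Finset.Ioc 0 N, w n * aa L n^2 * ∫ α in (0:ℝ)..θ, ‖sI T₁ T₂ (L * α - Real.log n)‖^2 ≤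
        (if n = 1 then w 1 * L^2 * P else 0) + 2 * P * (ArithmeticFunction.vonMangoldt n ^ 2 / n * w n) := by
      intro n hn
      have hwn := hw0 n hn
      by_cases h : n = 1
      · subst h
        rw [if_pos rfl]
        simp only [ArithmeticFunction.vonMangoldt_apply_one]
        have : aa L 1 = L := by simp [aa]
        rw [this]
        have h5 : w 1 * L^2 * ∫ α in (0:ℝ)..θ, ‖sI T₁ T₂ (L * α - Real.log (1:ℕ))‖^2 ≤ w 1 * L^2 * P := by gcongr
        simpa using h5
      · rw [if_neg h, aa_sq L n h, zero_add]
        have h5 := hcell n hn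
        have h6 : 0 ≤ w n * (ArithmeticFunction.vonMangoldt n ^ 2 / n) := by positivity
        calc _ ≤ w n * (ArithmeticFunction.vonMangoldt n ^ 2 / n) * (1 / L * (2 * (Real.pi * (U+3)))) := by gcongr
          _ = _ := by rw [hP]; ring
    refine (Finset.sum_le_sum ht).trans ?_
    rw [Finset.sum_add_distrib, Finset.sum_ite_eq' , if_pos h1mem, ← Finset.mul_sum]
    calc _ ≤ (1 + C0/L) * L^2 * P + 2 * P * (L^2 * (∫ α in (0:ℝ)..θ, α * rr b θ α) + Cp * L) := by gcongr
      _ = _ := by rw [hP, hC1]; field_simp; ring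
  refine hmono.trans ?_
  rw [smul_eq_mul, sub_zero]
  have hX0 : 0 < X := Real.exp_pos _
  set I1 := ∫ α in (0:ℝ)..θ, α * rr b θ α
  have hfin1 : (1+η) * (∑ n ∈ Finset.Ioc 0 N, w n * aa L n^2 * ∫ α in (0:ℝ)..θ, ‖sI T₁ T₂ (L * α - Real.log n)‖^2) ≤ (1+η) * (Real.pi * (U+3)) * (L * (1 + 2 * I1) + (C1 + C2)) := by
    rw [mul_assoc (1+η)]
    gcongr (1+η) * ?_
    refine hsumb.trans ?_
    gcongr
    linarith
  have hfin2 : (1+1/η) * (Ca * (∫ α in (0:ℝ)..θ, U^2 / (1 + (U * L * α)^2)) + θ * (Ca * L^4 * X)) ≤ (C1 + C2) * (U / L + L^4 * X) := by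
    calc _ ≤ (1+1/η) * (Ca * (2 * (U/L)) + 2 * (Ca * L^4 * X)) := by
          gcongr; linarith
      _ = C2 * (U / L + L^4 * X) := by rw [hC2]; ring
      _ ≤ _ := by
          gcongr
          have : 0 ≤ C1 := by positivity
          linarith
  linarith

lemma rr_int_pos (b θ : ℝ) (hθ : 0 < θ) : 0 < ∫ α in (0:ℝ)..θ, rr b θ α := by
  apply intervalIntegral.intervalIntegral_pos_of_pos_on ((rr_cont b θ).intervalIntegrable _ _) _ hθ
  intro x hx
  apply div_pos _ (Real.cosh_pos _)
  rw [sub_pos, div_lt_one hθ]; exact hx.2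

lemma rr_J_nonneg (b θ : ℝ) (hθ : 0 < θ) : 0 ≤ ∫ α in (0:ℝ)..θ, α * rr b θ α := by
  apply intervalIntegral.integral_nonneg hθ.le
  intro x hx
  apply mul_nonneg hx.1 (div_nonneg _ (Real.cosh_pos _).le)
  rw [sub_nonneg, div_le_one hθ]; exact hx.2

lemma asym2 (G J C D p : ℝ) (hAD : G * J < D) (hp : p < 1) : ∀ᶠ U : ℝ in atTop,
    G * (U + 3) * (Real.log U * J + C) + C * (U / Real.log U + Real.log U ^ 4 * Real.exp (p * Real.log U)) ≤ D * (U * Real.log U) := by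
  have hlog := Real.tendsto_log_atTop
  have l1 : Tendsto (fun U : ℝ => 1 + 3 / U) atTop (𝓝 (1 + 0)) := tendsto_const_nhds.add (tendsto_const_nhds.div_atTop tendsto_id)
  have l2 : Tendsto (fun U : ℝ => J + C / Real.log U) atTop (𝓝 (J + 0)) := tendsto_const_nhds.add (tendsto_const_nhds.div_atTop hlog)
  have l3 : Tendsto (fun U : ℝ => 1 / Real.log U ^ 2) atTop (𝓝 0) := tendsto_const_nhds.div_atTop ((tendsto_pow_atTop two_ne_zero).comp hlog)
  have l4 : Tendsto (fun U : ℝ => Real.log U ^ 3 / Real.exp ((1-p) * Real.log U)) atTop (𝓝 0) :=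
    ((isLittleO_pow_exp_pos_mul_atTop 3 (by linarith : 0 < 1 - p)).tendsto_div_nhds_zero).comp hlog
  have l5 : Tendsto (fun U : ℝ => G * (1 + 3 / U) * (J + C / Real.log U) + C * (1 / Real.log U ^ 2 + Real.log U ^ 3 / Real.exp ((1-p) * Real.log U))) atTop
      (𝓝 (G * (1 + 0) * (J + 0) + C * (0 + 0))) := (((l1.const_mul G).mul l2)).add ((l3.add l4).const_mul C)
  have h := l5.eventually_lt_const (u := D) (by simpa using hAD)
  filter_upwards [h, eventually_gt_atTop 1] with U hU hU1
  have hL : 0 < Real.log U := Real.log_pos hU1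
  have hU0 : 0 < U := by linarith
  have he : Real.exp (p * Real.log U) = U / Real.exp ((1-p) * Real.log U) := by
    rw [eq_div_iff (Real.exp_pos _).ne', ← Real.exp_add]
    conv_rhs => rw [← Real.exp_log hU0]
    congr 1; ring
  have h2 := mul_le_mul_of_nonneg_right hU.le (mul_pos hU0 hL).le
  refine le_trans (le_of_eq ?_) h2
  rw [he]
  have := (Real.exp_pos ((1-p) * Real.log U)).ne'
  field_simp

lemma final1 (b θ η c K : ℝ) (hb0 : 0 < b)
    (hbox : ∀ᶠ T in atTop, ∀ ρ ∈ zeroBand T, |ρ.re - 1/2| < b / (2 * Real.log T))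
    (hθ : 0 < θ) (hθ1 : θ ≤ 1) (hη : 0 < η) (hc : 1 < c) (hc2 : c ≤ 2) (hp : θ * (2 * c - 1) < 1)
    (hK : (1 + η) * (1 + 2 * ∫ α in (0:ℝ)..θ, α * rr b θ α) / (2 * ∫ α in (0:ℝ)..θ, rr b θ α) < K) :
    ∀ᶠ T : ℝ in atTop, (∑ᶠ ρ ∈ zeroBand T, (zetaMult ρ : ℝ) ^ 2) +
        (∑ᶠ ρ ∈ {ρ ∈ zeroBand T | ρ.re ≠ 1/2}, (zetaMult ρ : ℝ) ^ 2) ≤ K * (T / (2 * Real.pi)) * Real.log T := by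
  obtain ⟨C, hC, hup⟩ := upper b θ η c hθ hθ1 hη hc hc2
  have hI := rr_int_pos b θ hθ
  have hJ := rr_J_nonneg b θ hθ
  set I := ∫ α in (0:ℝ)..θ, rr b θ α
  set J := ∫ α in (0:ℝ)..θ, α * rr b θ α
  have hpi := Real.pi_pos
  have hK0 : 0 < K := lt_of_le_of_lt (by positivity) hK
  rw [div_lt_iff₀ (by positivity)] at hK
  have hAD : ((1+η) * Real.pi) * (1 + 2 * J) < 2 * Real.pi * I * K := by nlinarith
  have has := asym2 ((1+η) * Real.pi) (1+2*J) C _ (θ * (2*c-1)) hAD hp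
  have t1 : Tendsto (fun T : ℝ => T - 1) atTop atTop := tendsto_atTop_add_const_right _ (-1) tendsto_id
  have t2 : Tendsto (fun T : ℝ => T + 1) atTop atTop := tendsto_atTop_add_const_right _ 1 tendsto_id
  filter_upwards [t1.eventually has, t1.eventually hbox, t2.eventually hbox, eventually_ge_atTop 5] with T ha hb1 hb2 hT
  set U := T - 1 with hU
  have hTU : T = U + 1 := by rw [hU]; ring
  have hTU2 : T + 1 = U + 2 := by rw [hU]; ring
  rw [hTU2] at hb2
  have hU4 : 4 ≤ U := by linarith
  obtain ⟨T₁, T₂, S, h1, h1', h2, h2', hS, hmain⟩ := hup U hU4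
  have hL : 0 < Real.log U := Real.log_pos (by linarith)
  have hbd : ∀ ρ ∈ S, |ρ.re - 1/2| ≤ b / (2 * Real.log U) := by
    intro ρ hρ
    obtain ⟨z, r0, r1, i1, i2⟩ := (hS ρ).mp hρ
    by_cases h : ρ.im ≤ 2 * U
    · exact (hb1 ρ ⟨⟨z, r0, r1⟩, by linarith, h⟩).le
    · push Not at h
      refine (hb2 ρ ⟨⟨z, r0, r1⟩, by linarith, by linarith⟩).le.trans ?_
      have := Real.log_le_log (by linarith) (by linarith : U ≤ U + 2)
      gcongr
  have hlow := sft_lower S (fun ρ hρ => by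
      obtain ⟨z, r0, r1, i1, i2⟩ := (hS ρ).mp hρ
      rw [hS]
      refine ⟨zeta_symm_zero ρ r0 r1 z, ?_, ?_, ?_, ?_⟩ <;> simp <;> linarith)
    (fun ρ hρ => by
      obtain ⟨z, r0, r1, i1, i2⟩ := (hS ρ).mp hρ
      exact zetaMult_symm ρ r0 r1) b θ (Real.log U) hb0 hθ hL hbd
  have hsub : zeroBand T ⊆ (S : Set ℂ) := by
    rintro ρ ⟨⟨z, r0, r1⟩, i1, i2⟩
    exact (hS ρ).mpr ⟨z, r0, r1, by linarith, by linarith⟩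
  have key : ∀ (A : Set ℂ) (R : Finset ℂ), A ⊆ (R : Set ℂ) → ∑ᶠ ρ ∈ A, (zetaMult ρ : ℝ) ^ 2 ≤ ∑ ρ ∈ R, (zetaMult ρ : ℝ) ^ 2 := by
    intro A R h
    have hf : A.Finite := R.finite_toSet.subset h
    rw [finsum_mem_eq_finite_toFinset_sum _ hf]
    apply Finset.sum_le_sum_of_subset_of_nonneg
    · intro x hx
      exact h (by simpa using hx)
    · intros; positivity
  have k1 := key _ _ hsub
  have k2 := key {ρ ∈ zeroBand T | ρ.re ≠ 1/2} (S.filter (fun ρ => ρ.re ≠ 1/2)) (by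
    rintro ρ ⟨h, h'⟩
    have := hsub h
    simp only [Finset.coe_filter, mem_ofPred_eq]
    exact ⟨this, h'⟩)
  set Q := (∑ ρ ∈ S, (zetaMult ρ:ℝ)^2) + ∑ ρ ∈ S with ρ.re ≠ 1/2, (zetaMult ρ:ℝ)^2
  have hQ : 4 * Real.pi^2 * (I * Q) ≤ 2 * Real.pi * I * K * (U * Real.log U) := by
    refine le_trans (mul_le_mul_of_nonneg_left hlow (by positivity)) (hmain.trans (le_trans (le_of_eq ?_) ha))
    ring
  have hQ2 : Q ≤ K * (U / (2 * Real.pi)) * Real.log U := by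
    have : 4 * Real.pi^2 * (I * Q) ≤ 4 * Real.pi^2 * (I * (K * (U / (2 * Real.pi)) * Real.log U)) := by
      refine hQ.trans (le_of_eq ?_)
      field_simp; ring
    exact le_of_mul_le_mul_left (le_of_mul_le_mul_left this (by positivity)) hI
  have hfin : K * (U / (2 * Real.pi)) * Real.log U ≤ K * (T / (2 * Real.pi)) * Real.log T := by
    have h3 : U ≤ T := by linarith
    have := Real.log_le_log (by linarith) h3
    gcongr
  exact (add_le_add k1 k2).trans (hQ2.trans hfin)

lemma rr_lim (b : ℝ) : Tendsto (fun θ : ℝ => (1 + (1 - θ)) * (1 + 2 * ∫ α in (0:ℝ)..θ, α * rr b θ α) / (2 * ∫ α in (0:ℝ)..θ, rr b θ α)) (𝓝[<] 1)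
    (𝓝 ((1 + 2 * ∫ α in (0:ℝ)..1, α * (1 - α) / Real.cosh (b * α)) / (2 * ∫ α in (0:ℝ)..1, (1 - α) / Real.cosh (b * α)))) := by
  have hch : ∀ x, Real.cosh x ≠ 0 := fun x => (Real.cosh_pos x).ne'
  have hg : ∀ k : ℕ, Continuous (fun α : ℝ => α^k / Real.cosh (b * α)) := fun k =>
    Continuous.div (by fun_prop) (by fun_prop) (fun x => hch _)
  have hA : ∀ k : ℕ, Continuous (fun θ : ℝ => ∫ α in (0:ℝ)..θ, α^k / Real.cosh (b * α)) := fun k =>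
    intervalIntegral.continuous_primitive (fun p q => (hg k).intervalIntegrable p q) 0
  have e1 : ∀ θ : ℝ, ∫ α in (0:ℝ)..θ, rr b θ α = (∫ α in (0:ℝ)..θ, α^0 / Real.cosh (b * α)) - 1/θ * ∫ α in (0:ℝ)..θ, α^1 / Real.cosh (b * α) := by
    intro θ
    rw [← intervalIntegral.integral_const_mul, ← intervalIntegral.integral_sub ((hg 0).intervalIntegrable _ _) (((hg 1).const_mul _).intervalIntegrable _ _)]
    congr 1; ext α; simp only [rr]; ring
  have e2 : ∀ θ : ℝ, ∫ α in (0:ℝ)..θ, α * rr b θ α = (∫ α in (0:ℝ)..θ, α^1 / Real.cosh (b * α)) - 1/θ * ∫ α in (0:ℝ)..θ, α^2 / Real.cosh (b * α) := by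
    intro θ
    rw [← intervalIntegral.integral_const_mul, ← intervalIntegral.integral_sub ((hg 1).intervalIntegrable _ _) (((hg 2).const_mul _).intervalIntegrable _ _)]
    congr 1; ext α; simp only [rr]; ring
  have hinv : ContinuousAt (fun θ : ℝ => 1/θ) 1 := ContinuousAt.div (by fun_prop) (by fun_prop) one_ne_zero
  have c1 : ContinuousAt (fun θ : ℝ => ∫ α in (0:ℝ)..θ, rr b θ α) 1 := by
    simp only [e1]
    exact (hA 0).continuousAt.sub (hinv.mul (hA 1).continuousAt)
  have c2 : ContinuousAt (fun θ : ℝ => ∫ α in (0:ℝ)..θ, α * rr b θ α) 1 := by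
    simp only [e2]
    exact (hA 1).continuousAt.sub (hinv.mul (hA 2).continuousAt)
  have hI := rr_int_pos b 1 one_pos
  have c3 : ContinuousAt (fun θ : ℝ => (1 + (1 - θ)) * (1 + 2 * ∫ α in (0:ℝ)..θ, α * rr b θ α) / (2 * ∫ α in (0:ℝ)..θ, rr b θ α)) 1 := by
    refine ContinuousAt.div (ContinuousAt.mul (by fun_prop) ?_) ?_ (by positivity)
    · exact continuousAt_const.add (continuousAt_const.mul c2)
    · exact continuousAt_const.mul c1
  have := c3.tendsto.mono_left (nhdsWithin_le_nhds (s := Iio 1))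
  simpa [rr, mul_div_assoc] using this

theorem multiplicity_sum_bound (b : ℝ) (hb0 : 0 < b) (hb1 : b ≤ 1)
    (hbox : ∀ᶠ T in atTop, ∀ ρ ∈ zeroBand T, |ρ.re - 1/2| < b / (2 * Real.log T)) :
    ∃ ε : ℝ → ℝ, Tendsto ε atTop (nhds 0) ∧
      ∀ᶠ T in atTop,
        (∑ᶠ ρ ∈ zeroBand T, (zetaMult ρ : ℝ) ^ 2) +
        (∑ᶠ ρ ∈ {ρ ∈ zeroBand T | ρ.re ≠ 1/2}, (zetaMult ρ : ℝ) ^ 2)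
        ≤ ((1 + 2 * ∫ α in (0:ℝ)..1, α * (1 - α) / Real.cosh (b * α)) /
            (2 * ∫ α in (0:ℝ)..1, (1 - α) / Real.cosh (b * α)) + ε T) *
          (T / (2 * Real.pi)) * Real.log T := by
  have hlim := rr_lim b
  set Cb := (1 + 2 * ∫ α in (0:ℝ)..1, α * (1 - α) / Real.cosh (b * α)) /
            (2 * ∫ α in (0:ℝ)..1, (1 - α) / Real.cosh (b * α)) with hCb
  set Q : ℝ → ℝ := fun T => (∑ᶠ ρ ∈ zeroBand T, (zetaMult ρ : ℝ) ^ 2) +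
        (∑ᶠ ρ ∈ {ρ ∈ zeroBand T | ρ.re ≠ 1/2}, (zetaMult ρ : ℝ) ^ 2) with hQ
  have hpi := Real.pi_pos
  have hev : ∀ δ > 0, ∀ᶠ T : ℝ in atTop, Q T ≤ (Cb + δ) * (T / (2 * Real.pi)) * Real.log T := by
    intro δ hδ
    have h1 := hlim.eventually_lt_const (u := Cb + δ) (by linarith)
    have h2 : ∀ᶠ θ : ℝ in 𝓝[<] 1, θ ∈ Ioo (0:ℝ) 1 := Ioo_mem_nhdsLT one_pos
    obtain ⟨θ, hK, hθ0, hθ1⟩ := (h1.and h2).exists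
    exact final1 b θ (1-θ) (1 + (1-θ)/2) (Cb + δ) hb0 hbox hθ0 hθ1.le (by linarith) (by linarith) (by linarith) (by nlinarith) hK
  refine ⟨fun T => max 0 (Q T / ((T / (2 * Real.pi)) * Real.log T) - Cb), ?_, ?_⟩
  · rw [Metric.tendsto_nhds]
    intro δ hδ
    filter_upwards [hev (δ/2) (by linarith), eventually_gt_atTop 1] with T hT hT1
    have hL := Real.log_pos hT1
    have hm : 0 < (T / (2 * Real.pi)) * Real.log T := by positivity
    rw [mul_assoc, ← div_le_iff₀ hm] at hT
    rw [Real.dist_eq, sub_zero, abs_of_nonneg (le_max_left _ _)]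
    exact max_lt hδ (by linarith)
  · filter_upwards [eventually_gt_atTop 1] with T hT1
    have hL := Real.log_pos hT1
    have hm : 0 < (T / (2 * Real.pi)) * Real.log T := by positivity
    change Q T ≤ _
    rw [mul_assoc, ← div_le_iff₀ hm]
    have := le_max_right 0 (Q T / ((T / (2 * Real.pi)) * Real.log T) - Cb)
    linarith
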